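/- arXiv:2112.03663 — 11 statements merged into one kernel-verified Lean document; each statement's English description precedes it below -/
import Mathlib

section
/- Let D > 1 be a squarefree positive integer with D ≡ 1 or 2 (mod 4) (equivalently −D ≡ 3 or 2 (mod 4)), and suppose that every element of the ideal class group of the imaginary quadratic field ℚ(√(−D)) has order dividing 2. Let c > 1 be a positive integer whose prime factorization is c = p₁^{n₁} ⋯ p_k^{n_k} with p₁, …, p_k distinct odd primes such that the Legendre symbol (−D/pᵢ) = 1 for every 1 ≤ i ≤ k. Then the number of normalized solutions of x² + D y² = z² of the form (a, b, c) is exactly 2^{k−1}. -/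
/-- lifting roots -/
lemma root_lift (p : ℕ) (hp : p.Prime) (h2 : p ≠ 2) (D : ℤ) (hD : ¬ (p:ℤ) ∣ D)
    (r0 : ℤ) (h0 : (p:ℤ) ∣ r0 ^ 2 + D) (n : ℕ) (hn : 0 < n) :
    ∃ r : ℤ, ((p:ℤ) ^ n) ∣ r ^ 2 + D := by
  induction n, hn using Nat.le_induction with
  | base => exact ⟨r0, by simpa using h0⟩
  | succ n hn ih =>
    obtain ⟨r, m, hm⟩ := ih
    have hpp : Prime (p:ℤ) := Nat.prime_iff_prime_int.mp hp
    have hpr : ¬ (p:ℤ) ∣ 2 * r := by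
      intro h
      rcases hpp.dvd_or_dvd h with h | h
      · have : p ∣ 2 := by exact_mod_cast h
        exact h2 ((Nat.prime_dvd_prime_iff_eq hp Nat.prime_two).1 this)
      · apply hD
        have h1 : (p:ℤ) ∣ r ^ 2 + D := hm ▸ (dvd_pow_self _ (by omega)).mul_right _
        have h3 : (p:ℤ) ∣ r ^ 2 := h.trans (dvd_pow_self _ (by omega))
        exact (Int.dvd_add_right h3).1 h1
    have hcop : IsCoprime (2 * r) (p:ℤ) := ((Prime.coprime_iff_not_dvd hpp).2 hpr).symm
    obtain ⟨u, v, huv⟩ := hcop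
    refine ⟨r - (p:ℤ)^n * u * m, ?_⟩
    have hk : (p:ℤ)^(n+1) ∣ (p:ℤ)^n * (p:ℤ)^n := by
      rw [← pow_add]; exact pow_dvd_pow _ (by omega)
    have : (r - (p:ℤ)^n * u * m)^2 + D
        = (p:ℤ)^(n+1) * (v * m) + (p:ℤ)^n * (p:ℤ)^n * (u*m)^2 := by
      linear_combination hm - (p:ℤ)^n * m * huv
    rw [this]
    exact dvd_add (dvd_mul_right _ _) (hk.mul_right _)

lemma root_card_pp (p : ℕ) (hp : p.Prime) (h2 : p ≠ 2) (D : ℤ) (hl : @legendreSym p ⟨hp⟩ (-D) = 1)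
    (n : ℕ) (hn : 0 < n) : {r : ZMod (p ^ n) | r ^ 2 = -(D : ZMod (p ^ n))}.ncard = 2 := by
  haveI : Fact p.Prime := ⟨hp⟩
  have hpp : Prime (p:ℤ) := Nat.prime_iff_prime_int.mp hp
  have hne : ((-D : ℤ) : ZMod p) ≠ 0 := by
    intro h
    rw [(legendreSym.eq_zero_iff p (-D)).2 h] at hl
    omega
  have hD : ¬ (p:ℤ) ∣ D := by
    intro h; apply hne
    rw [ZMod.intCast_zmod_eq_zero_iff_dvd] 
    exact (dvd_neg).2 h
  obtain ⟨x, hx⟩ := (legendreSym.eq_one_iff p hne).1 hl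
  obtain ⟨r0, rfl⟩ := ZMod.intCast_surjective x
  have h0 : (p:ℤ) ∣ r0 ^ 2 + D := by
    rw [← ZMod.intCast_zmod_eq_zero_iff_dvd]
    push_cast at hx ⊢
    linear_combination -hx
  obtain ⟨r, hr⟩ := root_lift p hp h2 D hD r0 h0 n hn
  have hpr : ¬ (p:ℤ) ∣ 2 * r := by
    intro h
    rcases hpp.dvd_or_dvd h with h | h
    · have : p ∣ 2 := by exact_mod_cast h
      exact h2 ((Nat.prime_dvd_prime_iff_eq hp Nat.prime_two).1 this)
    · apply hD
      have h1 : (p:ℤ) ∣ r ^ 2 + D := (dvd_pow_self _ (by omega)).trans hr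
      have h3 : (p:ℤ) ∣ r ^ 2 := h.trans (dvd_pow_self _ (by omega))
      exact (Int.dvd_add_right h3).1 h1
  rw [Set.ncard_eq_two]
  refine ⟨(r : ZMod (p^n)), -(r : ZMod (p^n)), ?_, ?_⟩
  · intro h
    have h' : ((2 * r : ℤ) : ZMod (p^n)) = 0 := by push_cast; linear_combination h
    rw [ZMod.intCast_zmod_eq_zero_iff_dvd] at h'
    push_cast at h'
    exact hpr ((dvd_pow_self _ (by omega)).trans h')
  · have hr' : (r : ZMod (p^n))^2 = -(D : ZMod (p ^ n)) := by
      have : ((r^2 + D : ℤ) : ZMod (p^n)) = 0 := by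
        rw [ZMod.intCast_zmod_eq_zero_iff_dvd]; exact_mod_cast hr
      push_cast at this
      linear_combination this
    ext s
    simp only [Set.mem_setOf_eq, Set.mem_insert_iff, Set.mem_singleton_iff]
    constructor
    · intro hs
      obtain ⟨s, rfl⟩ := ZMod.intCast_surjective s
      have h1 : (((s - r) * (s + r) : ℤ) : ZMod (p^n)) = 0 := by
        push_cast; linear_combination hs - hr'
      rw [ZMod.intCast_zmod_eq_zero_iff_dvd] at h1
      push_cast at h1
      by_cases hps : (p:ℤ) ∣ s - r
      · left
        have : ¬ (p:ℤ) ∣ s + r := fun h => hpr (by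
          have := dvd_sub h hps
          ring_nf at this ⊢; exact this)
        have hc : IsCoprime ((p:ℤ)^n) (s + r) := (hpp.coprime_iff_not_dvd.2 this).pow_left
        have := hc.dvd_of_dvd_mul_right h1
        have h4 : ((s - r : ℤ) : ZMod (p^n)) = 0 := by
          rw [ZMod.intCast_zmod_eq_zero_iff_dvd]; exact_mod_cast this
        push_cast at h4; linear_combination h4
      · right
        have hc : IsCoprime ((p:ℤ)^n) (s - r) := (hpp.coprime_iff_not_dvd.2 hps).pow_left
        have := hc.dvd_of_dvd_mul_left h1
        have h4 : ((s + r : ℤ) : ZMod (p^n)) = 0 := by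
          rw [ZMod.intCast_zmod_eq_zero_iff_dvd]; exact_mod_cast this
        push_cast at h4; linear_combination h4
    · rintro (rfl | rfl)
      · exact hr'
      · rw [neg_sq]; exact hr'

lemma root_card (D : ℤ) (c : ℕ) (hc : 0 < c)
    (hfac : ∀ p ∈ c.primeFactors, ∃ hp : p.Prime,
      p ≠ 2 ∧ @legendreSym p ⟨hp⟩ (-D) = 1) :
    {r : ZMod c | r ^ 2 = -(D : ZMod c)}.ncard = 2 ^ c.primeFactors.card := by
  induction c using Nat.recOnPosPrimePosCoprime with
  | zero => omega
  | one =>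
    have : {r : ZMod 1 | r ^ 2 = -(D : ZMod 1)} = {0} := by
      ext x; simp; exact ⟨fun _ => Subsingleton.elim _ _, fun _ => Subsingleton.elim _ _⟩
    rw [this]; simp
  | prime_pow p n hp hn =>
    rw [Nat.primeFactors_prime_pow hn.ne' hp] at hfac ⊢
    obtain ⟨_, h2, hl⟩ := hfac p (by simp)
    rw [root_card_pp p hp h2 D hl n hn]; simp
  | coprime a b ha hb hab iha ihb =>
    have h1 := iha (by omega) (fun p hp => hfac p (by
      rw [hab.primeFactors_mul]; exact Finset.mem_union_left _ hp))
    have h2 := ihb (by omega) (fun p hp => hfac p (by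
      rw [hab.primeFactors_mul]; exact Finset.mem_union_right _ hp))
    rw [hab.primeFactors_mul, Finset.card_union_of_disjoint hab.disjoint_primeFactors, pow_add,
      ← h1, ← h2, ← Set.ncard_prod]
    let e := ZMod.chineseRemainder hab
    rw [← Set.ncard_image_of_injective _ e.injective]
    congr 1
    ext ⟨x, y⟩
    simp only [Set.mem_image, Set.mem_setOf_eq, Set.mem_prod]
    constructor
    · rintro ⟨r, hr, he⟩
      have := congrArg e hr
      rw [map_pow, map_neg, map_intCast, he] at this
      have h3 := congrArg Prod.fst this
      have h4 := congrArg Prod.snd this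
      simp at h3 h4
      exact ⟨h3, h4⟩
    · rintro ⟨hx, hy⟩
      refine ⟨e.symm (x, y), ?_, by simp⟩
      apply e.injective
      rw [map_pow, map_neg, map_intCast, e.apply_symm_apply]
      ext <;> simp [hx, hy]

lemma int_of_half (D : ℕ) (hsq : Squarefree D)
    (hmod : D % 4 = 1 ∨ D % 4 = 2) (u v : ℚ) (A N : ℤ) (hA : 2 * u = A)
    (hN : u ^ 2 + D * v ^ 2 = N) : ∃ x y : ℤ, u = x ∧ v = y := by
  have h1 : (D:ℚ) * (2 * v) ^ 2 = ((4 * N - A ^ 2 : ℤ) : ℚ) := by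
    push_cast; rw [← hA, ← hN]; ring
  obtain ⟨B, hB⟩ : ∃ B : ℤ, 2 * v = B := by
    generalize 2 * v = w at h1
    have hd : (w.den : ℚ) ≠ 0 := by exact_mod_cast w.den_ne_zero
    have h2 : (D:ℤ) * w.num ^ 2 = (4 * N - A ^ 2) * (w.den:ℤ) ^ 2 := by
      have h3 : (D:ℚ) * w.num ^ 2 = ((4 * N - A ^ 2 : ℤ) : ℚ) * (w.den:ℚ) ^ 2 := by
        rw [← h1]
        have := Rat.num_div_den w
        have : (w.num : ℚ) = w * w.den := by field_simp at this ⊢; linarith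
        rw [this]; ring
      exact_mod_cast h3
    have hcop : IsCoprime ((w.den:ℤ) ^ 2) (w.num ^ 2) := by
      apply IsCoprime.pow
      rw [Int.isCoprime_iff_nat_coprime]
      simpa using w.reduced.symm
    have h4 : ((w.den:ℤ) ^ 2) ∣ D := hcop.dvd_of_dvd_mul_right (h2 ▸ dvd_mul_left _ _)
    have h5 : w.den * w.den ∣ D := by rw [← sq]; exact_mod_cast h4
    have h6 := Nat.isUnit_iff.1 (hsq _ h5)
    exact ⟨w.num, ((Rat.den_eq_one_iff w).1 h6).symm⟩
  have h7 : (D:ℤ) * B ^ 2 = 4 * N - A ^ 2 := by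
    rw [hB] at h1; exact_mod_cast h1
  have key : A % 2 = 0 ∧ B % 2 = 0 := by
    obtain ⟨d, hd⟩ : ∃ d : ℤ, (D:ℤ) = 4 * d + 1 ∨ (D:ℤ) = 4 * d + 2 := ⟨(D:ℤ) / 4, by omega⟩
    have hA4 := Int.emod_add_mul_ediv A 2
    have hB4 := Int.emod_add_mul_ediv B 2
    generalize A / 2 = a' at *
    generalize B / 2 = b' at *
    rcases Int.emod_two_eq_zero_or_one A with ha | ha <;>
    rcases Int.emod_two_eq_zero_or_one B with hb | hb <;> rw [ha] at hA4 ⊢ <;> rw [hb] at hB4 ⊢ <;> 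
    rw [← hA4, ← hB4] at h7 <;>
    rcases hd with hd | hd <;> rw [hd] at h7 <;> ring_nf at h7 <;> first | simp; done | (exfalso; omega) 
  refine ⟨A / 2, B / 2, ?_, ?_⟩
  · have : A = 2 * (A / 2) := by omega
    have h : (A:ℚ) = 2 * ((A / 2 : ℤ) : ℚ) := by exact_mod_cast this
    linarith
  · have : B = 2 * (B / 2) := by omega
    have h : (B:ℚ) = 2 * ((B / 2 : ℤ) : ℚ) := by exact_mod_cast this
    linarith

lemma integral_form (D : ℕ) (hD : 1 < D) (hsq : Squarefree D)
    (hmod : D % 4 = 1 ∨ D % 4 = 2)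
    (K : Type) [Field K] [NumberField K] (ω : K) (hω : ω ^ 2 = -(D : K))
    (hgen : Algebra.adjoin ℚ {ω} = ⊤) (θ : K) (hθ : IsIntegral ℤ θ) :
    ∃ x y : ℤ, θ = x + y * ω := by
  have h1 : ∃ u v : ℚ, θ = u + v * ω := by
    have hm : θ ∈ Algebra.adjoin ℚ {ω} := by rw [hgen]; trivial
    clear hθ
    induction hm using Algebra.adjoin_induction with
    | mem x hx => exact ⟨0, 1, by simp at hx; simp [hx]⟩
    | algebraMap r => exact ⟨r, 0, by simp⟩
    | add x y hx hy h1 h2 =>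
      obtain ⟨u, v, rfl⟩ := h1
      obtain ⟨u', v', rfl⟩ := h2
      exact ⟨u + u', v + v', by push_cast; ring⟩
    | mul x y hx hy h1 h2 =>
      obtain ⟨u, v, rfl⟩ := h1
      obtain ⟨u', v', rfl⟩ := h2
      exact ⟨u * u' - D * (v * v'), u * v' + v * u', by
        push_cast; linear_combination (v * v' : K) * hω⟩
  obtain ⟨u, v, huv⟩ := h1
  suffices h : ∃ A N : ℤ, 2 * u = A ∧ u ^ 2 + D * v ^ 2 = N by
    obtain ⟨A, N, hA, hN⟩ := h
    obtain ⟨x, y, rfl, rfl⟩ := int_of_half D hsq hmod u v A N hA hN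
    exact ⟨x, y, by rw [huv]; simp⟩
  by_cases hv : v = 0
  · have h2 : IsIntegral ℤ u := by
      rw [hv] at huv
      have : θ = algebraMap ℚ K u := by rw [huv]; simp
      rw [this] at hθ
      exact (isIntegral_algebraMap_iff (algebraMap ℚ K).injective).1 hθ
    obtain ⟨n, hn⟩ := IsIntegrallyClosed.isIntegral_iff.1 h2
    refine ⟨2 * n, n ^ 2, ?_, ?_⟩ <;> simp [← hn, hv]
  · let p : Polynomial ℚ := Polynomial.X ^ 2 + Polynomial.C (-2 * u) * Polynomial.X + Polynomial.C (u^2 + D * v^2)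
    have hpm : p.Monic := by unfold p; monicity!
    have hpd : p.degree = 2 := by unfold p; compute_degree!
    have hp0 : Polynomial.aeval θ p = 0 := by
      simp [p, huv]
      linear_combination (v ^ 2 : K) * hω
    have hθQ : IsIntegral ℚ θ := hθ.tower_top
    have hnot : θ ∉ (algebraMap ℚ K).range := by
      rintro ⟨q, hq⟩
      have h3 : (v : K) * ω = ((q - u : ℚ) : K) := by
        push_cast
        rw [huv] at hq
        simp at hq
        rw [hq]; ring
      have h4 : ((v ^ 2 * (-D) : ℚ) : K) = (((q - u)^2 : ℚ) : K) := by
        rw [Rat.cast_pow, ← h3]; push_cast; linear_combination -(v ^ 2 : K) * hω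
      have h5 : v ^ 2 * (-D : ℚ) = (q - u)^2 := by exact_mod_cast h4
      have : 0 < v ^ 2 * (D:ℚ) := by
        have : (0:ℚ) < D := by exact_mod_cast (by omega : 0 < D)
        positivity
      nlinarith [sq_nonneg (q - u)]
    have hmin : p = minpoly ℚ θ := by
      apply minpoly.unique ℚ θ hpm hp0
      intro q hq hq0
      have h6 := (minpoly.two_le_natDegree_iff hθQ).2 hnot
      have h7 := minpoly.min ℚ θ hq hq0
      rw [hpd]
      refine le_trans ?_ h7
      rw [Polynomial.degree_eq_natDegree (minpoly.ne_zero hθQ)]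
      exact_mod_cast h6
    have hz := minpoly.isIntegrallyClosed_eq_field_fractions' ℚ hθ
    rw [← hmin] at hz
    have c0 := congrArg (fun q => Polynomial.coeff q 0) hz
    have c1 := congrArg (fun q => Polynomial.coeff q 1) hz
    simp only [p, Polynomial.coeff_map, Polynomial.coeff_add, Polynomial.coeff_C_mul,
      Polynomial.coeff_C, Polynomial.coeff_X, Polynomial.coeff_X_pow] at c0 c1
    norm_num at c0 c1
    exact ⟨-(minpoly ℤ θ).coeff 1, (minpoly ℤ θ).coeff 0, by push_cast; linarith, c0⟩

lemma ring_equiv (D : ℕ) (hD : 1 < D) (hsq : Squarefree D)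
    (hmod : D % 4 = 1 ∨ D % 4 = 2)
    (K : Type) [Field K] [NumberField K] (ω : K) (hω : ω ^ 2 = -(D : K))
    (hgen : Algebra.adjoin ℚ {ω} = ⊤) :
    Nonempty (Zsqrtd (-(D:ℤ)) ≃+* NumberField.RingOfIntegers K) := by
  have hint : IsIntegral ℤ ω := by
    refine ⟨Polynomial.X ^ 2 + Polynomial.C (D:ℤ), by monicity!, by simp [hω]⟩
  let w : NumberField.RingOfIntegers K := ⟨ω, hint⟩
  have hw : w * w = ((-(D:ℤ) : ℤ) : NumberField.RingOfIntegers K) := by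
    apply NumberField.RingOfIntegers.ext
    have : ((w * w : NumberField.RingOfIntegers K) : K) = ω * ω := rfl
    rw [this, ← sq, hω]; simp
  refine ⟨RingEquiv.ofBijective (Zsqrtd.lift ⟨w, hw⟩) ⟨?_, ?_⟩⟩
  · apply Zsqrtd.lift_injective
    intro n h
    nlinarith [mul_self_nonneg n]
  · intro θ
    obtain ⟨x, y, hxy⟩ := integral_form D hD hsq hmod K ω hω hgen θ θ.2
    refine ⟨⟨x, y⟩, ?_⟩
    apply NumberField.RingOfIntegers.ext
    have h : ((w : NumberField.RingOfIntegers K) : K) = ω := rfl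
    simp only [Zsqrtd.lift, Equiv.coe_fn_mk, RingHom.coe_mk, MonoidHom.coe_mk, OneHom.coe_mk]
    rw [hxy, ← h]
    change algebraMap (NumberField.RingOfIntegers K) K _ = x + y * algebraMap (NumberField.RingOfIntegers K) K w
    rw [map_add, map_mul, map_intCast, map_intCast]

lemma sq_principal (R S : Type) [CommRing R] [IsDomain R] [CommRing S] [IsDedekindDomain S] (e : R ≃+* S)
    (hcg : ∀ g : ClassGroup S, g ^ 2 = 1) (J : Ideal R) (hJ : J ≠ ⊥) :
    ∃ α, J * J = Ideal.span {α} := by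
  have hJ' : J.map e ≠ ⊥ := by
    intro h
    exact hJ ((Ideal.map_eq_bot_iff_of_injective e.injective).1 h)
  have h1 := hcg (ClassGroup.mk0 ⟨J.map e, mem_nonZeroDivisors_of_ne_zero hJ'⟩)
  rw [← map_pow] at h1
  have h2 := (ClassGroup.mk0_eq_one_iff _).1 h1
  obtain ⟨β, hβ⟩ := h2
  refine ⟨e.symm β, ?_⟩
  have h3 : (J * J).map e = Ideal.span {β} := by
    rw [Ideal.map_mul, ← sq]; exact hβ
  have h4 := congrArg (Ideal.map e.symm) h3
  rw [Ideal.map_span] at h4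
  have h5 : Ideal.map e.symm (Ideal.map e (J * J)) = J * J := Ideal.map_of_equiv e
  rw [← h5, h4]; simp

lemma exists_sol (D c : ℕ) (hD : 1 < D) (hc : 0 < c) (r : ℤ) (hcr : IsCoprime (c:ℤ) (2 * r))
    (hr : (c:ℤ) ∣ r ^ 2 + D)
    (hprin : ∀ J : Ideal (Zsqrtd (-(D:ℤ))), J ≠ ⊥ → ∃ α, J * J = Ideal.span {α}) :
    ∃ x y : ℤ, x ^ 2 + D * y ^ 2 = (c:ℤ) ^ 2 ∧ IsCoprime x y ∧ (c:ℤ) ∣ x - r * y := by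
  let J : Ideal (Zsqrtd (-(D:ℤ))) := Ideal.span {((c:ℤ) : Zsqrtd (-(D:ℤ))), ⟨r, 1⟩}
  let Jb : Ideal (Zsqrtd (-(D:ℤ))) := Ideal.span {((c:ℤ) : Zsqrtd (-(D:ℤ))), ⟨r, -1⟩}
  have hJ0 : J ≠ ⊥ := by
    intro h
    have : ((⟨r, 1⟩ : Zsqrtd (-(D:ℤ)))) ∈ J := Ideal.subset_span (by simp)
    rw [h, Ideal.mem_bot, Zsqrtd.ext_iff] at this
    simp at this
  obtain ⟨α, hα⟩ := hprin J hJ0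
  have hmap : J.map (starRingEnd (Zsqrtd (-(D:ℤ)))) = Jb := by
    simp only [J, Jb, Ideal.map_span, Set.image_pair]
    congr 2
  have hα' : Jb * Jb = Ideal.span {star α} := by
    rw [← hmap, ← Ideal.map_mul, hα, Ideal.map_span]; simp [starRingEnd_apply]
  obtain ⟨m, hm⟩ := hr
  have hJJ : J * Jb = Ideal.span {((c:ℤ) : Zsqrtd (-(D:ℤ)))} := by
    apply le_antisymm
    · simp only [J, Jb, Ideal.span_pair_mul_span_pair]
      rw [Ideal.span_le]
      have e : ((⟨r, 1⟩ * ⟨r, -1⟩ : Zsqrtd (-(D:ℤ)))) = ((c:ℤ) : Zsqrtd (-(D:ℤ))) * (m : ℤ) := by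
        ext
        · simp; linear_combination hm
        · simp
      intro z hz
      simp only [Set.mem_insert_iff, Set.mem_singleton_iff] at hz
      rw [SetLike.mem_coe, Ideal.mem_span_singleton]
      rcases hz with rfl | rfl | rfl | rfl
      · exact dvd_mul_right _ _
      · exact dvd_mul_right _ _
      · exact dvd_mul_left _ _
      · rw [e]; exact dvd_mul_right _ _
    · rw [Ideal.span_singleton_le_iff_mem]
      obtain ⟨u, v, huv⟩ := hcr
      have h1 : ((c:ℤ) : Zsqrtd (-(D:ℤ))) ∈ J := Ideal.subset_span (by simp)
      have h2 : (⟨r, 1⟩ : Zsqrtd (-(D:ℤ))) ∈ J := Ideal.subset_span (by simp)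
      have h3 : ((c:ℤ) : Zsqrtd (-(D:ℤ))) ∈ Jb := Ideal.subset_span (by simp)
      have h4 : (⟨r, -1⟩ : Zsqrtd (-(D:ℤ))) ∈ Jb := Ideal.subset_span (by simp)
      have e : ((c:ℤ) : Zsqrtd (-(D:ℤ))) = (u : ℤ) * (((c:ℤ) : Zsqrtd (-(D:ℤ))) * ((c:ℤ) : Zsqrtd (-(D:ℤ))))
          + (v : ℤ) * (⟨r, 1⟩ * ((c:ℤ) : Zsqrtd (-(D:ℤ))) + ((c:ℤ) : Zsqrtd (-(D:ℤ))) * ⟨r, -1⟩) := by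
        ext
        · simp; linear_combination -(c:ℤ) * huv
        · simp
      rw [e]
      exact Ideal.add_mem _ (Ideal.mul_mem_left _ _ (Ideal.mul_mem_mul h1 h3))
        (Ideal.mul_mem_left _ _ (Ideal.add_mem _ (Ideal.mul_mem_mul h2 h3) (Ideal.mul_mem_mul h1 h4)))
  have hN : Ideal.span {α * star α} = Ideal.span {((c:ℤ) : Zsqrtd (-(D:ℤ))) * (c:ℤ)} := by
    rw [← Ideal.span_singleton_mul_span_singleton, ← hα, ← hα',
      ← Ideal.span_singleton_mul_span_singleton, ← hJJ]
    ring
  rw [← Zsqrtd.norm_eq_mul_conj, ← Int.cast_mul] at hN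
  have hd1 : α.norm ∣ (c:ℤ) * c := by
    rw [← Zsqrtd.intCast_dvd_intCast (d := -(D:ℤ)), ← Ideal.span_singleton_le_span_singleton, hN]
  have hd2 : (c:ℤ) * c ∣ α.norm := by
    rw [← Zsqrtd.intCast_dvd_intCast (d := -(D:ℤ)), ← Ideal.span_singleton_le_span_singleton, hN]
  have hnorm : α.norm = (c:ℤ) * c :=
    Int.dvd_antisymm (Zsqrtd.norm_nonneg (by omega) _) (by positivity) hd1 hd2
  rw [Zsqrtd.norm_def] at hnorm
  have hnorm' : α.re ^ 2 + D * α.im ^ 2 = (c:ℤ) ^ 2 := by linear_combination hnorm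
  have hcpos : (0:ℤ) < c := by exact_mod_cast hc
  refine ⟨α.re, α.im, hnorm', ?_, ?_⟩
  · apply isCoprime_of_prime_dvd
    · rintro ⟨h1, h2⟩
      rw [h1, h2] at hnorm'
      nlinarith
    · intro p hp h1 h2
      have hpc : p ∣ c := by
        apply hp.dvd_of_dvd_pow (n := 2)
        rw [← hnorm']
        exact dvd_add (h1.trans (dvd_pow_self _ (by omega))) ((h2.trans (dvd_pow_self _ (by omega))).mul_left _)
      have hpα : (p : Zsqrtd (-(D:ℤ))) ∣ α := (Zsqrtd.intCast_dvd _ _).2 ⟨h1, h2⟩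
      have hm2 : (⟨r, 1⟩ * ⟨r, 1⟩ : Zsqrtd (-(D:ℤ))) ∈ J * J :=
        Ideal.mul_mem_mul (Ideal.subset_span (by simp)) (Ideal.subset_span (by simp))
      rw [hα, Ideal.mem_span_singleton] at hm2
      have h5 := ((Zsqrtd.intCast_dvd _ _).1 (hpα.trans hm2)).2
      simp at h5
      have h6 : p ∣ 2 * r := by rw [two_mul]; exact h5
      exact hp.not_isUnit (hcr.isUnit_of_dvd' hpc h6)
  · have : α ∈ J := by
      have : α ∈ J * J := by rw [hα]; exact Ideal.mem_span_singleton_self α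
      exact Ideal.mul_le_left this
    obtain ⟨a, b, hab⟩ := Ideal.mem_span_pair.1 this
    have h1 := congrArg Zsqrtd.re hab
    have h2 := congrArg Zsqrtd.im hab
    simp at h1 h2
    refine ⟨a.re - r * a.im - m * b.im, ?_⟩
    rw [← h1, ← h2]
    linear_combination -b.im * hm

lemma unique_sol (D c : ℕ) (hD : 1 < D) (hc : 0 < c) (r x y x' y' : ℤ)
    (h : x ^ 2 + D * y ^ 2 = (c:ℤ) ^ 2) (h' : x' ^ 2 + D * y' ^ 2 = (c:ℤ) ^ 2)
    (hx : (c:ℤ) ∣ x - r * y) (hx' : (c:ℤ) ∣ x' - r * y')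
    (hcop : IsCoprime (c:ℤ) (2 * r * y * y')) : x * y' = x' * y := by
  obtain ⟨m, hm⟩ := hx
  obtain ⟨m', hm'⟩ := hx'
  have h1 : (c:ℤ) ^ 2 ∣ (x * y' - x' * y) * (x * y' + x' * y) :=
    ⟨y' ^ 2 - y ^ 2, by linear_combination y' ^ 2 * h - y ^ 2 * h'⟩
  have h2 : IsCoprime (c:ℤ) (x * y' + x' * y) := by
    have : x * y' + x' * y = 2 * r * y * y' + (c:ℤ) * (m * y' + m' * y) := by
      linear_combination y' * hm + y * hm'
    rw [this]
    exact hcop.add_mul_left_right _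
  obtain ⟨t, ht⟩ := (h2.pow_left (m := 2)).dvd_of_dvd_mul_right h1
  have h3 : (x * x' + D * y * y') ^ 2 + D * ((c:ℤ) ^ 2 * t) ^ 2 = (c:ℤ) ^ 4 := by
    rw [← ht]
    linear_combination (x' ^ 2 + D * y' ^ 2) * h + (c:ℤ) ^ 2 * h'
  have hc0 : (0:ℤ) < (c:ℤ) ^ 4 := by positivity
  have ht0 : t = 0 := by
    by_contra hne
    have ht1 : 1 ≤ t ^ 2 := by have : 0 < t ^ 2 := by positivity
                               omega
    have hD' : (2:ℤ) ≤ D := by exact_mod_cast hD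
    have : (2:ℤ) ≤ D * t ^ 2 := by nlinarith
    have h5 : (c:ℤ) ^ 4 * (D * t ^ 2) ≤ (c:ℤ) ^ 4 := by
      nlinarith [sq_nonneg (x * x' + D * y * y')]
    nlinarith
  rw [ht0] at ht
  linarith

/-- A normalized solution to `x² + D y² = z²`: a triple of positive integers
`(a, b, c)` with `a² + D b² = c²` and `gcd(a, b, c) = 1`. -/
def IsNormalizedSolution (D a b c : ℕ) : Prop :=
  0 < a ∧ 0 < b ∧ 0 < c ∧ a ^ 2 + D * b ^ 2 = c ^ 2 ∧ Nat.gcd (Nat.gcd a b) c = 1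

/-- Let `D > 1` be squarefree with `D ≡ 1` or `2 (mod 4)`, and suppose every
element of the ideal class group of `ℚ(√(-D))` (here `K` is any number field
generated over `ℚ` by a square root `ω` of `-D`) has order dividing `2`.
If `c > 1` is such that every prime factor `p` of `c` is odd with Legendre
symbol `(-D/p) = 1`, then the number of normalized solutions of
`x² + D y² = z²` of the form `(a, b, c)` is exactly `2^(k-1)`, where `k` is
the number of distinct prime factors of `c`. -/
theorem count_normalized_solutions (D : ℕ) (hD : 1 < D) (hsq : Squarefree D)
    (hmod : D % 4 = 1 ∨ D % 4 = 2)
    (K : Type) [Field K] [NumberField K] (ω : K) (hω : ω ^ 2 = -(D : K))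
    (hgen : Algebra.adjoin ℚ {ω} = ⊤)
    (hcg : ∀ g : ClassGroup (NumberField.RingOfIntegers K), g ^ 2 = 1)
    (c : ℕ) (hc : 1 < c)
    (hfac : ∀ p ∈ c.primeFactors, ∃ hp : p.Prime,
      p ≠ 2 ∧ @legendreSym p ⟨hp⟩ (-(D : ℤ)) = 1) :
    {ab : ℕ × ℕ | IsNormalizedSolution D ab.1 ab.2 c}.ncard
      = 2 ^ (c.primeFactors.card - 1) := by
  have hcfac : ∀ p : ℕ, p.Prime → p ∣ c → p ≠ 2 ∧ ¬ p ∣ D := by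
    intro p hp hpc
    obtain ⟨hp', h2, hl⟩ := hfac p (Nat.mem_primeFactors.2 ⟨hp, hpc, by omega⟩)
    refine ⟨h2, fun h => ?_⟩
    have : Fact p.Prime := ⟨hp⟩
    have h0 : ((-(D:ℤ) : ℤ) : ZMod p) = 0 := by
      rw [ZMod.intCast_zmod_eq_zero_iff_dvd]
      exact (dvd_neg).2 (by exact_mod_cast h)
    have := (legendreSym.eq_zero_iff p (-(D:ℤ))).2 h0
    rw [this] at hl
    omega
  have hc2D : IsCoprime (c:ℤ) (2 * D) := by
    have : Nat.Coprime c (2 * D) := by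
      apply Nat.Coprime.mul_right <;> apply Nat.coprime_of_dvd
      · intro p hp h1 h2
        exact (hcfac p hp h1).1 ((Nat.prime_dvd_prime_iff_eq hp Nat.prime_two).1 h2)
      · intro p hp h1 h2
        exact (hcfac p hp h1).2 h2
    exact_mod_cast Nat.isCoprime_iff_coprime.2 this
  have hc2 : IsCoprime (c:ℤ) 2 := hc2D.of_mul_right_left
  have hcD : IsCoprime (c:ℤ) D := hc2D.of_mul_right_right
  obtain ⟨e⟩ := ring_equiv D hD hsq hmod K ω hω hgen
  have hnz : Fact (1 < c) := ⟨hc⟩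
  have hnz' : NeZero c := ⟨by omega⟩
  have hprin : ∀ J : Ideal (Zsqrtd (-(D:ℤ))), J ≠ ⊥ → ∃ α, J * J = Ideal.span {α} := by
    intro J hJ
    have : IsDomain (Zsqrtd (-(D:ℤ))) := e.toMulEquiv.isDomain _
    exact sq_principal _ _ e hcg J hJ
  have hcard := root_card D c (by omega) hfac
  set S := {ab : ℕ × ℕ | IsNormalizedSolution D ab.1 ab.2 c} with hS
  let sg : Bool → ℤ := fun b => if b then 1 else -1
  have hsg : ∀ b, sg b * sg b = 1 := by intro b; cases b <;> simp [sg]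
  -- coprimality of b with c
  have hbc : ∀ ab ∈ S, Nat.Coprime ab.2 c := by
    rintro ⟨a, b⟩ ⟨ha, hb, -, heq, hg⟩
    simp only at *
    apply Nat.coprime_of_dvd
    intro p hp h1 h2
    have h3 : p ∣ a := by
      apply hp.dvd_of_dvd_pow (n := 2)
      refine (Nat.dvd_add_left (c := D * b ^ 2) ?_).1 ?_
      · exact (h1.trans (dvd_pow_self _ (by omega))).mul_left _
      · rw [heq]; exact h2.trans (dvd_pow_self _ (by omega))
    have := Nat.dvd_gcd (Nat.dvd_gcd h3 h1) h2
    rw [hg] at this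
    exact hp.one_lt.ne' (Nat.dvd_one.1 this)
  have hrc : ∀ r : ℤ, (c:ℤ) ∣ r ^ 2 + D → IsCoprime (c:ℤ) r := by
    rintro r ⟨m, hm⟩
    obtain ⟨u, v, huv⟩ := hcD
    exact ⟨u + v * m, -v * r, by linear_combination huv - v * hm⟩
  have hroot : ∀ r : ℤ, (r : ZMod c) ^ 2 = -((D:ℤ) : ZMod c) ↔ (c:ℤ) ∣ r ^ 2 + D := by
    intro r
    rw [← ZMod.intCast_zmod_eq_zero_iff_dvd, eq_neg_iff_add_eq_zero]
    push_cast
    rfl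
  let f : (ℕ × ℕ) × Bool → ZMod c := fun t => (sg t.2 : ZMod c) * (t.1.1 : ZMod c) * (t.1.2 : ZMod c)⁻¹
  have hf : ∀ t : (ℕ × ℕ) × Bool, t.1 ∈ S → f t * t.1.2 = (sg t.2 : ZMod c) * t.1.1 := by
    rintro ⟨⟨a, b⟩, ε⟩ ht
    have h1 := ZMod.coe_mul_inv_eq_one b (hbc _ ht)
    simp only [f]
    linear_combination (sg ε : ZMod c) * a * h1
  have hbij : Set.BijOn f (S ×ˢ (Set.univ : Set Bool)) {r : ZMod c | r ^ 2 = -((D:ℤ) : ZMod c)} := by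
    have hmaps : ∀ t : (ℕ × ℕ) × Bool, t.1 ∈ S → f t ^ 2 = -((D:ℤ) : ZMod c) := by
      rintro ⟨⟨a, b⟩, ε⟩ ht
      have h1 := ZMod.coe_mul_inv_eq_one b (hbc _ ht)
      have h2 := hf _ ht
      obtain ⟨-, -, -, heq, -⟩ := ht
      simp only at heq h2
      have h3 : (a:ZMod c) ^ 2 + D * (b : ZMod c) ^ 2 = 0 := by
        have := congrArg (Nat.cast (R := ZMod c)) heq
        push_cast at this
        rw [this]; simp
      have h4 : (sg ε : ZMod c) * sg ε = 1 := by exact_mod_cast congrArg (Int.cast (R := ZMod c)) (hsg ε)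
      have h5 : f ((a, b), ε) ^ 2 * b ^ 2 = -((D:ℤ) : ZMod c) * b ^ 2 := by
        push_cast
        rw [← mul_pow, h2]
        linear_combination h3 + a ^ 2 * h4
      have hu : IsUnit ((b : ZMod c) ^ 2) := (IsUnit.of_mul_eq_one _ h1).pow 2
      exact hu.mul_right_cancel h5
    refine ⟨fun t ht => hmaps t ht.1, ?_, ?_⟩
    · rintro t ht t' ht' hff
      have hm := hmaps t ht.1
      have h1 := hf t ht.1
      have h1' := hf t' ht'.1
      rw [← hff] at h1'
      obtain ⟨r, hr⟩ := ZMod.intCast_surjective (f t)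
      rw [← hr] at hm h1 h1'
      have hb1 := hbc _ ht.1
      have hb1' := hbc _ ht'.1
      obtain ⟨⟨a, b⟩, ε⟩ := t
      obtain ⟨⟨a', b'⟩, ε'⟩ := t'
      obtain ⟨ha, hb, -, heq, -⟩ := ht.1
      obtain ⟨ha', hb', -, heq', -⟩ := ht'.1
      simp only at *
      have hcr := hrc r ((hroot r).1 hm)
      have key := unique_sol D c hD (by omega) r (sg ε * a) b (sg ε' * a') b'
        (by have : (a:ℤ) ^ 2 + D * b ^ 2 = (c:ℤ) ^ 2 := by exact_mod_cast heq
            linear_combination this + a ^ 2 * hsg ε)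
        (by have : (a':ℤ) ^ 2 + D * b' ^ 2 = (c:ℤ) ^ 2 := by exact_mod_cast heq'
            linear_combination this + a' ^ 2 * hsg ε')
        (by rw [← ZMod.intCast_zmod_eq_zero_iff_dvd]; push_cast; rw [h1]; ring)
        (by rw [← ZMod.intCast_zmod_eq_zero_iff_dvd]; push_cast; rw [h1']; ring)
        (((hc2.mul_right hcr).mul_right (Nat.isCoprime_iff_coprime.2 hb1.symm)).mul_right
          (Nat.isCoprime_iff_coprime.2 hb1'.symm))
      have p1 : (0:ℤ) < a * b' := by positivity
      have p2 : (0:ℤ) < a' * b := by positivity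
      have hε : ε = ε' ∧ (a:ℤ) * b' = a' * b := by
        cases ε <;> cases ε' <;> simp [sg] at key ⊢ <;> nlinarith
      obtain ⟨rfl, hab⟩ := hε
      have hab' : a * b' = a' * b := by exact_mod_cast hab
      have hbb : c ^ 2 * b' ^ 2 = c ^ 2 * b ^ 2 := by
        have h6 : (a * b') ^ 2 = (a' * b) ^ 2 := by rw [hab']
        zify at h6 heq heq' ⊢
        linear_combination h6 - b' ^ 2 * heq + b ^ 2 * heq'
      have hb2 : b' = b := by
        have := Nat.eq_of_mul_eq_mul_left (by positivity) hbb
        exact Nat.pow_left_injective (n := 2) (by omega) this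
      subst hb2
      have ha2 : a = a' := Nat.eq_of_mul_eq_mul_right hb hab'
      subst ha2
      rfl
    · intro r hr
      obtain ⟨r, rfl⟩ := ZMod.intCast_surjective r
      have hr' := (hroot r).1 hr
      have hcr := hrc r hr'
      obtain ⟨x, y, hxy, hcop, hd⟩ := exists_sol D c hD (by omega) r (hc2.mul_right hcr) hr' hprin
      have hc1 : ¬ IsUnit (c:ℤ) := by
        rw [Int.isUnit_iff]; omega
      have hx0 : x ≠ 0 := by
        rintro rfl
        have hy : IsUnit y := isCoprime_zero_left.1 hcop
        have hy2 : y ^ 2 = 1 := by rcases Int.isUnit_iff.1 hy with rfl | rfl <;> rfl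
        rw [hy2] at hxy
        exact hc1 (hcD.isUnit_of_dvd' dvd_rfl ⟨c, by linear_combination hxy⟩)
      have hy0 : y ≠ 0 := by
        rintro rfl
        have hx : IsUnit x := isCoprime_zero_right.1 hcop
        have hx2 : x ^ 2 = 1 := by rcases Int.isUnit_iff.1 hx with rfl | rfl <;> rfl
        rw [hx2] at hxy
        exact hc1 (IsUnit.of_mul_eq_one (c:ℤ) (by linear_combination -hxy))
      have hmem : (x.natAbs, y.natAbs) ∈ S := by
        refine ⟨Int.natAbs_pos.2 hx0, Int.natAbs_pos.2 hy0, by omega, ?_, ?_⟩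
        · zify; simpa using hxy
        · have : Nat.gcd x.natAbs y.natAbs = 1 := Int.isCoprime_iff_gcd_eq_one.1 hcop
          simp [this]
      have hsig : ∃ ε, sg ε * |x| * y = x * |y| := by
        rcases abs_cases x with ⟨h1, -⟩ | ⟨h1, -⟩ <;> rcases abs_cases y with ⟨h2, -⟩ | ⟨h2, -⟩ <;>
          rw [h1, h2]
        · exact ⟨true, by simp [sg]⟩
        · exact ⟨false, by simp [sg]⟩
        · exact ⟨false, by simp [sg]⟩
        · exact ⟨true, by simp [sg]⟩
      obtain ⟨ε, hε⟩ := hsig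
      refine ⟨((x.natAbs, y.natAbs), ε), ⟨hmem, trivial⟩, ?_⟩
      have h1 := hf ((x.natAbs, y.natAbs), ε) hmem
      have h2 := ZMod.coe_mul_inv_eq_one _ (hbc _ hmem)
      have hu : IsUnit ((y.natAbs : ℕ) : ZMod c) := IsUnit.of_mul_eq_one _ h2
      have hcast : ∀ z : ℤ, ((z.natAbs : ℕ) : ZMod c) = ((|z| : ℤ) : ZMod c) := by
        intro z; rw [Int.abs_eq_natAbs]; simp
      have hu' : IsUnit ((y : ℤ) : ZMod c) := by
        rw [hcast] at hu
        rcases abs_cases y with ⟨h1, -⟩ | ⟨h1, -⟩ <;> rw [h1] at hu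
        · exact hu
        · push_cast at hu; exact (IsUnit.neg_iff _).1 hu
      simp only at h1 
      apply hu.mul_right_cancel
      rw [h1]
      apply hu'.mul_right_cancel
      have h3 : (x : ZMod c) = r * y := by
        rw [← ZMod.intCast_zmod_eq_zero_iff_dvd] at hd
        push_cast at hd
        linear_combination hd
      have h4 : (sg ε : ZMod c) * ((|x| : ℤ) : ZMod c) * y = x * ((|y| : ℤ) : ZMod c) := by
        exact_mod_cast congrArg (Int.cast (R := ZMod c)) hε
      rw [hcast, hcast, h4, h3]
      ring
  have hfin : (S ×ˢ (Set.univ : Set Bool)).ncard = 2 ^ c.primeFactors.card := by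
    rw [← hcard, ← hbij.image_eq, Set.ncard_image_of_injOn hbij.injOn]
  rw [Set.ncard_prod, Set.ncard_univ, Nat.card_eq_fintype_card, Fintype.card_bool] at hfin
  have hk : 0 < c.primeFactors.card := Finset.card_pos.2 (Nat.nonempty_primeFactors.2 hc)
  obtain ⟨k, hk⟩ : ∃ k, c.primeFactors.card = k + 1 := ⟨_, (Nat.succ_pred_eq_of_pos hk).symm⟩
  rw [hk, pow_succ] at hfin
  rw [hk, Nat.add_sub_cancel]
  omega
end

section
/- Let D > 1 be a squarefree positive integer with D ≡ 1 or 2 (mod 4). If c > 1 is a positive integer that has a prime factor p which is either equal to 2 or is an odd prime with Legendre symbol (−D/p) ≠ 1, then there is no normalized solution to x² + D y² = z² of the form (a, b, c). -/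
/-- Let `D > 1` be squarefree with `D ≡ 1` or `2 (mod 4)`. If `c > 1` has a prime
factor `p` which is `2`, or which is odd with Legendre symbol `(-D/p) ≠ 1`, then
there is no normalized solution to `x² + D y² = z²` of the form `(a, b, c)`. -/
theorem no_solution_of_bad_prime (D : ℕ) (hD : 1 < D) (hsq : Squarefree D)
    (hmod : D % 4 = 1 ∨ D % 4 = 2) (c : ℕ) (hc : 1 < c)
    (p : ℕ) (hp : p.Prime) (hpc : p ∣ c)
    (hbad : p = 2 ∨ (p ≠ 2 ∧ @legendreSym p ⟨hp⟩ (-(D : ℤ)) ≠ 1)) :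
    ∀ a b : ℕ, ¬ IsNormalizedSolution D a b c := by
  rintro a b ⟨ha, hb, hc0, heq, hg⟩
  haveI : Fact p.Prime := ⟨hp⟩
  have key : p ∣ a → p ∣ b → False := fun h1 h2 =>
    hp.one_lt.ne' (Nat.dvd_one.mp (hg ▸ Nat.dvd_gcd (Nat.dvd_gcd h1 h2) hpc))
  have hpb : ¬ p ∣ b := by
    intro h
    refine key ?_ h
    have h1 : p ∣ a ^ 2 + D * b ^ 2 := heq ▸ dvd_pow hpc two_ne_zero
    exact hp.dvd_of_dvd_pow
      ((Nat.dvd_add_left ((dvd_pow h two_ne_zero).mul_left D)).mp h1)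
  rcases hbad with rfl | ⟨-, hl⟩
  · have h4 : (a ^ 2 + D * b ^ 2) % 4 = 0 := by
      obtain ⟨k, rfl⟩ := hpc
      rw [heq, mul_pow]
      omega
    have hb2 : b ^ 2 % 4 = 1 := by
      have : b % 4 = 1 ∨ b % 4 = 3 := by omega
      rcases this with h | h <;> simp [Nat.pow_mod, h]
    have ha2 : a ^ 2 % 4 = 0 ∨ a ^ 2 % 4 = 1 := by
      have : a % 4 = 0 ∨ a % 4 = 1 ∨ a % 4 = 2 ∨ a % 4 = 3 := by omega
      rcases this with h | h | h | h <;> simp [Nat.pow_mod, h]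
    have hm : (D * b ^ 2) % 4 = D % 4 := by
      rw [Nat.mul_mod, hb2]; simp
    omega
  · have hpD : ¬ p ∣ D := by
      intro h
      have h1 : p ∣ a ^ 2 + D * b ^ 2 := heq ▸ dvd_pow hpc two_ne_zero
      have hpa : p ∣ a := hp.dvd_of_dvd_pow ((Nat.dvd_add_left (h.mul_right _)).mp h1)
      have h2 : p ^ 2 ∣ a ^ 2 + D * b ^ 2 := heq ▸ pow_dvd_pow_of_dvd hpc 2
      have h3 : p ^ 2 ∣ D * b ^ 2 := (Nat.dvd_add_right (pow_dvd_pow_of_dvd hpa 2)).mp h2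
      have hco : Nat.Coprime (p ^ 2) (b ^ 2) :=
        Nat.Coprime.pow 2 2 ((Nat.Prime.coprime_iff_not_dvd hp).mpr hpb)
      have h4 : p * p ∣ D := by
        rw [← pow_two]; exact hco.dvd_of_dvd_mul_right h3
      exact hp.one_lt.ne' (Nat.isUnit_iff.mp (hsq p h4))
    apply hl
    have hb0 : (b : ZMod p) ≠ 0 := by
      rwa [Ne, ZMod.natCast_eq_zero_iff]
    have hD0 : (D : ZMod p) ≠ 0 := by
      rwa [Ne, ZMod.natCast_eq_zero_iff]
    have hc1 : (c : ZMod p) = 0 := (ZMod.natCast_eq_zero_iff c p).mpr hpc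
    have he : (a : ZMod p) ^ 2 + D * b ^ 2 = 0 := by
      have := congrArg (Nat.cast : ℕ → ZMod p) heq
      push_cast at this
      rw [this, hc1]; simp
    rw [legendreSym.eq_one_iff p (by simpa using hD0)]
    refine ⟨(a : ZMod p) / b, ?_⟩
    push_cast
    field_simp
    linear_combination -he
end

section
/- Let D > 1 be a squarefree positive integer with D ≡ 1 or 2 (mod 4), and suppose that every element of the ideal class group of ℚ(√(−D)) has order dividing 2. Let c > 1 be an odd positive integer all of whose prime factors p satisfy the Legendre symbol condition (−D/p) = 1. Then there exist positive integers a and b with gcd(a, b, c) = 1 and a² + D b² = c²; that is, a normalized solution of the form (a, b, c) exists. -/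
theorem aux_sqrt (D : ℕ) (c : ℕ) (hc : c ≠ 0)
    (h : ∀ p : ℕ, p.Prime → p ∣ c → ¬ p ∣ 2 ∧ ¬ p ∣ D ∧ ∃ r : ℤ, (p : ℤ) ∣ r ^ 2 + D) :
    ∃ r : ℤ, (c : ℤ) ∣ r ^ 2 + D := by
  induction c using induction_on_primes with
  | zero => exact absurd rfl hc
  | one => exact ⟨0, by simp⟩
  | prime_mul p c hp ih =>
    have hc0 : c ≠ 0 := by rintro rfl; simp at hc
    obtain ⟨r, t, ht⟩ := ih hc0 (fun q hq hqc => h q hq (hqc.mul_left p))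
    obtain ⟨h2, hpD, ρ, hρ⟩ := h p hp (dvd_mul_right p c)
    have hpZ : Prime (p : ℤ) := Nat.prime_iff_prime_int.mp hp
    have key : ∃ s : ℤ, (p : ℤ) ∣ t + 2 * r * s + c * s ^ 2 := by
      by_cases hpc : p ∣ c
      · have hpc' : (p : ℤ) ∣ c := by exact_mod_cast hpc
        have hcop : IsCoprime (p : ℤ) (2 * r) := by
          rw [hpZ.coprime_iff_not_dvd]
          intro hd
          rcases hpZ.dvd_or_dvd hd with hd | hd
          · exact h2 (by exact_mod_cast hd)
          · apply hpD
            have h1 : (p : ℤ) ∣ r ^ 2 + D := ht ▸ hpc'.mul_right t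
            have h3 : (p : ℤ) ∣ r ^ 2 := dvd_pow hd two_ne_zero
            exact_mod_cast (dvd_add_right h3).mp h1
        obtain ⟨u, v, huv⟩ := hcop
        obtain ⟨e, he⟩ := hpc'
        refine ⟨-(t * v), u * t + e * (t * v) ^ 2, ?_⟩
        rw [he]
        linear_combination (-t) * huv
      · have hcop : IsCoprime (p : ℤ) c := by
          rw [hpZ.coprime_iff_not_dvd]; exact_mod_cast hpc
        obtain ⟨u, v, huv⟩ := hcop
        refine ⟨v * (ρ - r), ?_⟩
        have hcop : IsCoprime (p : ℤ) c := ⟨u, v, huv⟩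
        apply hcop.dvd_of_dvd_mul_left
        obtain ⟨e, he⟩ := hρ
        have e1 : (c : ℤ) * (t + 2 * r * (v * (ρ - r)) + c * (v * (ρ - r)) ^ 2)
            = (r + (v * c) * (ρ - r)) ^ 2 + D := by linear_combination -ht
        have e2 : v * c = 1 - u * p := by linear_combination huv
        rw [e1, e2]
        refine ⟨e - 2 * ρ * u * (ρ - r) + u ^ 2 * p * (ρ - r) ^ 2, ?_⟩
        linear_combination he
    obtain ⟨s, w, hw⟩ := key
    refine ⟨r + c * s, w, ?_⟩
    push_cast
    linear_combination ht + c * hw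

theorem aux_rat (D : ℕ) (hsq : Squarefree D) (q : ℚ) (n : ℤ) (h : D * q ^ 2 = n) :
    ∃ k : ℤ, q = k := by
  have hden : (q.den : ℚ) ≠ 0 := by exact_mod_cast q.den_nz
  have h1 : (D : ℤ) * q.num ^ 2 = n * q.den ^ 2 := by
    have : (D : ℚ) * q.num ^ 2 = n * q.den ^ 2 := by
      rw [← h]
      nth_rewrite 2 [← Rat.num_div_den q]
      field_simp
    exact_mod_cast this
  have hcop : IsCoprime ((q.den : ℤ) ^ 2) (q.num ^ 2) := by
    apply IsCoprime.pow
    rw [Int.isCoprime_iff_nat_coprime]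
    simpa using q.reduced.symm
  have h2 : (q.den : ℤ) ^ 2 ∣ D := hcop.dvd_of_dvd_mul_right (h1 ▸ dvd_mul_left _ _)
  have h3 : q.den * q.den ∣ D := by rw [← pow_two]; exact_mod_cast h2
  have h4 := Nat.isUnit_iff.mp (hsq _ h3)
  exact ⟨q.num, ((Rat.den_eq_one_iff q).mp h4).symm⟩

theorem aux_int (D : ℕ) (hD : 1 < D) (hsq : Squarefree D)
    (hmod : D % 4 = 1 ∨ D % 4 = 2)
    (K : Type) [Field K] [NumberField K] (ω : K) (hω : ω ^ 2 = -(D : K))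
    (a b : ℚ) (h : IsIntegral ℤ ((a : K) + b * ω)) :
    ∃ m n : ℤ, a = m ∧ b = n := by
  let φ : K →+* ℂ := Classical.arbitrary _
  have hz : (φ ω) ^ 2 = -(D : ℂ) := by rw [← map_pow, hω]; simp
  set z := φ ω with hzdef
  have hstar : star z = - z := by
    have hre := congrArg Complex.re hz
    have him := congrArg Complex.im hz
    simp [pow_two] at hre him
    have hD' : (1 : ℝ) < D := by exact_mod_cast hD
    have : z.re = 0 := by
      have h1 : z.re * z.im = 0 := by linarith
      rcases mul_eq_zero.mp h1 with h1 | h1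
      · exact h1
      · rw [h1] at hre; nlinarith
    apply Complex.ext <;> simp [this]
  have h1 : IsIntegral ℤ ((a : ℂ) + b * z) := by
    have := h.map φ.toIntAlgHom
    simpa using this
  have h2 : IsIntegral ℤ ((a : ℂ) - b * z) := by
    have := h1.map (starRingEnd ℂ).toIntAlgHom
    have e : (starRingEnd ℂ) z = -z := hstar
    simpa [e, sub_eq_add_neg] using this
  have h3 : IsIntegral ℤ ((2 * a : ℚ) : ℂ) := by
    have e : ((2 * a : ℚ) : ℂ) = ((a : ℂ) + b * z) + ((a : ℂ) - b * z) := by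
      push_cast; ring
    rw [e]; exact h1.add h2
  have h4 : IsIntegral ℤ ((a ^ 2 + D * b ^ 2 : ℚ) : ℂ) := by
    have e : ((a ^ 2 + D * b ^ 2 : ℚ) : ℂ) = ((a : ℂ) + b * z) * ((a : ℂ) - b * z) := by
      push_cast; linear_combination (b : ℂ) ^ 2 * hz
    rw [e]; exact h1.mul h2
  have hr : ∀ q : ℚ, IsIntegral ℤ (q : ℂ) → ∃ m : ℤ, q = m := by
    intro q hq
    have h5 : IsIntegral ℤ (algebraMap ℚ ℂ q) := by simpa using hq
    rw [isIntegral_algebraMap_iff (algebraMap ℚ ℂ).injective] at h5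
    obtain ⟨m, hm⟩ := IsIntegrallyClosed.isIntegral_iff.mp h5
    exact ⟨m, by simpa using hm.symm⟩
  obtain ⟨m, hm⟩ := hr _ h3
  obtain ⟨n, hn⟩ := hr _ h4
  obtain ⟨k, hk⟩ := aux_rat D hsq (2 * b) (4 * n - m ^ 2) (by
    push_cast; rw [← hm, ← hn]; ring)
  have h6 : m ^ 2 + D * k ^ 2 = 4 * n := by
    have : (m : ℚ) ^ 2 + D * k ^ 2 = 4 * n := by rw [← hm, ← hn, ← hk]; ring
    exact_mod_cast this
  have h7 : 2 ∣ m ∧ 2 ∣ k := by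
    obtain ⟨d, hd⟩ : ∃ d : ℤ, (D : ℤ) = 4 * d + 1 ∨ (D : ℤ) = 4 * d + 2 :=
      ⟨(D : ℤ) / 4, by omega⟩
    rcases Int.even_or_odd' m with ⟨m', h | h⟩ <;> rcases Int.even_or_odd' k with ⟨k', h' | h'⟩ <;>
      rcases hd with hd | hd <;> rw [h, h', hd] at h6 <;> ring_nf at h6 <;> omega
  obtain ⟨⟨m', rfl⟩, ⟨k', rfl⟩⟩ := h7
  refine ⟨m', k', ?_, ?_⟩
  · push_cast at hm; linarith
  · push_cast at hk; linarith

theorem aux_span (K : Type) [Field K] [NumberField K] (ω : K) (D : ℕ) (hω : ω ^ 2 = -(D : K))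
    (hgen : Algebra.adjoin ℚ {ω} = ⊤) (x : K) : ∃ a b : ℚ, x = a + b * ω := by
  have hx : x ∈ Algebra.adjoin ℚ {ω} := hgen ▸ Algebra.mem_top
  induction hx using Algebra.adjoin_induction with
  | mem x hx => exact ⟨0, 1, by simpa using hx⟩
  | algebraMap r => exact ⟨r, 0, by simp⟩
  | add x y _ _ hx hy =>
    obtain ⟨a, b, rfl⟩ := hx
    obtain ⟨a', b', rfl⟩ := hy
    exact ⟨a + a', b + b', by push_cast; ring⟩
  | mul x y _ _ hx hy =>
    obtain ⟨a, b, rfl⟩ := hx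
    obtain ⟨a', b', rfl⟩ := hy
    exact ⟨a * a' - D * b * b', a * b' + a' * b, by
      push_cast; linear_combination (b : K) * b' * hω⟩

theorem aux_equiv (D : ℕ) (hD : 1 < D) (hsq : Squarefree D)
    (hmod : D % 4 = 1 ∨ D % 4 = 2)
    (K : Type) [Field K] [NumberField K] (ω : K) (hω : ω ^ 2 = -(D : K))
    (hgen : Algebra.adjoin ℚ {ω} = ⊤) :
    Nonempty (ℤ√(-(D : ℤ)) ≃+* NumberField.RingOfIntegers K) := by
  have hωi : IsIntegral ℤ ω := by
    apply IsIntegral.of_pow (n := 2) two_pos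
    rw [hω]
    have := isIntegral_algebraMap (R := ℤ) (A := K) (x := -(D : ℤ))
    simpa using this
  let w : NumberField.RingOfIntegers K := ⟨ω, hωi⟩
  have hw : w * w = ((-(D : ℤ) : ℤ) : NumberField.RingOfIntegers K) := by
    apply NumberField.RingOfIntegers.ext
    simp only [map_mul, map_intCast]
    change ω * ω = _
    rw [← pow_two, hω]; push_cast; rfl
  refine ⟨RingEquiv.ofBijective (Zsqrtd.lift ⟨w, hw⟩) ⟨?_, ?_⟩⟩
  · apply Zsqrtd.lift_injective
    intro n hn
    have := mul_self_nonneg n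
    omega
  · intro x
    obtain ⟨a, b, hab⟩ := aux_span K ω D hω hgen (x : K)
    obtain ⟨m, n, rfl, rfl⟩ := aux_int D hD hsq hmod K ω hω a b (hab ▸ x.isIntegral_coe)
    refine ⟨⟨m, n⟩, ?_⟩
    apply NumberField.RingOfIntegers.ext
    rw [hab]
    simp only [Zsqrtd.lift, Equiv.coe_fn_mk, RingHom.coe_mk, MonoidHom.coe_mk, OneHom.coe_mk,
      map_add, map_mul, map_intCast, Rat.cast_intCast]
    rfl

theorem aux_main (D : ℕ) (hD : 1 < D) (hsq : Squarefree D)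
    (hprin : ∀ I : Ideal (ℤ√(-(D : ℤ))), I ≠ ⊥ → ∃ α, I ^ 2 = Ideal.span {α})
    (c : ℕ) (hc : 1 < c) (r : ℤ) (hr : (c : ℤ) ∣ r ^ 2 + D)
    (hcop : IsCoprime (c : ℤ) (2 * r)) :
    ∃ a b : ℕ, IsNormalizedSolution D a b c := by
  obtain ⟨t, ht⟩ := hr
  obtain ⟨u, v, huv⟩ := hcop
  have h0 : (c : ℤ√(-(D : ℤ))) ≠ 0 := by
    intro h
    have := congrArg Zsqrtd.re h
    simp at this
    omega
  set ρ : ℤ√(-(D : ℤ)) := ⟨r, 1⟩ with hρ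
  set I : Ideal (ℤ√(-(D : ℤ))) := Ideal.span {(c : ℤ√(-(D : ℤ))), ρ} with hI
  have hcI : (c : ℤ√(-(D : ℤ))) ∈ I := Ideal.subset_span (by simp)
  have hρI : ρ ∈ I := Ideal.subset_span (by simp)
  obtain ⟨α, hα⟩ := hprin I (by
    intro h; rw [h] at hcI; exact h0 (by simpa using hcI))
  let σ := starRingEnd (ℤ√(-(D : ℤ)))
  have hσI : I.map σ = Ideal.span {(c : ℤ√(-(D : ℤ))), star ρ} := by
    rw [hI, Ideal.map_span]
    congr 1
    rw [Set.image_pair]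
    rw [map_natCast]
    rfl
  have hprod : I * I.map σ = Ideal.span {(c : ℤ√(-(D : ℤ)))} := by
    apply le_antisymm
    · rw [hσI, hI, Ideal.span_pair_mul_span_pair, Ideal.span_le]
      intro x hx
      simp only [Set.mem_insert_iff, Set.mem_singleton_iff] at hx
      rw [SetLike.mem_coe, Ideal.mem_span_singleton]
      rcases hx with rfl | rfl | rfl | rfl
      · exact dvd_mul_right _ _
      · exact dvd_mul_right _ _
      · exact dvd_mul_left _ _
      · refine ⟨(t : ℤ√(-(D : ℤ))), ?_⟩
        apply Zsqrtd.ext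
        · simp [hρ]; linear_combination ht
        · simp [hρ]
    · rw [Ideal.span_singleton_le_iff_mem]
      have e : (c : ℤ√(-(D : ℤ))) = (u : ℤ√(-(D : ℤ))) * (c * c)
          + (v : ℤ√(-(D : ℤ))) * (c * star ρ + ρ * c) := by
        apply Zsqrtd.ext
        · simp [hρ]; linear_combination (-(c : ℤ)) * huv
        · simp [hρ]
      have hc' : (c : ℤ√(-(D : ℤ))) ∈ I.map σ := by
        rw [hσI]; exact Ideal.subset_span (by simp)
      have hρ' : star ρ ∈ I.map σ := by
        rw [hσI]; exact Ideal.subset_span (by simp)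
      rw [e]
      exact Ideal.add_mem _ (Ideal.mul_mem_left _ _ (Ideal.mul_mem_mul hcI hc'))
        (Ideal.mul_mem_left _ _ (Ideal.add_mem _ (Ideal.mul_mem_mul hcI hρ')
          (Ideal.mul_mem_mul hρI hc')))
  have hnorm : Ideal.span {α * star α} = Ideal.span {((c : ℤ√(-(D : ℤ)))) ^ 2} := by
    rw [← Ideal.span_singleton_pow, ← hprod, mul_pow, ← Ideal.map_pow, hα, Ideal.map_span,
      Set.image_singleton, Ideal.span_singleton_mul_span_singleton]
    rfl
  rw [← Zsqrtd.norm_eq_mul_conj] at hnorm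
  have hcc : ((c : ℤ√(-(D : ℤ)))) ^ 2 = (((c : ℤ) ^ 2 : ℤ) : ℤ√(-(D : ℤ))) := by push_cast; rfl
  rw [hcc] at hnorm
  have hd1 : α.norm ∣ (c : ℤ) ^ 2 := by
    rw [← Zsqrtd.intCast_dvd_intCast (d := -(D : ℤ)), ← Ideal.span_singleton_le_span_singleton,
      hnorm]
  have hd2 : (c : ℤ) ^ 2 ∣ α.norm := by
    rw [← Zsqrtd.intCast_dvd_intCast (d := -(D : ℤ)), ← Ideal.span_singleton_le_span_singleton,
      hnorm]
  have hnn : 0 ≤ α.norm := Zsqrtd.norm_nonneg (by omega) α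
  have heq : α.norm = (c : ℤ) ^ 2 := Int.dvd_antisymm hnn (by positivity) hd1 hd2
  have heq' : α.re ^ 2 + D * α.im ^ 2 = (c : ℤ) ^ 2 := by
    rw [← heq, Zsqrtd.norm_def]; ring
  have hN : α.re.natAbs ^ 2 + D * α.im.natAbs ^ 2 = c ^ 2 := by
    zify; simpa using heq'
  have hgcd : Nat.gcd (Nat.gcd α.re.natAbs α.im.natAbs) c = 1 := by
    by_contra hne
    obtain ⟨p, hp, hpd⟩ := Nat.exists_prime_and_dvd hne
    have hpc : (p : ℤ) ∣ c := by exact_mod_cast hpd.trans (Nat.gcd_dvd_right _ _)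
    have hpg := hpd.trans (Nat.gcd_dvd_left _ _)
    have hpx : (p : ℤ) ∣ α.re := Int.natCast_dvd.mpr (hpg.trans (Nat.gcd_dvd_left _ _))
    have hpy : (p : ℤ) ∣ α.im := Int.natCast_dvd.mpr (hpg.trans (Nat.gcd_dvd_right _ _))
    have hpα : ((p : ℤ) : ℤ√(-(D : ℤ))) ∣ α := (Zsqrtd.intCast_dvd _ _).mpr ⟨hpx, hpy⟩
    have hρ2 : ρ * ρ ∈ I ^ 2 := by rw [pow_two]; exact Ideal.mul_mem_mul hρI hρI
    rw [hα, Ideal.mem_span_singleton] at hρ2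
    have h5 := ((Zsqrtd.intCast_dvd _ _).mp (hpα.trans hρ2)).2
    simp [hρ] at h5
    have h6 : (p : ℤ) ∣ 1 := by
      rw [← huv]
      refine dvd_add (hpc.mul_left _) (Dvd.dvd.mul_left ?_ _)
      rw [two_mul]; exact h5
    exact hp.one_lt.ne' (by exact_mod_cast Int.eq_one_of_dvd_one (by positivity) h6)
  refine ⟨α.re.natAbs, α.im.natAbs, ?_, ?_, by omega, hN, hgcd⟩
  · rw [Nat.pos_iff_ne_zero]
    intro hx
    rw [hx] at hN
    simp at hN
    have hdv : α.im.natAbs ∣ c := by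
      rw [← Nat.pow_dvd_pow_iff two_ne_zero, ← hN]; exact dvd_mul_left _ _
    obtain ⟨k, hk⟩ := hdv
    have hy : 0 < α.im.natAbs := by
      rw [Nat.pos_iff_ne_zero]; intro h; rw [h] at hk; omega
    have hDk : D = k * k := by
      apply Nat.eq_of_mul_eq_mul_right (pow_pos hy 2)
      rw [hN, hk]; ring
    have := Nat.isUnit_iff.mp (hsq k (hDk ▸ dvd_rfl))
    rw [this] at hDk
    omega
  · rw [Nat.pos_iff_ne_zero]
    intro hy
    rw [hy] at hN hgcd
    simp at hN
    rw [hN] at hgcd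
    simp at hgcd
    omega

/-- Let `D > 1` be squarefree with `D ≡ 1` or `2 (mod 4)`, and suppose every
element of the ideal class group of `ℚ(√(-D))` has order dividing `2`. If
`c > 1` is odd and every prime factor `p` of `c` satisfies `(-D/p) = 1`, then a
normalized solution of the form `(a, b, c)` to `x² + D y² = z²` exists. -/
theorem exists_normalized_solution (D : ℕ) (hD : 1 < D) (hsq : Squarefree D)
    (hmod : D % 4 = 1 ∨ D % 4 = 2)
    (K : Type) [Field K] [NumberField K] (ω : K) (hω : ω ^ 2 = -(D : K))
    (hgen : Algebra.adjoin ℚ {ω} = ⊤)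
    (hcg : ∀ g : ClassGroup (NumberField.RingOfIntegers K), g ^ 2 = 1)
    (c : ℕ) (hc : 1 < c) (hodd : Odd c)
    (hfac : ∀ p : ℕ, (hp : p.Prime) → p ∣ c → @legendreSym p ⟨hp⟩ (-(D : ℤ)) = 1) :
    ∃ a b : ℕ, IsNormalizedSolution D a b c := by
  obtain ⟨e⟩ := aux_equiv D hD hsq hmod K ω hω hgen
  have hprin : ∀ I : Ideal (ℤ√(-(D : ℤ))), I ≠ ⊥ → ∃ α, I ^ 2 = Ideal.span {α} := by
    intro I hI
    let J := I.map (e : ℤ√(-(D : ℤ)) →+* NumberField.RingOfIntegers K)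
    have hback : J.map (e.symm : NumberField.RingOfIntegers K →+* ℤ√(-(D : ℤ))) = I :=
      Ideal.map_of_equiv e
    have hJ : J ≠ ⊥ := by
      intro h; rw [h, Ideal.map_bot] at hback; exact hI hback.symm
    have hJm := mem_nonZeroDivisors_iff_ne_zero.mpr hJ
    have h1 := hcg (ClassGroup.mk0 ⟨J, hJm⟩)
    rw [← map_pow] at h1
    have h2 := (ClassGroup.mk0_eq_one_iff (I := J ^ 2) (pow_mem hJm 2)).mp h1
    obtain ⟨β, hβ⟩ := h2.principal
    refine ⟨e.symm β, ?_⟩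
    rw [← hback, ← Ideal.map_pow, hβ]
    change Ideal.map _ (Ideal.span {β}) = _
    rw [Ideal.map_span, Set.image_singleton]
    rfl
  have hloc : ∀ p : ℕ, p.Prime → p ∣ c → ¬ p ∣ 2 ∧ ¬ p ∣ D ∧ ∃ r : ℤ, (p : ℤ) ∣ r ^ 2 + D := by
    intro p hp hpc
    have : Fact p.Prime := ⟨hp⟩
    have hl : legendreSym p (-(D : ℤ)) = 1 := hfac p hp hpc
    have hpD : ¬ p ∣ D := by
      intro hd
      have : legendreSym p (-(D : ℤ)) = 0 := by
        rw [legendreSym.eq_zero_iff]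
        push_cast
        rw [neg_eq_zero, ZMod.natCast_eq_zero_iff]; exact hd
      rw [this] at hl; exact absurd hl (by norm_num)
    refine ⟨?_, hpD, ?_⟩
    · intro h2
      have := (Nat.prime_dvd_prime_iff_eq hp Nat.prime_two).mp h2
      subst this
      exact (Nat.not_even_iff_odd.mpr hodd) (even_iff_two_dvd.mpr hpc)
    · have hne : ((-(D : ℤ) : ℤ) : ZMod p) ≠ 0 := by
        push_cast
        rw [neg_ne_zero, Ne, ZMod.natCast_eq_zero_iff]; exact hpD
      obtain ⟨s, hs⟩ := (legendreSym.eq_one_iff p hne).mp hl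
      obtain ⟨r, rfl⟩ := ZMod.intCast_surjective s
      refine ⟨r, ?_⟩
      rw [← ZMod.intCast_zmod_eq_zero_iff_dvd]
      push_cast at hs ⊢
      linear_combination -hs
  obtain ⟨r, hr⟩ := aux_sqrt D c (by omega) hloc
  refine aux_main D hD hsq hprin c hc r hr ?_
  rw [Int.isCoprime_iff_gcd_eq_one]
  by_contra hne
  obtain ⟨p, hp, hpd⟩ := Nat.exists_prime_and_dvd hne
  have hpg : (p : ℤ) ∣ (Int.gcd (c : ℤ) (2 * r) : ℤ) := by exact_mod_cast hpd
  have hpc : (p : ℤ) ∣ c := hpg.trans (Int.gcd_dvd_left _ _)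
  have hp2 : (p : ℤ) ∣ 2 * r := hpg.trans (Int.gcd_dvd_right _ _)
  obtain ⟨h2, hpD, -⟩ := hloc p hp (by exact_mod_cast hpc)
  rcases (Nat.prime_iff_prime_int.mp hp).dvd_or_dvd hp2 with h | h
  · exact h2 (by exact_mod_cast h)
  · apply hpD
    have h3 : (p : ℤ) ∣ r ^ 2 := dvd_pow h two_ne_zero
    exact_mod_cast (dvd_add_right h3).mp (hpc.trans hr)
end

section
/- Let D > 1 be a squarefree positive integer and p an odd prime with Legendre symbol (−D/p) = 1. Let α ≥ 1 and let x₀, y₀ be integers with gcd(x₀, y₀) = 1 and x₀² + D y₀² = p^{2α}. Let c, d be integers with gcd(c, d) = 1 such that p^{2α} divides c² + D d². Then exactly one of the following holds in the ring ℤ[√(−D)]: (x₀ + y₀√(−D)) divides (c + d√(−D)), or (x₀ − y₀√(−D)) divides (c + d√(−D)). -/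
theorem dvd_iff_aux (D N x y c d : ℤ) (hN : N ≠ 0) (hn : x ^ 2 + D * y ^ 2 = N)
    (hy : IsCoprime N y) :
    ((⟨x, y⟩ : Zsqrtd (-D)) ∣ (⟨c, d⟩ : Zsqrtd (-D))) ↔ N ∣ d * x - c * y := by
  constructor
  · rintro ⟨⟨u, v⟩, h⟩
    have h1 := congrArg Zsqrtd.re h
    have h2 := congrArg Zsqrtd.im h
    simp only [Zsqrtd.re_mul, Zsqrtd.im_mul] at h1 h2
    refine ⟨v, ?_⟩
    rw [h1, h2, ← hn]; ring
  · rintro ⟨v, hv⟩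
    have h1 : N ∣ y * (c * x + D * d * y) := by
      refine ⟨d - v * x, ?_⟩
      linear_combination d * hn - x * hv
    obtain ⟨u, hu⟩ := hy.dvd_of_dvd_mul_left h1
    refine ⟨⟨u, v⟩, ?_⟩
    rw [Zsqrtd.ext_iff]
    simp only [Zsqrtd.re_mul, Zsqrtd.im_mul]
    constructor
    · apply mul_left_cancel₀ hN
      linear_combination x * hu - D * y * hv - c * hn
    · apply mul_left_cancel₀ hN
      linear_combination y * hu + x * hv - d * hn

/-- Let `D > 1` be squarefree and `p` an odd prime with `(-D/p) = 1`. Suppose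
`x₀² + D y₀² = p^(2α)` with `gcd(x₀, y₀) = 1` and `α ≥ 1`, and suppose
`p^(2α) ∣ c² + D d²` with `gcd(c, d) = 1`. Then, in `ℤ[√(-D)]`, exactly one of
`x₀ + y₀√(-D)` and `x₀ - y₀√(-D)` divides `c + d√(-D)`. -/
theorem division_lemma (D : ℕ) (hD : 1 < D) (hsq : Squarefree D)
    (p : ℕ) (hp : p.Prime) (hp2 : p ≠ 2)
    (hleg : @legendreSym p ⟨hp⟩ (-(D : ℤ)) = 1)
    (α : ℕ) (hα : 1 ≤ α)
    (x₀ y₀ : ℤ) (hxy : Int.gcd x₀ y₀ = 1)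
    (hnorm : x₀ ^ 2 + (D : ℤ) * y₀ ^ 2 = (p : ℤ) ^ (2 * α))
    (c d : ℤ) (hcd : Int.gcd c d = 1)
    (hdvd : (p : ℤ) ^ (2 * α) ∣ c ^ 2 + (D : ℤ) * d ^ 2) :
    Xor' ((⟨x₀, y₀⟩ : Zsqrtd (-(D : ℤ))) ∣ (⟨c, d⟩ : Zsqrtd (-(D : ℤ))))
      ((⟨x₀, -y₀⟩ : Zsqrtd (-(D : ℤ))) ∣ (⟨c, d⟩ : Zsqrtd (-(D : ℤ)))) := by
  have hpZ : Prime (p : ℤ) := Nat.prime_iff_prime_int.mp hp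
  have hN : (p : ℤ) ^ (2 * α) ≠ 0 := pow_ne_zero _ hpZ.ne_zero
  have hpN : (p : ℤ) ∣ (p : ℤ) ^ (2 * α) := dvd_pow_self _ (by omega)
  have hpD : ¬ (p : ℤ) ∣ (D : ℤ) := by
    intro h
    haveI : Fact p.Prime := ⟨hp⟩
    have h0 : legendreSym p (-(D : ℤ)) = 0 := by
      rw [legendreSym.eq_zero_iff, ZMod.intCast_zmod_eq_zero_iff_dvd] <;> simpa using h
    rw [h0] at hleg
    exact absurd hleg (by norm_num)
  have hp2' : ¬ (p : ℤ) ∣ 2 := by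
    intro h
    have h' : p ∣ 2 := by exact_mod_cast h
    exact hp2 ((Nat.prime_dvd_prime_iff_eq hp Nat.prime_two).mp h')
  have hnot : ∀ a b : ℤ, Int.gcd a b = 1 → (p : ℤ) ∣ a → ¬ (p : ℤ) ∣ b := by
    intro a b hab ha hb
    exact hpZ.not_unit ((Int.isCoprime_iff_gcd_eq_one.mpr hab).isUnit_of_dvd' ha hb)
  have hs : (p : ℤ) ∣ x₀ ^ 2 + (D : ℤ) * y₀ ^ 2 := hnorm ▸ hpN
  have hpy : ¬ (p : ℤ) ∣ y₀ := by
    intro h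
    have : (p : ℤ) ∣ x₀ ^ 2 :=
      (dvd_add_left (Dvd.dvd.mul_left (dvd_pow h two_ne_zero) _)).mp hs
    exact hnot _ _ hxy (hpZ.dvd_of_dvd_pow this) h
  have hpx : ¬ (p : ℤ) ∣ x₀ := by
    intro h
    have : (p : ℤ) ∣ D * y₀ ^ 2 := (dvd_add_right (dvd_pow h two_ne_zero)).mp hs
    rcases hpZ.dvd_or_dvd this with h1 | h1
    · exact hpD h1
    · exact hpy (hpZ.dvd_of_dvd_pow h1)
  have hcop : ∀ b : ℤ, ¬ (p : ℤ) ∣ b → IsCoprime ((p : ℤ) ^ (2 * α)) b := fun b hb =>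
    IsCoprime.pow_left ((Prime.coprime_iff_not_dvd hpZ).mpr hb)
  rw [dvd_iff_aux D _ x₀ y₀ c d hN hnorm (hcop _ hpy),
    dvd_iff_aux D _ x₀ (-y₀) c d hN (by rw [← hnorm]; ring) (hcop _ (by rwa [dvd_neg]))]
  have hboth : (p : ℤ) ∣ d * x₀ - c * y₀ → ¬ (p : ℤ) ∣ d * x₀ - c * -y₀ := by
    intro h1 h2
    have h3 : (p : ℤ) ∣ 2 * (d * x₀) := by
      have := dvd_add h1 h2
      ring_nf at this ⊢; exact this
    have h4 : (p : ℤ) ∣ 2 * (c * y₀) := by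
      have := dvd_sub h2 h1
      ring_nf at this ⊢; exact this
    have h5 := (hpZ.dvd_or_dvd ((hpZ.dvd_or_dvd h3).resolve_left hp2')).resolve_right hpx
    have h6 := (hpZ.dvd_or_dvd ((hpZ.dvd_or_dvd h4).resolve_left hp2')).resolve_right hpy
    exact hnot _ _ hcd h6 h5
  have hprod : (p : ℤ) ^ (2 * α) ∣ (d * x₀ - c * y₀) * (d * x₀ - c * -y₀) := by
    obtain ⟨k, hk⟩ := hdvd
    refine ⟨d ^ 2 - k * y₀ ^ 2, ?_⟩
    linear_combination d ^ 2 * hnorm - y₀ ^ 2 * hk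
  by_cases h : (p : ℤ) ∣ d * x₀ - c * y₀
  · exact Or.inl ⟨(hcop _ (hboth h)).dvd_of_dvd_mul_right hprod,
      fun h2 => hboth h (hpN.trans h2)⟩
  · exact Or.inr ⟨(hcop _ h).dvd_of_dvd_mul_left hprod, fun h2 => h (hpN.trans h2)⟩
end

section
/- Let D > 1 be a squarefree positive integer and p an odd prime. If (x₀, y₀) and (x₁, y₁) are two pairs of positive integers with gcd(x₀, y₀) = 1, gcd(x₁, y₁) = 1, and x₀² + D y₀² = x₁² + D y₁² = p², then x₀ = x₁ and y₀ = y₁. In other words, the equation x² + D y² = z² has at most one normalized solution of the form (a, b, p). -/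
/-- Let `D > 1` be squarefree and `p` an odd prime. If `(x₀, y₀)` and
`(x₁, y₁)` are pairs of positive integers, each coprime, with
`x₀² + D y₀² = x₁² + D y₁² = p²`, then `x₀ = x₁` and `y₀ = y₁`; i.e.,
`x² + D y² = z²` has at most one normalized solution of the form `(a, b, p)`. -/
theorem unique_solution_for_prime (D : ℕ) (hD : 1 < D) (hsq : Squarefree D)
    (p : ℕ) (hp : p.Prime) (hp2 : p ≠ 2)
    (x₀ y₀ x₁ y₁ : ℕ) (hx₀ : 0 < x₀) (hy₀ : 0 < y₀) (hx₁ : 0 < x₁) (hy₁ : 0 < y₁)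
    (hcop₀ : Nat.gcd x₀ y₀ = 1) (hcop₁ : Nat.gcd x₁ y₁ = 1)
    (h₀ : x₀ ^ 2 + D * y₀ ^ 2 = p ^ 2) (h₁ : x₁ ^ 2 + D * y₁ ^ 2 = p ^ 2) :
    x₀ = x₁ ∧ y₀ = y₁ := by
  have hpp : Prime (p : ℤ) := Nat.prime_iff_prime_int.mp hp
  have hp0 : 0 < p := hp.pos
  have hxp : x₀ < p := by
    have : 0 < D * y₀ ^ 2 := by positivity
    exact lt_of_pow_lt_pow_left₀ 2 hp0.le (by omega)
  have hyp : y₁ < p := by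
    have h : 0 < x₁ ^ 2 := by positivity
    have : y₁ ^ 2 ≤ D * y₁ ^ 2 := Nat.le_mul_of_pos_left _ (by omega)
    exact lt_of_pow_lt_pow_left₀ 2 hp0.le (by omega)
  have nd : ¬ (p ∣ 2 * x₀ * y₁) := by
    intro h
    rcases hp.dvd_mul.mp h with h | h
    · rcases hp.dvd_mul.mp h with h | h
      · exact hp2 ((Nat.prime_dvd_prime_iff_eq hp Nat.prime_two).mp h)
      · exact absurd (Nat.le_of_dvd hx₀ h) (by omega)
    · exact absurd (Nat.le_of_dvd hy₁ h) (by omega)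
  have e₀ : (x₀ : ℤ) ^ 2 + D * y₀ ^ 2 = p ^ 2 := by exact_mod_cast h₀
  have e₁ : (x₁ : ℤ) ^ 2 + D * y₁ ^ 2 = p ^ 2 := by exact_mod_cast h₁
  have hDz : (1 : ℤ) < D := by exact_mod_cast hD
  have hpz : (0 : ℤ) < p := by exact_mod_cast hp0
  have key : ((x₀ : ℤ) * y₁ - x₁ * y₀) * (x₀ * y₁ + x₁ * y₀) = p ^ 2 * (y₁ ^ 2 - y₀ ^ 2) := by
    linear_combination (y₁ : ℤ) ^ 2 * e₀ - (y₀ : ℤ) ^ 2 * e₁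
  have big : ∀ t C : ℤ, C ^ 2 + D * t ^ 2 = p ^ 4 → (p : ℤ) ^ 2 ∣ t → t = 0 := by
    rintro t C h ⟨k, rfl⟩
    by_contra hne
    have hk : k ≠ 0 := by rintro rfl; simp at hne
    have hk2 : 1 ≤ k ^ 2 := by have := sq_pos_of_ne_zero hk; omega
    have hp4 : (0 : ℤ) < p ^ 4 := by positivity
    have h2 : (D : ℤ) * k ^ 2 > 1 := by nlinarith
    have h3 : C ^ 2 + p ^ 4 * (D * k ^ 2) = (p : ℤ) ^ 4 := by linear_combination h
    nlinarith [sq_nonneg C]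
  have kd : (p : ℤ) ^ 2 ∣ ((x₀ : ℤ) * y₁ - x₁ * y₀) * (x₀ * y₁ + x₁ * y₀) := ⟨_, key⟩
  have A0 : (x₀ : ℤ) * y₁ - x₁ * y₀ = 0 := by
    by_cases hA : (p : ℤ) ∣ (x₀ : ℤ) * y₁ - x₁ * y₀
    · have hB : ¬ (p : ℤ) ∣ (x₀ : ℤ) * y₁ + x₁ * y₀ := by
        intro hB
        apply nd
        have h := dvd_add hA hB
        have h' : (x₀ : ℤ) * y₁ - x₁ * y₀ + (x₀ * y₁ + x₁ * y₀) = ((2 * x₀ * y₁ : ℕ) : ℤ) := by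
          push_cast; ring
        rw [h'] at h
        exact_mod_cast h
      have hc : IsCoprime ((p : ℤ) ^ 2) ((x₀ : ℤ) * y₁ + x₁ * y₀) :=
        ((Prime.coprime_iff_not_dvd hpp).mpr hB).pow_left
      refine big _ (x₀ * x₁ + D * y₀ * y₁) ?_ (hc.dvd_of_dvd_mul_right kd)
      linear_combination ((x₁ : ℤ) ^ 2 + D * y₁ ^ 2) * e₀ + (p : ℤ) ^ 2 * e₁
    · have hc : IsCoprime ((p : ℤ) ^ 2) ((x₀ : ℤ) * y₁ - x₁ * y₀) :=
        ((Prime.coprime_iff_not_dvd hpp).mpr hA).pow_left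
      have hz := big _ (x₀ * x₁ - D * y₀ * y₁) (by
        linear_combination ((x₁ : ℤ) ^ 2 + D * y₁ ^ 2) * e₀ + (p : ℤ) ^ 2 * e₁)
        (hc.dvd_of_dvd_mul_left kd)
      have : (0 : ℤ) < (x₀ : ℤ) * y₁ + x₁ * y₀ := by positivity
      omega
  have hy : y₀ = y₁ := by
    rw [A0, zero_mul] at key
    have h : (y₁ : ℤ) ^ 2 - y₀ ^ 2 = 0 := by
      rcases mul_eq_zero.mp key.symm with h | h
      · exact absurd h (by positivity)
      · exact h
    have h' : y₀ ^ 2 = y₁ ^ 2 := by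
      have : (y₀ : ℤ) ^ 2 = y₁ ^ 2 := by linarith
      exact_mod_cast this
    exact Nat.pow_left_injective (by norm_num : 2 ≠ 0) h'
  subst hy
  refine ⟨?_, rfl⟩
  exact Nat.pow_left_injective (by norm_num : 2 ≠ 0) (show x₀ ^ 2 = x₁ ^ 2 by omega)
end

section
/- Let D > 1 be a squarefree positive integer. Suppose (a₁, b₁, c₁) and (a₂, b₂, c₂) are normalized solutions to x² + D y² = z² with gcd(a₁, b₁) = 1, gcd(a₂, b₂) = 1, and gcd(c₁, c₂) = 1. Then gcd(a₁a₂ − D b₁b₂, a₁b₂ + a₂b₁) = 1 and (a₁a₂ − D b₁b₂)² + D (a₁b₂ + a₂b₁)² = (c₁c₂)²; in particular (|a₁a₂ − D b₁b₂|, |a₁b₂ + a₂b₁|, c₁c₂) is a normalized solution. -/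
/-- Let `D > 1` be squarefree. If `(a₁, b₁, c₁)` and `(a₂, b₂, c₂)` are
normalized solutions to `x² + D y² = z²` with `gcd(a₁, b₁) = 1`,
`gcd(a₂, b₂) = 1` and `gcd(c₁, c₂) = 1`, then
`gcd(a₁a₂ - D b₁b₂, a₁b₂ + a₂b₁) = 1` and
`(a₁a₂ - D b₁b₂)² + D (a₁b₂ + a₂b₁)² = (c₁c₂)²`; in particular
`(|a₁a₂ - D b₁b₂|, |a₁b₂ + a₂b₁|, c₁c₂)` is a normalized solution. -/
theorem multiply_solutions (D : ℕ) (hD : 1 < D) (hsq : Squarefree D)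
    (a₁ b₁ c₁ a₂ b₂ c₂ : ℕ)
    (h1 : IsNormalizedSolution D a₁ b₁ c₁) (h2 : IsNormalizedSolution D a₂ b₂ c₂)
    (hab1 : Nat.gcd a₁ b₁ = 1) (hab2 : Nat.gcd a₂ b₂ = 1)
    (hc : Nat.gcd c₁ c₂ = 1) :
    Int.gcd ((a₁ : ℤ) * a₂ - D * b₁ * b₂) ((a₁ : ℤ) * b₂ + a₂ * b₁) = 1 ∧
    ((a₁ : ℤ) * a₂ - D * b₁ * b₂) ^ 2 + D * ((a₁ : ℤ) * b₂ + a₂ * b₁) ^ 2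
      = ((c₁ : ℤ) * c₂) ^ 2 ∧
    IsNormalizedSolution D ((a₁ : ℤ) * a₂ - D * b₁ * b₂).natAbs
      ((a₁ : ℤ) * b₂ + a₂ * b₁).natAbs (c₁ * c₂) := by
  obtain ⟨ha1, hb1, hc1, e1, -⟩ := h1
  obtain ⟨ha2, hb2, hc2, e2, -⟩ := h2
  have E1 : (a₁ : ℤ) ^ 2 + D * b₁ ^ 2 = c₁ ^ 2 := by exact_mod_cast e1
  have E2 : (a₂ : ℤ) ^ 2 + D * b₂ ^ 2 = c₂ ^ 2 := by exact_mod_cast e2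
  have hcop : IsCoprime ((a₁ : ℤ) * a₂ - D * b₁ * b₂) ((a₁ : ℤ) * b₂ + a₂ * b₁) := by
    obtain ⟨u, v, huv⟩ : IsCoprime (a₁ : ℤ) b₁ := Nat.isCoprime_iff_coprime.2 hab1
    obtain ⟨s, t, hst⟩ : IsCoprime (a₂ : ℤ) b₂ := Nat.isCoprime_iff_coprime.2 hab2
    have hcc : IsCoprime (c₁ : ℤ) c₂ := Nat.isCoprime_iff_coprime.2 hc
    obtain ⟨m, n, hmn⟩ : IsCoprime ((c₁ : ℤ) ^ 2) ((c₂ : ℤ) ^ 2) := hcc.pow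
    refine ⟨m * (s * a₁ - t * b₁) + n * (u * a₂ - v * b₂),
      m * (s * (D * b₁) + t * a₁) + n * (u * (D * b₂) + v * a₂), ?_⟩
    have k1 : (s * a₁ - t * b₁) * ((a₁ : ℤ) * a₂ - D * b₁ * b₂)
        + (s * (D * b₁) + t * a₁) * ((a₁ : ℤ) * b₂ + a₂ * b₁) = c₁ ^ 2 := by
      linear_combination (s * a₂ + t * b₂) * E1 + c₁ ^ 2 * hst
    have k2 : (u * a₂ - v * b₂) * ((a₁ : ℤ) * a₂ - D * b₁ * b₂)
        + (u * (D * b₂) + v * a₂) * ((a₁ : ℤ) * b₂ + a₂ * b₁) = c₂ ^ 2 := by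
      linear_combination (u * a₁ + v * b₁) * E2 + c₂ ^ 2 * huv
    linear_combination m * k1 + n * k2 + hmn
  have heq : ((a₁ : ℤ) * a₂ - D * b₁ * b₂) ^ 2 + D * ((a₁ : ℤ) * b₂ + a₂ * b₁) ^ 2
      = ((c₁ : ℤ) * c₂) ^ 2 := by
    linear_combination ((a₂ : ℤ) ^ 2 + D * b₂ ^ 2) * E1 + c₁ ^ 2 * E2
  have hg := Int.isCoprime_iff_gcd_eq_one.1 hcop
  refine ⟨hg, heq, ?_, ?_, by positivity, ?_, ?_⟩
  · rw [Int.natAbs_pos]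
    intro h0
    rw [h0] at heq hcop
    have hu : IsUnit ((a₁ : ℤ) * b₂ + a₂ * b₁) := isCoprime_zero_left.1 hcop
    have h1 := Int.isUnit_sq hu
    rw [h1] at heq
    have hDc : D = (c₁ * c₂) * (c₁ * c₂) := by
      zify
      linear_combination heq
    have := Nat.isUnit_iff.1 (hsq (c₁ * c₂) ⟨1, by rw [mul_one]; exact hDc⟩)
    rw [this] at hDc
    omega
  · rw [Int.natAbs_pos]
    positivity
  · zify
    rw [sq_abs, sq_abs]
    exact heq
  · have : Nat.gcd ((a₁ : ℤ) * a₂ - D * b₁ * b₂).natAbs ((a₁ : ℤ) * b₂ + a₂ * b₁).natAbs = 1 := hg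
    rw [this, Nat.gcd_one_left]
end

section
/- Let D > 1 be a squarefree positive integer with D ≡ 1 or 2 (mod 4), and suppose every element of the ideal class group of ℚ(√(−D)) has order dividing 2. Let a, b be integers with gcd(a, b) = 1 and let c > 1 satisfy a² + D b² = c², where c = p₁^{α₁} ⋯ p_k^{α_k} is the factorization of c into distinct primes. For each i let (xᵢ, yᵢ) be the unique pair of positive coprime integers with xᵢ² + D yᵢ² = pᵢ². Then there exist a sign s ∈ {1, −1} and signs ε₁, …, ε_k ∈ {1, −1} such that, in the ring ℤ[√(−D)], a + b√(−D) = s · ∏_{i=1}^{k} (xᵢ + εᵢ yᵢ √(−D))^{αᵢ}. Equivalently, every element z = (a + b√(−D))/c of G_D(ℚ) with gcd(a,b) = 1 and c > 1 factors as z = ± ζ_{p₁}^{±α₁} ⋯ ζ_{p_k}^{±α_k}. -/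
lemma gd_step (D : ℤ) (hD3 : ∀ x y : ℤ, 0 < x → 0 < y → x ^ 2 + D * y ^ 2 ≠ 4) (hD : 1 < D)
    (hsq : Squarefree D) (p : ℕ) (hp : p.Prime) (x y : ℤ) (hx : 0 < x) (hy : 0 < y)
    (hxy : IsCoprime x y) (h : x ^ 2 + D * y ^ 2 = (p : ℤ) ^ 2)
    (a b : ℤ) (hab : IsCoprime a b) (c : ℤ)
    (heq : a ^ 2 + D * b ^ 2 = (p * c) ^ 2) :
    ∃ e : ℤ, (e = 1 ∨ e = -1) ∧ ∃ a' b' : ℤ, IsCoprime a' b' ∧ a' ^ 2 + D * b' ^ 2 = c ^ 2 ∧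
      a = a' * x - D * b' * (e * y) ∧ b = a' * (e * y) + b' * x := by
  have hpp : Prime (p : ℤ) := Nat.prime_iff_prime_int.mp hp
  have hp0 : (0 : ℤ) < p := by exact_mod_cast hp.pos
  have hp2 : p ≠ 2 := by
    rintro rfl
    exact hD3 x y hx hy (by rw [h]; norm_num)
  have hy_lt : y < p := by nlinarith
  have hpy : ¬ (p : ℤ) ∣ y := fun hd => by
    have := Int.le_of_dvd hy hd
    omega
  have hpx : ¬ (p : ℤ) ∣ x := fun hd => by
    have := Int.le_of_dvd hx hd
    nlinarith
  have hpD : ¬ (p : ℤ) ∣ D := fun hd => by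
    apply hpx
    apply hpp.dvd_of_dvd_pow (n := 2)
    have : x ^ 2 = p ^ 2 - D * y ^ 2 := by linarith
    rw [this]
    exact dvd_sub (dvd_pow_self _ (by norm_num)) (hd.mul_right _)
  have hpa : ¬ (p : ℤ) ∣ a := fun hd => by
    have h1 : (p : ℤ) ∣ D * b ^ 2 := by
      have : D * b ^ 2 = (p * c) ^ 2 - a ^ 2 := by linarith
      rw [this]
      exact dvd_sub (Dvd.dvd.pow (dvd_mul_right _ _) (by norm_num)) (hd.pow (by norm_num))
    rcases hpp.dvd_or_dvd h1 with h2 | h2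
    · exact hpD h2
    · exact hpp.not_isUnit (hab.isUnit_of_dvd' hd (hpp.dvd_of_dvd_pow h2))
  have hp2' : ¬ (p : ℤ) ∣ 2 := fun hd => by
    have h3 : p ∣ 2 := by exact_mod_cast hd
    exact hp2 ((Nat.prime_dvd_prime_iff_eq hp Nat.prime_two).mp h3)
  have hprod : (p : ℤ) ^ 2 ∣ (a * y - b * x) * (a * y + b * x) :=
    ⟨y ^ 2 * c ^ 2 - b ^ 2, by linear_combination y ^ 2 * heq - b ^ 2 * h⟩
  have key : ∃ e : ℤ, (e = 1 ∨ e = -1) ∧ (p : ℤ) ^ 2 ∣ a * (e * y) - b * x := by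
    by_cases h1 : (p : ℤ) ∣ a * y - b * x
    · have h2 : ¬ (p : ℤ) ∣ a * y + b * x := fun h2 => by
        have h3 : (p : ℤ) ∣ 2 * (a * y) := by
          have := dvd_add h1 h2
          ring_nf at this ⊢
          exact this
        rcases hpp.dvd_or_dvd h3 with h4 | h4
        · exact hp2' h4
        · rcases hpp.dvd_or_dvd h4 with h5 | h5
          · exact hpa h5
          · exact hpy h5
      refine ⟨1, Or.inl rfl, ?_⟩
      rw [one_mul]
      exact hpp.pow_dvd_of_dvd_mul_right 2 h2 hprod
    · refine ⟨-1, Or.inr rfl, ?_⟩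
      have := hpp.pow_dvd_of_dvd_mul_left 2 h1 hprod
      have h3 : a * (-1 * y) - b * x = -(a * y + b * x) := by ring
      rw [h3]
      exact (dvd_neg).mpr this
  obtain ⟨e, he, k, hk⟩ := key
  have hee : e ^ 2 = 1 := by rcases he with rfl | rfl <;> norm_num
  have hm : (p : ℤ) ^ 2 ∣ a * x + D * b * (e * y) := by
    rw [← Int.pow_dvd_pow_iff (n := 2) (by norm_num)]
    refine ⟨c ^ 2 - D * k ^ 2, ?_⟩
    linear_combination (x ^ 2 + D * y ^ 2) * heq + (p * c) ^ 2 * h - D * (a * (e * y) - b * x + p ^ 2 * k) * hk + (D * y ^ 2 * D * b ^ 2 + D * a ^ 2 * y ^ 2) * hee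
  obtain ⟨m, hm⟩ := hm
  have hp20 : (p : ℤ) ^ 2 ≠ 0 := by positivity
  have ha : a = m * x - D * (-k) * (e * y) := by
    apply mul_left_cancel₀ hp20
    linear_combination x * hm + D * e * y * hk - a * h - D * a * y ^ 2 * hee
  have hb : b = m * (e * y) + (-k) * x := by
    apply mul_left_cancel₀ hp20
    linear_combination (e * y) * hm - x * hk - b * h - D * b * y ^ 2 * hee
  refine ⟨e, he, m, -k, ?_, ?_, ha, hb⟩
  · obtain ⟨u, v, huv⟩ := hab
    refine ⟨u * x + v * (e * y), -u * D * (e * y) + v * x, ?_⟩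
    rw [ha, hb] at huv
    linear_combination huv
  · apply mul_left_cancel₀ hp20
    rw [ha, hb] at heq
    linear_combination heq - (m ^ 2 + D * k ^ 2) * h - (m ^ 2 + D * k ^ 2) * D * y ^ 2 * hee

lemma gd_main (D : ℕ) (hD3 : ∀ x y : ℤ, 0 < x → 0 < y → x ^ 2 + (D : ℤ) * y ^ 2 ≠ 4)
    (hD : 1 < D) (hsq : Squarefree (D : ℤ)) (x y : ℕ → ℤ) (c : ℕ) :
    0 < c → (∀ p ∈ c.primeFactors, 0 < x p ∧ 0 < y p ∧ IsCoprime (x p) (y p) ∧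
      (x p) ^ 2 + (D : ℤ) * (y p) ^ 2 = (p : ℤ) ^ 2) → ∀ a b : ℤ, IsCoprime a b →
    a ^ 2 + (D : ℤ) * b ^ 2 = (c : ℤ) ^ 2 →
    ∃ (s : Zsqrtd (-(D : ℤ))) (ε : ℕ → ℤ),
      (s = 1 ∨ s = -1) ∧ (∀ p, ε p = 1 ∨ ε p = -1) ∧
      (⟨a, b⟩ : Zsqrtd (-(D : ℤ)))
        = s * c.factorization.prod fun p k =>
            (⟨x p, ε p * y p⟩ : Zsqrtd (-(D : ℤ))) ^ k := by
  induction c using induction_on_primes with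
  | zero => intro h; omega
  | one =>
    intro _ _ a b _ heq
    have hD' : (1 : ℤ) < D := by exact_mod_cast hD
    have hb : b = 0 := by
      by_contra hb
      have : 0 < b ^ 2 := by positivity
      push_cast at heq
      nlinarith [sq_nonneg a]
    subst hb
    have ha : a ^ 2 = 1 := by simpa using heq
    rcases (sq_eq_sq_iff_eq_or_eq_neg.mp (ha.trans (one_pow 2).symm)) with rfl | rfl
    · exact ⟨1, fun _ => 1, Or.inl rfl, fun _ => Or.inl rfl, by simp; rfl⟩
    · exact ⟨-1, fun _ => 1, Or.inr rfl, fun _ => Or.inl rfl, by simp; rfl⟩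
  | prime_mul p c hp ih =>
    intro hc hxy a b hab heq
    have hc0 : c ≠ 0 := by rintro rfl; simp at hc
    have hpc : p * c ≠ 0 := hc.ne'
    obtain ⟨hx, hy, hcop, hn⟩ := hxy p (Nat.mem_primeFactors.mpr ⟨hp, dvd_mul_right _ _, hpc⟩)
    obtain ⟨e, he, a', b', hab', heq', ha, hb⟩ := gd_step D hD3 (by exact_mod_cast hD) hsq p hp
      (x p) (y p) hx hy hcop hn a b hab c (by rw [heq]; push_cast; ring)
    obtain ⟨s, ε, hs, hε, hF⟩ := ih (Nat.pos_of_ne_zero hc0)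
      (fun q hq => hxy q (Nat.primeFactors_mono (dvd_mul_left _ _) hpc hq)) a' b' hab' heq'
    have hmul : (⟨a, b⟩ : Zsqrtd (-(D : ℤ))) = ⟨x p, e * y p⟩ * ⟨a', b'⟩ := by
      rw [Zsqrtd.ext_iff]
      simp only [Zsqrtd.re_mul, Zsqrtd.im_mul]
      constructor
      · rw [ha]; ring
      · rw [hb]; ring
    have hfac : ∀ z : ℕ → Zsqrtd (-(D : ℤ)), ((p * c).factorization.prod fun q k => z q ^ k)
        = z p * c.factorization.prod fun q k => z q ^ k := by
      intro z
      rw [Nat.factorization_mul hp.ne_zero hc0, Finsupp.prod_add_index' (by simp) (by intros; rw [pow_add]),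
        hp.factorization, Finsupp.prod_single_index (by simp), pow_one]
    refine ⟨s, Function.update ε p e, hs, ?_, ?_⟩
    · intro q
      by_cases hq : q = p
      · subst hq; simpa using he
      · simpa [Function.update_of_ne hq] using hε q
    rw [hfac (fun q => ⟨x q, Function.update ε p e q * y q⟩), hmul, Function.update_self]
    have hagree : (c.factorization.prod fun q k =>
        (⟨x q, ε q * y q⟩ : Zsqrtd (-(D : ℤ))) ^ k) = c.factorization.prod fun q k =>
        (⟨x q, Function.update ε p e q * y q⟩ : Zsqrtd (-(D : ℤ))) ^ k := by
      apply Finsupp.prod_congr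
      intro q hq
      by_cases hqp : q = p
      · subst hqp
        have hee : ε q = e := by
          by_contra hne
          have hneg : ε q * e = -1 := by
            rcases hε q with h1 | h1 <;> rcases he with h2 | h2 <;> simp_all
          have hd1 : (⟨x q, ε q * y q⟩ : Zsqrtd (-(D : ℤ))) ∣ ⟨a', b'⟩ := by
            rw [hF]
            apply Dvd.dvd.mul_left
            refine dvd_trans (dvd_pow_self _ (Finsupp.mem_support_iff.mp hq)) ?_
            exact Finset.dvd_prod_of_mem
              (fun q => (⟨x q, ε q * y q⟩ : Zsqrtd (-(D : ℤ))) ^ (c.factorization q)) hq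
          have hd2 : (((q : ℤ) ^ 2 : ℤ) : Zsqrtd (-(D : ℤ))) ∣ ⟨a, b⟩ := by
            rw [hmul]
            refine dvd_trans (dvd_of_eq ?_) (mul_dvd_mul_left _ hd1)
            rw [Zsqrtd.ext_iff]
            simp only [Zsqrtd.re_mul, Zsqrtd.im_mul, Zsqrtd.re_intCast, Zsqrtd.im_intCast]
            constructor
            · linear_combination -hn + D * y q ^ 2 * hneg
            · have : ε q + e = 0 := by
                rcases hε q with h1 | h1 <;> rcases he with h2 | h2 <;> simp_all
              linear_combination - x q * y q * this
          rw [Zsqrtd.intCast_dvd] at hd2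
          have hu := hab.isUnit_of_dvd' hd2.1 hd2.2
          exact (Nat.prime_iff_prime_int.mp hp).not_isUnit
            (isUnit_of_dvd_unit (dvd_pow_self _ (by norm_num)) hu)
        simp [hee]
      · rw [Function.update_of_ne hqp]
    rw [← hagree, hF]
    ring

/-- Factorization of elements of `G_D(ℚ)`: let `D > 1` be squarefree with
`D ≡ 1` or `2 (mod 4)`, and suppose every element of the ideal class group of
`ℚ(√(-D))` has order dividing `2`. Let `gcd(a, b) = 1`, `c > 1`, and
`a² + D b² = c²`. For each prime `p ∣ c`, let `(x p, y p)` be the unique pair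
of positive coprime integers with `(x p)² + D (y p)² = p²`. Then there are
signs `s` and `ε p` such that, in `ℤ[√(-D)]`,
`a + b√(-D) = s ∏_p (x p + ε p · y p · √(-D))^(v_p(c))`. -/
theorem factorization_in_GDQ (D : ℕ) (hD : 1 < D) (hsq : Squarefree D)
    (hmod : D % 4 = 1 ∨ D % 4 = 2)
    (K : Type) [Field K] [NumberField K] (ω : K) (hω : ω ^ 2 = -(D : K))
    (hgen : Algebra.adjoin ℚ {ω} = ⊤)
    (hcg : ∀ g : ClassGroup (NumberField.RingOfIntegers K), g ^ 2 = 1)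
    (a b : ℤ) (hab : IsCoprime a b) (c : ℕ) (hc : 1 < c)
    (heq : a ^ 2 + (D : ℤ) * b ^ 2 = (c : ℤ) ^ 2)
    (x y : ℕ → ℤ)
    (hxy : ∀ p ∈ c.primeFactors, 0 < x p ∧ 0 < y p ∧ IsCoprime (x p) (y p) ∧
      (x p) ^ 2 + (D : ℤ) * (y p) ^ 2 = (p : ℤ) ^ 2) :
    ∃ (s : Zsqrtd (-(D : ℤ))) (ε : ℕ → ℤ),
      (s = 1 ∨ s = -1) ∧ (∀ p ∈ c.primeFactors, ε p = 1 ∨ ε p = -1) ∧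
      (⟨a, b⟩ : Zsqrtd (-(D : ℤ)))
        = s * ∏ p ∈ c.primeFactors,
            (⟨x p, ε p * y p⟩ : Zsqrtd (-(D : ℤ))) ^ (c.factorization p) := by
  have hD3 : ∀ x y : ℤ, 0 < x → 0 < y → x ^ 2 + (D : ℤ) * y ^ 2 ≠ 4 := by
    intro x y hx hy h
    have hD' : (1 : ℤ) < D := by exact_mod_cast hD
    have hy1 : y = 1 := by nlinarith
    subst hy1
    have hx1 : x = 1 := by nlinarith
    subst hx1
    have : D = 3 := by omega
    omega
  obtain ⟨s, ε, hs, hε, hF⟩ := gd_main D hD3 hD (Int.squarefree_natCast.mpr hsq) x y c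
    (by omega) hxy a b hab heq
  exact ⟨s, ε, hs, fun p _ => hε p, hF⟩
end

section
/- Let D > 1 be a squarefree positive integer with D ≡ 1 or 2 (mod 4), and suppose every element of the ideal class group of ℚ(√(−D)) has order dividing 2. Let p₁, …, p_k be distinct odd primes with Legendre symbol (−D/pᵢ) = 1, let α₁, …, α_k ≥ 1 be integers, for each i let (xᵢ, yᵢ) be the unique pair of positive coprime integers with xᵢ² + D yᵢ² = pᵢ², and let ε₁, …, ε_k ∈ {1, −1} and s ∈ {1, −1}. Write s · ∏_{i=1}^{k} (xᵢ + εᵢ yᵢ √(−D))^{αᵢ} = a + b√(−D) in ℤ[√(−D)]. Then gcd(a, b) = 1 and a² + D b² = (p₁^{α₁} ⋯ p_k^{α_k})². Equivalently, if z = ± ζ_{p₁}^{±α₁} ⋯ ζ_{p_k}^{±α_k} corresponds to the normalized triple (a, b, c), then c = p₁^{α₁} ⋯ p_k^{α_k}. -/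
/-- Retrieving solutions from factorizations: let `D > 1` be squarefree with
`D ≡ 1` or `2 (mod 4)`, and suppose every element of the ideal class group of
`ℚ(√(-D))` has order dividing `2`. Let `P` be a finite set of distinct odd
primes `p` with `(-D/p) = 1`, let `α p ≥ 1`, let `(x p, y p)` be the unique
positive coprime pair with `(x p)² + D (y p)² = p²`, and let `ε p, s ∈ {±1}`.
If `s ∏_p (x p + ε p · y p √(-D))^(α p) = a + b√(-D)` in `ℤ[√(-D)]`, then
`gcd(a, b) = 1` and `a² + D b² = (∏_p p^(α p))²`. -/
theorem retrieve_solutions (D : ℕ) (hD : 1 < D) (hsq : Squarefree D)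
    (hmod : D % 4 = 1 ∨ D % 4 = 2)
    (K : Type) [Field K] [NumberField K] (ω : K) (hω : ω ^ 2 = -(D : K))
    (hgen : Algebra.adjoin ℚ {ω} = ⊤)
    (hcg : ∀ g : ClassGroup (NumberField.RingOfIntegers K), g ^ 2 = 1)
    (P : Finset ℕ)
    (hP : ∀ p ∈ P, ∃ hp : p.Prime, p ≠ 2 ∧ @legendreSym p ⟨hp⟩ (-(D : ℤ)) = 1)
    (α : ℕ → ℕ) (hα : ∀ p ∈ P, 1 ≤ α p)
    (x y : ℕ → ℤ)
    (hxy : ∀ p ∈ P, 0 < x p ∧ 0 < y p ∧ IsCoprime (x p) (y p) ∧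
      (x p) ^ 2 + (D : ℤ) * (y p) ^ 2 = (p : ℤ) ^ 2)
    (ε : ℕ → ℤ) (hε : ∀ p ∈ P, ε p = 1 ∨ ε p = -1)
    (s : Zsqrtd (-(D : ℤ))) (hs : s = 1 ∨ s = -1)
    (a b : ℤ)
    (hab : s * ∏ p ∈ P, (⟨x p, ε p * y p⟩ : Zsqrtd (-(D : ℤ))) ^ (α p)
      = (⟨a, b⟩ : Zsqrtd (-(D : ℤ)))) :
    IsCoprime a b ∧
      a ^ 2 + (D : ℤ) * b ^ 2 = ((∏ p ∈ P, p ^ (α p) : ℕ) : ℤ) ^ 2 := by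
  have hN : a ^ 2 + (D : ℤ) * b ^ 2 = ((∏ p ∈ P, p ^ (α p) : ℕ) : ℤ) ^ 2 := by
    have h := congrArg (Zsqrtd.normMonoidHom (d := -(D : ℤ))) hab
    have hs1 : Zsqrtd.normMonoidHom (d := -(D : ℤ)) s = 1 := by
      rcases hs with rfl | rfl <;> simp [Zsqrtd.normMonoidHom, Zsqrtd.norm_def]
    rw [map_mul, hs1, one_mul, map_prod] at h
    have h2 : ∀ p ∈ P, Zsqrtd.normMonoidHom (d := -(D : ℤ))
        ((⟨x p, ε p * y p⟩ : Zsqrtd (-(D : ℤ))) ^ (α p)) = ((p : ℤ) ^ α p) ^ 2 := by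
      intro p hp
      obtain ⟨-, -, -, h4⟩ := hxy p hp
      have he : ε p ^ 2 = 1 := by rcases hε p hp with h | h <;> simp [h]
      have : Zsqrtd.normMonoidHom (d := -(D : ℤ))
        (⟨x p, ε p * y p⟩ : Zsqrtd (-(D : ℤ))) = (p : ℤ) ^ 2 := by
        simp only [Zsqrtd.normMonoidHom, MonoidHom.coe_mk, OneHom.coe_mk, Zsqrtd.norm_def]
        linear_combination h4 + (D : ℤ) * y p ^ 2 * he
      rw [map_pow, this]; ring
    rw [Finset.prod_congr rfl h2, Finset.prod_pow] at h
    simp only [Zsqrtd.normMonoidHom, MonoidHom.coe_mk, OneHom.coe_mk, Zsqrtd.norm_def] at h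
    push_cast
    linear_combination -h
  refine ⟨?_, hN⟩
  rw [Int.isCoprime_iff_gcd_eq_one]
  by_contra hg
  obtain ⟨q, hq, hqg⟩ := Nat.exists_prime_and_dvd hg
  have hqa : (q : ℤ) ∣ a := (Int.natCast_dvd_natCast.2 hqg).trans (Int.gcd_dvd_left ..)
  have hqb : (q : ℤ) ∣ b := (Int.natCast_dvd_natCast.2 hqg).trans (Int.gcd_dvd_right ..)
  have hqP : q ∈ P := by
    have h1 : (q : ℤ) ∣ ((∏ p ∈ P, p ^ (α p) : ℕ) : ℤ) ^ 2 := by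
      rw [← hN]
      exact dvd_add (dvd_pow hqa two_ne_zero) (Dvd.dvd.mul_left (dvd_pow hqb two_ne_zero) _)
    have h2 := Int.natCast_dvd_natCast.1 ((Nat.prime_iff_prime_int.1 hq).dvd_of_dvd_pow h1)
    obtain ⟨p, hp, hd⟩ := (hq.prime.dvd_finsetProd_iff _).1 h2
    have h3 := (Nat.prime_dvd_prime_iff_eq hq (hP p hp).1).1 (hq.dvd_of_dvd_pow hd)
    rwa [h3]
  obtain ⟨hq', hq2, hleg⟩ := hP q hqP
  have : Fact q.Prime := ⟨hq⟩
  obtain ⟨-, -, hc, hn⟩ := hxy q hqP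
  have hD0 : (D : ZMod q) ≠ 0 := by
    intro h0
    have : legendreSym q (-(D : ℤ)) = 0 := (legendreSym.eq_zero_iff q _).2 (by simp [h0])
    rw [this] at hleg
    exact zero_ne_one hleg
  have hn' : (x q : ZMod q) ^ 2 + D * (y q : ZMod q) ^ 2 = 0 := by
    have := congrArg (Int.cast : ℤ → ZMod q) hn
    push_cast at this
    simpa using this
  have hc' : ∃ u v : ZMod q, u * x q + v * y q = 1 := by
    obtain ⟨u, v, h⟩ := hc
    exact ⟨u, v, by exact_mod_cast congrArg (Int.cast : ℤ → ZMod q) h⟩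
  obtain ⟨u, v, huv⟩ := hc'
  have hy0 : (y q : ZMod q) ≠ 0 := by
    intro h0
    have hx : (x q : ZMod q) = 0 := by simpa [h0] using hn'
    simp [h0, hx] at huv
  have hx0 : (x q : ZMod q) ≠ 0 := by
    intro h0
    have : (y q : ZMod q) = 0 := by simpa [h0, hD0] using hn'
    exact hy0 this
  have h20 : (2 : ZMod q) ≠ 0 := by
    intro h0
    have : ((2 : ℕ) : ZMod q) = 0 := by exact_mod_cast h0
    rw [ZMod.natCast_eq_zero_iff] at this
    exact hq2 ((Nat.prime_dvd_prime_iff_eq hq Nat.prime_two).1 this)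
  have heq : (ε q : ZMod q) ^ 2 = 1 := by rcases hε q hqP with h | h <;> simp [h]
  have hr : ((ε q : ZMod q) * x q / y q) * ((ε q : ZMod q) * x q / y q)
      = ((-(D : ℤ) : ℤ) : ZMod q) := by
    push_cast
    field_simp
    linear_combination hn' + (x q : ZMod q) ^ 2 * heq
  let φ : Zsqrtd (-(D : ℤ)) →+* ZMod q := Zsqrtd.lift ⟨_, hr⟩
  have hφ : ∀ m n : ℤ, φ ⟨m, n⟩ = m + n * ((ε q : ZMod q) * x q / y q) := fun m n => rfl
  have h0 : φ ⟨a, b⟩ = 0 := by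
    rw [hφ, (ZMod.intCast_zmod_eq_zero_iff_dvd a q).2 hqa,
      (ZMod.intCast_zmod_eq_zero_iff_dvd b q).2 hqb]
    simp
  rw [← hab, map_mul, map_prod, mul_eq_zero] at h0
  rcases h0 with h0 | h0
  · rcases hs with rfl | rfl <;> simp at h0
  obtain ⟨p, hp, h0⟩ := Finset.prod_eq_zero_iff.1 h0
  rw [map_pow] at h0
  have h0 := eq_zero_of_pow_eq_zero h0
  by_cases hpq : p = q
  · subst hpq
    rw [hφ] at h0
    have : (2 : ZMod p) * x p = 0 := by
      rw [← h0]
      push_cast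
      field_simp
      linear_combination -heq
    exact (mul_ne_zero h20 hx0) this
  · have hm : (⟨x p, ε p * y p⟩ : Zsqrtd (-(D : ℤ))) * ⟨x p, -(ε p * y p)⟩
        = (((p : ℤ) ^ 2 : ℤ) : Zsqrtd (-(D : ℤ))) := by
      obtain ⟨-, -, -, h4⟩ := hxy p hp
      have he : ε p ^ 2 = 1 := by rcases hε p hp with h | h <;> simp [h]
      rw [Zsqrtd.ext_iff]
      constructor
      · rw [Zsqrtd.re_mul, Zsqrtd.re_intCast]
        linear_combination h4 + (D : ℤ) * y p ^ 2 * he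
      · rw [Zsqrtd.im_mul, Zsqrtd.im_intCast]
        ring
    have := congrArg φ hm
    rw [map_mul, h0, zero_mul, map_intCast] at this
    push_cast at this
    have hp0 := eq_zero_of_pow_eq_zero this.symm
    rw [ZMod.natCast_eq_zero_iff] at hp0
    exact hpq ((Nat.prime_dvd_prime_iff_eq hq (hP p hp).1).1 hp0).symm
end

section
/- The ideal class group of the imaginary quadratic field ℚ(√(−34)) is cyclic of order 4; in particular, it has order 4 but is not an elementary abelian 2-group, i.e., it contains an element g with g² ≠ 1. -/
open nonZeroDivisors

section abs
variable {R : Type*} [CommRing R] [IsDedekindDomain R]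

theorem mk0_mul_eq_one (I J : (Ideal R)⁰) (x : R)
    (h : (I : Ideal R) * J = Ideal.span {x}) :
    ClassGroup.mk0 I * ClassGroup.mk0 J = 1 := by
  rw [← map_mul, ClassGroup.mk0_eq_one_iff]
  exact ⟨⟨x, by simpa using h⟩⟩

variable (t : R) (ht : t ^ 2 = -34)
include ht

theorem p2sq : Ideal.span {(2 : R), t} * Ideal.span {(2 : R), t} = Ideal.span {2} := by
  apply le_antisymm
  · rw [Ideal.span_pair_mul_span_pair, Ideal.span_le]
    rintro x (rfl | rfl | rfl | rfl) <;> simp only [SetLike.mem_coe, Ideal.mem_span_singleton]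
    · exact ⟨2, rfl⟩
    · exact ⟨t, rfl⟩
    · exact ⟨t, by ring⟩
    · exact ⟨-17, by linear_combination ht⟩
  · rw [Ideal.span_le]
    rintro x rfl
    have h2 : (2 : R) ∈ Ideal.span {(2 : R), t} := Ideal.subset_span (by simp)
    have h3 : t ∈ Ideal.span {(2 : R), t} := Ideal.subset_span (by simp)
    have e : (2 : R) = 9 * (2 * 2) + t * t := by linear_combination -ht
    rw [SetLike.mem_coe]
    refine e.symm.subst (motive := fun y => y ∈ _) ?_
    exact add_mem (Ideal.mul_mem_left _ _ (Ideal.mul_mem_mul h2 h2)) (Ideal.mul_mem_mul h3 h3)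

theorem p5p5 : Ideal.span {(5 : R), t - 1} * Ideal.span {(5 : R), t + 1} = Ideal.span {5} := by
  apply le_antisymm
  · rw [Ideal.span_pair_mul_span_pair, Ideal.span_le]
    rintro x (rfl | rfl | rfl | rfl) <;> simp only [SetLike.mem_coe, Ideal.mem_span_singleton]
    · exact ⟨5, rfl⟩
    · exact ⟨t + 1, rfl⟩
    · exact ⟨t - 1, by ring⟩
    · exact ⟨-7, by linear_combination ht⟩
  · rw [Ideal.span_le]
    rintro x rfl
    have h1 : (5 : R) ∈ Ideal.span {(5 : R), t - 1} := Ideal.subset_span (by simp)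
    have h2 : t - 1 ∈ Ideal.span {(5 : R), t - 1} := Ideal.subset_span (by simp)
    have h3 : (5 : R) ∈ Ideal.span {(5 : R), t + 1} := Ideal.subset_span (by simp)
    have h4 : t + 1 ∈ Ideal.span {(5 : R), t + 1} := Ideal.subset_span (by simp)
    have e : (5 : R) = 3 * (5 * 5) + 2 * ((t - 1) * (t + 1)) := by linear_combination -2*ht
    rw [SetLike.mem_coe]
    refine e.symm.subst (motive := fun y => y ∈ _) ?_
    exact add_mem (Ideal.mul_mem_left _ _ (Ideal.mul_mem_mul h1 h3))
      (Ideal.mul_mem_left _ _ (Ideal.mul_mem_mul h2 h4))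

theorem p7p5 (s : R) (hs : s = 1 ∨ s = -1) :
    Ideal.span {(7 : R), t + s} * Ideal.span {(5 : R), t + s} = Ideal.span {t + s} := by
  have hs2 : s ^ 2 = 1 := by rcases hs with rfl | rfl <;> ring
  apply le_antisymm
  · rw [Ideal.span_pair_mul_span_pair, Ideal.span_le]
    rintro x (rfl | rfl | rfl | rfl) <;> simp only [SetLike.mem_coe, Ideal.mem_span_singleton]
    · exact ⟨s - t, by linear_combination ht - hs2⟩
    · exact ⟨7, by ring⟩
    · exact ⟨5, by ring⟩
    · exact ⟨t + s, rfl⟩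
  · rw [Ideal.span_le]
    rintro x rfl
    have h1 : (7 : R) ∈ Ideal.span {(7 : R), t + s} := Ideal.subset_span (by simp)
    have h2 : t + s ∈ Ideal.span {(7 : R), t + s} := Ideal.subset_span (by simp)
    have h3 : (5 : R) ∈ Ideal.span {(5 : R), t + s} := Ideal.subset_span (by simp)
    have h4 : t + s ∈ Ideal.span {(5 : R), t + s} := Ideal.subset_span (by simp)
    have e : (t + s : R) = 3 * (7 * (t + s)) + (-4) * ((t + s) * 5) := by ring
    rw [SetLike.mem_coe]
    refine e.symm.subst (motive := fun y => y ∈ _) ?_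
    exact add_mem (Ideal.mul_mem_left _ _ (Ideal.mul_mem_mul h1 h4))
      (Ideal.mul_mem_left _ _ (Ideal.mul_mem_mul h2 h3))

theorem p5sqp2 : Ideal.span {(5 : R), t - 1} * Ideal.span {(5 : R), t - 1} *
    Ideal.span {(2 : R), t} = Ideal.span {t + 4} := by
  apply le_antisymm
  · rw [Ideal.span_pair_mul_span_pair, Ideal.span_mul_span', Ideal.span_le]
    rintro x ⟨y, hy, z, hz, rfl⟩
    simp only [SetLike.mem_coe, Ideal.mem_span_singleton]
    rcases hz with rfl | rfl <;> rcases hy with rfl | rfl | rfl | rfl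
    · exact ⟨4 - t, by linear_combination ht⟩
    · exact ⟨t + 6, by linear_combination -ht⟩
    · exact ⟨t + 6, by linear_combination -ht⟩
    · exact ⟨t - 8, by linear_combination ht⟩
    · exact ⟨2 * z + 17, by linear_combination -2 * ht⟩
    · exact ⟨3 * z - 17, by linear_combination 2 * ht⟩
    · exact ⟨3 * z - 17, by linear_combination 2 * ht⟩
    · exact ⟨-4 * z - 17, by linear_combination (z + 2) * ht⟩
  · rw [Ideal.span_le]
    rintro x rfl
    have h1 : (5 : R) ∈ Ideal.span {(5 : R), t - 1} := Ideal.subset_span (by simp)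
    have h2 : t - 1 ∈ Ideal.span {(5 : R), t - 1} := Ideal.subset_span (by simp)
    have h3 : (2 : R) ∈ Ideal.span {(2 : R), t} := Ideal.subset_span (by simp)
    have h4 : t ∈ Ideal.span {(2 : R), t} := Ideal.subset_span (by simp)
    have e : t + 4 = 8 * (5 * 5 * 2) + 6 * ((t - 1) * (t - 1) * 2) + 5 * 5 * t := by
      linear_combination -12 * ht
    rw [SetLike.mem_coe]
    refine e.symm.subst (motive := fun y => y ∈ _) ?_
    exact add_mem (add_mem
      (Ideal.mul_mem_left _ _ (Ideal.mul_mem_mul (Ideal.mul_mem_mul h1 h1) h3))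
      (Ideal.mul_mem_left _ _ (Ideal.mul_mem_mul (Ideal.mul_mem_mul h2 h2) h3)))
      (Ideal.mul_mem_mul (Ideal.mul_mem_mul h1 h1) h4)

theorem lin_indep [CharZero R] (a b : ℤ) (h : (a : R) + b * t = 0) : a = 0 ∧ b = 0 := by
  have h1 : ((a ^ 2 + 34 * b ^ 2 : ℤ) : R) = 0 := by
    push_cast
    linear_combination (a - b * t) * h + b ^ 2 * ht
  have h2 : a ^ 2 + 34 * b ^ 2 = 0 := by exact_mod_cast h1
  constructor <;> nlinarith [sq_nonneg a, sq_nonneg b]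

theorem lin_eq [CharZero R] (a b c d : ℤ) (h : (a : R) + b * t = c + d * t) : a = c ∧ b = d := by
  have := lin_indep t ht (a - c) (b - d) (by push_cast; linear_combination h)
  omega

theorem p2_not_principal [CharZero R] (hR : ∀ x : R, ∃ a b : ℤ, x = a + b * t) :
    ¬ (Ideal.span {(2 : R), t}).IsPrincipal := by
  rintro ⟨⟨x, hx⟩⟩
  rw [Ideal.submodule_span_eq] at hx
  have h2 : (2 : R) ∈ Ideal.span {(2 : R), t} := Ideal.subset_span (by simp)
  have h3 : t ∈ Ideal.span {(2 : R), t} := Ideal.subset_span (by simp)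
  have h4 : x ∈ Ideal.span {(2 : R), t} := hx ▸ Ideal.mem_span_singleton_self x
  rw [hx, Ideal.mem_span_singleton] at h2 h3
  rw [Ideal.mem_span_pair] at h4
  obtain ⟨u, v, huv⟩ := h4
  obtain ⟨y, hy⟩ := h2
  obtain ⟨z, hz⟩ := h3
  obtain ⟨a, b, rfl⟩ := hR x
  obtain ⟨c, d, rfl⟩ := hR y
  obtain ⟨e, f, rfl⟩ := hR z
  obtain ⟨u1, u2, rfl⟩ := hR u
  obtain ⟨v1, v2, rfl⟩ := hR v
  have A := lin_eq t ht a b (2 * u1 - 34 * v2) (2 * u2 + v1) (by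
    push_cast; linear_combination -huv + v2 * ht)
  have B := lin_eq t ht 2 0 (a * c - 34 * b * d) (a * d + b * c) (by
    push_cast; linear_combination hy + b * d * ht)
  have C := lin_eq t ht 0 1 (a * e - 34 * b * f) (a * f + b * e) (by
    push_cast; linear_combination hz + b * f * ht)
  have N : (a ^ 2 + 34 * b ^ 2) * (c ^ 2 + 34 * d ^ 2) = 4 := by
    have : (a ^ 2 + 34 * b ^ 2) * (c ^ 2 + 34 * d ^ 2) =
      (a * c - 34 * b * d) ^ 2 + 34 * (a * d + b * c) ^ 2 := by ring
    rw [this, ← B.1, ← B.2]; norm_num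
  have N1 : a ^ 2 + 34 * b ^ 2 ≤ 4 := Int.le_of_dvd (by norm_num) ⟨_, N.symm⟩
  have hb : b = 0 := by
    have : b ^ 2 < 1 := by nlinarith [sq_nonneg a]
    nlinarith [sq_nonneg b]
  subst hb
  have : a ∣ 1 := ⟨f, by linarith [C.2]⟩
  have h2a : 2 ∣ a := ⟨u1 - 17 * v2, by linarith [A.1]⟩
  have := h2a.trans this
  norm_num at this

theorem eq_span_three (hR : ∀ x : R, ∃ a b : ℤ, x = a + b * t) (P : Ideal R) (hP : P ≠ ⊤)
    (h3 : (3 : R) ∈ P) : P = Ideal.span {3} := by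
  apply le_antisymm
  · intro x hx
    rw [Ideal.mem_span_singleton]
    obtain ⟨a, b, rfl⟩ := hR x
    have hn : ((a ^ 2 + 34 * b ^ 2 : ℤ) : R) ∈ P := by
      have : ((a ^ 2 + 34 * b ^ 2 : ℤ) : R) = (a - b * t) * (a + b * t) := by
        push_cast; linear_combination b ^ 2 * ht
      rw [this]; exact Ideal.mul_mem_left _ _ hx
    have hd : (3 : ℤ) ∣ a ^ 2 + 34 * b ^ 2 := by
      by_contra hc
      have : IsCoprime (3 : ℤ) (a ^ 2 + 34 * b ^ 2) :=
        (Int.prime_three.coprime_iff_not_dvd).2 hc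
      obtain ⟨u, v, huv⟩ := this
      apply hP
      rw [Ideal.eq_top_iff_one]
      have : (1 : R) = u * 3 + v * ((a ^ 2 + 34 * b ^ 2 : ℤ) : R) := by
        rw [← Int.cast_one (R := R), ← huv]; push_cast; ring
      rw [this]
      exact add_mem (Ideal.mul_mem_left _ _ h3) (Ideal.mul_mem_left _ _ hn)
    have hab : (3 : ℤ) ∣ a ∧ (3 : ℤ) ∣ b := by
      have key : ∀ a b : ZMod 3, a ^ 2 + 34 * b ^ 2 = 0 → a = 0 ∧ b = 0 := by decide
      have := key a b (by
        have := (ZMod.intCast_zmod_eq_zero_iff_dvd _ 3).2 hd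
        push_cast at this; exact this)
      exact ⟨(ZMod.intCast_zmod_eq_zero_iff_dvd _ 3).1 this.1,
        (ZMod.intCast_zmod_eq_zero_iff_dvd _ 3).1 this.2⟩
    obtain ⟨⟨u, rfl⟩, ⟨v, rfl⟩⟩ := hab
    exact ⟨u + v * t, by push_cast; ring⟩
  · rw [Ideal.span_le]; rintro x rfl; exact h3

omit ht in
theorem eq_span_pair (hR : ∀ x : R, ∃ a b : ℤ, x = a + b * t) (P : Ideal R) (hP : P ≠ ⊤)
    (p k : ℤ) (hp : Prime p) (hpP : (p : R) ∈ P) (hk : t + (k : R) ∈ P) :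
    P = Ideal.span {(p : R), t + k} := by
  apply le_antisymm
  · intro x hx
    obtain ⟨a, b, rfl⟩ := hR x
    have hn : ((a - b * k : ℤ) : R) ∈ P := by
      have : ((a - b * k : ℤ) : R) = (a + b * t) - b * (t + k) := by
        push_cast; ring
      rw [this]; exact sub_mem hx (Ideal.mul_mem_left _ _ hk)
    have hd : p ∣ a - b * k := by
      by_contra hc
      have : IsCoprime p (a - b * k) :=
        (hp.coprime_iff_not_dvd).2 hc
      obtain ⟨u, v, huv⟩ := this
      apply hP
      rw [Ideal.eq_top_iff_one]
      have : (1 : R) = u * p + v * ((a - b * k : ℤ) : R) := by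
        rw [← Int.cast_one (R := R), ← huv]; push_cast; ring
      rw [this]
      exact add_mem (Ideal.mul_mem_left _ _ hpP) (Ideal.mul_mem_left _ _ hn)
    obtain ⟨c, hc⟩ := hd
    rw [Ideal.mem_span_pair]
    refine ⟨c, b, ?_⟩
    have : (a : R) - b * k = p * c := by exact_mod_cast congrArg (Int.cast (R := R)) hc
    linear_combination -this
  · rw [Ideal.span_le]; rintro x (rfl | rfl)
    · exact hpP
    · exact hk

/-- The main abstract computation. -/
theorem abstract_main [CharZero R] [Module.Free ℤ R] [Module.Finite ℤ R]
    (hR : ∀ x : R, ∃ a b : ℤ, x = a + b * t)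
    (hM : ∀ C : ClassGroup R, ∃ I : (Ideal R)⁰, ClassGroup.mk0 I = C ∧
      Ideal.absNorm (I : Ideal R) ≤ 7) :
    Nat.card (ClassGroup R) = 4 ∧ IsCyclic (ClassGroup R) ∧ ∃ g : ClassGroup R, g ^ 2 ≠ 1 := by
  have nz : ∀ (n x : R), n ≠ 0 → Ideal.span {n, x} ∈ (Ideal R)⁰ := by
    intro n x hn
    rw [mem_nonZeroDivisors_iff_ne_zero]
    intro h
    exact hn (by simpa using (h ▸ Ideal.subset_span (by simp) : n ∈ (0 : Ideal R)))
  let P2 : (Ideal R)⁰ := ⟨Ideal.span {(2 : R), t}, nz _ _ (by norm_num)⟩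
  let P5 : (Ideal R)⁰ := ⟨Ideal.span {(5 : R), t - 1}, nz _ _ (by norm_num)⟩
  let Q5 : (Ideal R)⁰ := ⟨Ideal.span {(5 : R), t + 1}, nz _ _ (by norm_num)⟩
  let P7 : (Ideal R)⁰ := ⟨Ideal.span {(7 : R), t + (-1)}, nz _ _ (by norm_num)⟩
  let Q7 : (Ideal R)⁰ := ⟨Ideal.span {(7 : R), t + 1}, nz _ _ (by norm_num)⟩
  set g := ClassGroup.mk0 P5 with hg
  have e2 : ClassGroup.mk0 P2 * ClassGroup.mk0 P2 = 1 := mk0_mul_eq_one _ _ 2 (p2sq t ht)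
  have e5 : g * ClassGroup.mk0 Q5 = 1 := mk0_mul_eq_one _ _ 5 (p5p5 t ht)
  have e7 : ClassGroup.mk0 P7 * g = 1 :=
    mk0_mul_eq_one _ _ (t + (-1)) (by
      have := p7p5 t ht (-1) (Or.inr rfl)
      simpa only [P7, P5, sub_eq_add_neg] using this)
  have e7' : ClassGroup.mk0 Q7 * ClassGroup.mk0 Q5 = 1 :=
    mk0_mul_eq_one _ _ (t + 1) (p7p5 t ht 1 (Or.inl rfl))
  have e52 : g * g * ClassGroup.mk0 P2 = 1 := by
    rw [hg, ← map_mul]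
    exact mk0_mul_eq_one _ _ (t + 4) (p5sqp2 t ht)
  have n2 : ClassGroup.mk0 P2 ≠ 1 := by
    rw [Ne, ClassGroup.mk0_eq_one_iff]
    exact p2_not_principal t ht hR
  have g2 : g ^ 2 ≠ 1 := by
    intro h
    rw [← pow_two, h, one_mul] at e52
    exact n2 e52
  have g4 : g ^ 4 = 1 := by
    have : g * g = ClassGroup.mk0 P2 := by
      rw [eq_inv_of_mul_eq_one_left e52, inv_eq_of_mul_eq_one_left e2]
    calc g ^ 4 = (g * g) * (g * g) := by simp only [pow_succ, pow_zero, one_mul, mul_assoc]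
      _ = 1 := by rw [this, e2]
  have m5 : g ∈ Subgroup.zpowers g := Subgroup.mem_zpowers g
  have m5' : ClassGroup.mk0 Q5 ∈ Subgroup.zpowers g := by
    rw [eq_inv_of_mul_eq_one_right e5]; exact inv_mem m5
  have m2 : ClassGroup.mk0 P2 ∈ Subgroup.zpowers g := by
    rw [eq_inv_of_mul_eq_one_right e52]; exact inv_mem (mul_mem m5 m5)
  have m7 : ClassGroup.mk0 P7 ∈ Subgroup.zpowers g := by
    rw [eq_inv_of_mul_eq_one_left e7]; exact inv_mem m5
  have m7' : ClassGroup.mk0 Q7 ∈ Subgroup.zpowers g := by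
    rw [eq_inv_of_mul_eq_one_left e7']; exact inv_mem m5'
  -- prime ideals of small norm
  have hprime : ∀ P : Ideal R, ∀ h : P ∈ (Ideal R)⁰, P.IsPrime → Ideal.absNorm P ≤ 7 →
      ClassGroup.mk0 ⟨P, h⟩ ∈ Subgroup.zpowers g := by
    intro P h hP hn
    have n0 : 0 < Ideal.absNorm P := Ideal.absNorm_pos_of_nonZeroDivisors ⟨P, h⟩
    have hmem := Ideal.absNorm_mem P
    have c2 : (2 : R) ∈ P → ClassGroup.mk0 ⟨P, h⟩ ∈ Subgroup.zpowers g := by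
      intro h2
      have h3 : t ∈ P := by
        apply hP.mem_of_pow_mem 2
        rw [ht, show (-34 : R) = (-17) * 2 by norm_num]
        exact Ideal.mul_mem_left _ _ h2
      have : P2 = ⟨P, h⟩ := Subtype.ext
        (by simpa using (eq_span_pair t hR P hP.ne_top 2 0 Int.prime_two (by simpa using h2)
          (by simpa using h3)).symm)
      rwa [← this]
    have c3 : (3 : R) ∈ P → ClassGroup.mk0 ⟨P, h⟩ ∈ Subgroup.zpowers g := by
      intro h3
      have : ClassGroup.mk0 ⟨P, h⟩ = 1 := by
        rw [ClassGroup.mk0_eq_one_iff]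
        exact ⟨⟨3, eq_span_three t ht hR P hP.ne_top h3⟩⟩
      rw [this]; exact one_mem _
    have c57 : (35 : R) ∈ P → t + 1 ∈ P ∨ t + (-1) ∈ P := by
      intro h35
      apply hP.mem_or_mem
      rw [show (t + 1) * (t + (-1)) = (-1) * 35 by linear_combination ht]
      exact Ideal.mul_mem_left _ _ h35
    have c5 : (5 : R) ∈ P → ClassGroup.mk0 ⟨P, h⟩ ∈ Subgroup.zpowers g := by
      intro h5
      rcases c57 (by
        rw [show (35 : R) = 7 * 5 by norm_num]; exact Ideal.mul_mem_left _ _ h5) with h' | h'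
      · have : Q5 = ⟨P, h⟩ := Subtype.ext
          (by simpa using (eq_span_pair t hR P hP.ne_top 5 1 (by norm_num) (by simpa using h5)
            (by simpa using h')).symm)
        rwa [← this]
      · have : P5 = ⟨P, h⟩ := Subtype.ext
          (by simpa [← sub_eq_add_neg] using (eq_span_pair t hR P hP.ne_top 5 (-1) (by norm_num)
            (by simpa using h5) (by simpa using h')).symm)
        rwa [← this]
    have c7 : (7 : R) ∈ P → ClassGroup.mk0 ⟨P, h⟩ ∈ Subgroup.zpowers g := by
      intro h7
      rcases c57 (by
        rw [show (35 : R) = 5 * 7 by norm_num]; exact Ideal.mul_mem_left _ _ h7) with h' | h'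
      · have : Q7 = ⟨P, h⟩ := Subtype.ext
          (by simpa using (eq_span_pair t hR P hP.ne_top 7 1 (by norm_num) (by simpa using h7)
            (by simpa using h')).symm)
        rwa [← this]
      · have : P7 = ⟨P, h⟩ := Subtype.ext
          (by simpa using (eq_span_pair t hR P hP.ne_top 7 (-1) (by norm_num)
            (by simpa using h7) (by simpa using h')).symm)
        rwa [← this]
    generalize Ideal.absNorm P = n at hn n0 hmem
    interval_cases n
    · exact absurd ((Ideal.eq_top_iff_one P).2 (by simpa using hmem)) hP.ne_top
    · exact c2 (by simpa using hmem)
    · exact c3 (by simpa using hmem)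
    · have : (2 : R) * 2 ∈ P := by norm_num; simpa using hmem
      exact c2 ((hP.mem_or_mem this).elim id id)
    · exact c5 (by simpa using hmem)
    · have : (2 : R) * 3 ∈ P := by norm_num; simpa using hmem
      exact (hP.mem_or_mem this).elim c2 c3
    · exact c7 (by simpa using hmem)
  have hall : ∀ P : Ideal R, ∀ h : P ∈ (Ideal R)⁰, Ideal.absNorm P ≤ 7 →
      ClassGroup.mk0 ⟨P, h⟩ ∈ Subgroup.zpowers g := by
    intro P
    induction P using UniqueFactorizationMonoid.induction_on_prime with
    | h₁ => intro h; exact absurd rfl (mem_nonZeroDivisors_iff_ne_zero.1 h)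
    | h₂ I hI =>
      intro h _
      have : ClassGroup.mk0 ⟨I, h⟩ = 1 := by
        rw [ClassGroup.mk0_eq_one_iff]
        rw [Ideal.isUnit_iff] at hI
        simp only [hI]
        exact top_isPrincipal
      rw [this]; exact one_mem _
    | h₃ I P hI hP ih =>
      intro h hn
      have hI' := mem_nonZeroDivisors_iff_ne_zero.2 hI
      have hP' := mem_nonZeroDivisors_iff_ne_zero.2 hP.ne_zero
      have : (⟨P * I, h⟩ : (Ideal R)⁰) = ⟨P, hP'⟩ * ⟨I, hI'⟩ := rfl
      rw [this, map_mul]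
      rw [map_mul] at hn
      have a1 : 0 < Ideal.absNorm P := Ideal.absNorm_pos_of_nonZeroDivisors ⟨P, hP'⟩
      have a2 : 0 < Ideal.absNorm I := Ideal.absNorm_pos_of_nonZeroDivisors ⟨I, hI'⟩
      exact mul_mem (hprime P hP' (Ideal.isPrime_of_prime hP) (by nlinarith)) (ih hI' (by nlinarith))
  have htop : ∀ x, x ∈ Subgroup.zpowers g := by
    intro x
    obtain ⟨I, rfl, hI⟩ := hM x
    exact hall I I.2 hI
  have ho : orderOf g = 4 := by
    have : Fact (Nat.Prime 2) := ⟨Nat.prime_two⟩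
    exact orderOf_eq_prime_pow (p := 2) (n := 1) (by simpa using g2) (by simpa using g4)
  refine ⟨?_, ⟨g, htop⟩, g, g2⟩
  rw [← ho, orderOf_eq_card_of_forall_mem_zpowers htop]
end abs

open NumberField Module in
theorem trace_aux {A S : Type*} [CommRing A] [Nontrivial A] [CommRing S] [Algebra A S]
    (B : Basis (Fin 2) A S) (t : S)
    (ht : t ^ 2 = -34) (h0 : B 0 = 1) (h1 : B 1 = t) :
    Algebra.trace A S 1 = 2 ∧ Algebra.trace A S t = 0 ∧ Algebra.trace A S (t * t) = -68 := by
  have e : t * t = (-34 : A) • B 0 := by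
    rw [← pow_two, ht, h0, Algebra.smul_def, map_neg, map_ofNat, mul_one]
  have T1 : Algebra.trace A S 1 = 2 := by
    have := Algebra.trace_algebraMap_of_basis B (1 : A)
    simpa using this
  refine ⟨T1, ?_, ?_⟩
  · rw [Algebra.trace_eq_matrix_trace B, Matrix.trace, Fin.sum_univ_two]
    simp only [Matrix.diag, Algebra.leftMulMatrix_eq_repr_mul]
    rw [h1, h0, mul_one, e, ← h1]
    simp
  · rw [e, map_smul, h0, T1]; simp; norm_num

theorem exists_rat (K : Type) [Field K] [NumberField K]
    (ω : K) (hω : ω ^ 2 = -34) (hgen : Algebra.adjoin ℚ {ω} = ⊤) (x : K) :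
    ∃ a b : ℚ, x = a + b * ω := by
  have hx : x ∈ Algebra.adjoin ℚ {ω} := hgen ▸ Algebra.mem_top
  induction hx using Algebra.adjoin_induction with
  | mem x hx => exact ⟨0, 1, by simpa using hx⟩
  | algebraMap r => exact ⟨r, 0, by simp⟩
  | add x y _ _ hx hy =>
    obtain ⟨a, b, rfl⟩ := hx
    obtain ⟨c, d, rfl⟩ := hy
    exact ⟨a + c, b + d, by push_cast; ring⟩
  | mul x y _ _ hx hy =>
    obtain ⟨a, b, rfl⟩ := hx
    obtain ⟨c, d, rfl⟩ := hy
    exact ⟨a * c - 34 * b * d, a * d + b * c, by push_cast; linear_combination b * d * hω⟩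

theorem rat_indep (K : Type) [Field K] [NumberField K]
    (ω : K) (hω : ω ^ 2 = -34) (a b : ℚ) (h : (a : K) + b * ω = 0) : a = 0 ∧ b = 0 := by
  have h1 : ((a ^ 2 + 34 * b ^ 2 : ℚ) : K) = 0 := by
    push_cast
    linear_combination (a - b * ω) * h + b ^ 2 * hω
  have h2 : a ^ 2 + 34 * b ^ 2 = 0 := by exact_mod_cast h1
  constructor <;> nlinarith [sq_nonneg a, sq_nonneg b]

open NumberField Module

theorem int_aux (a b : ℚ) (m j n : ℤ) (hm : 2 * a = m) (hj : 68 * b = j)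
    (hn : a ^ 2 + 34 * b ^ 2 = n) : ∃ u v : ℤ, a = u ∧ b = v := by
  have h1 : j ^ 2 = 34 * (4 * n - m ^ 2) := by
    have : (j : ℚ) ^ 2 = 34 * (4 * n - m ^ 2) := by
      rw [← hm, ← hj, ← hn]; ring
    exact_mod_cast this
  have h2 : (2 : ℤ) ∣ j := Int.prime_two.dvd_of_dvd_pow (n := 2) ⟨17 * (4 * n - m ^ 2), by rw [h1]; ring⟩
  have h17 : (17 : ℤ) ∣ j :=
    (show Prime (17 : ℤ) by norm_num).dvd_of_dvd_pow (n := 2) ⟨2 * (4 * n - m ^ 2), by rw [h1]; ring⟩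
  obtain ⟨c, hc⟩ : (34 : ℤ) ∣ j := by omega
  have h3 : m ^ 2 + 34 * c ^ 2 = 4 * n := by subst hc; linarith
  have key : ∀ m c : ZMod 4, m ^ 2 + 34 * c ^ 2 = 0 → (m = 0 ∨ m = 2) ∧ (c = 0 ∨ c = 2) := by
    decide
  have hk := key m c (by
    have := (ZMod.intCast_zmod_eq_zero_iff_dvd _ 4).2 ⟨n, h3⟩
    push_cast at this; exact this)
  have ev : ∀ z : ℤ, ((z : ZMod 4) = 0 ∨ (z : ZMod 4) = 2) → ∃ w, z = 2 * w := by
    rintro z (h | h)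
    · have := (ZMod.intCast_zmod_eq_zero_iff_dvd z 4).1 h
      exact ⟨z / 2, by push_cast at this; omega⟩
    · have : ((z - 2 : ℤ) : ZMod 4) = 0 := by push_cast; rw [h]; ring
      have := (ZMod.intCast_zmod_eq_zero_iff_dvd _ 4).1 this
      exact ⟨z / 2, by push_cast at this; omega⟩
  obtain ⟨u, hu⟩ := ev m hk.1
  obtain ⟨v, hv⟩ := ev c hk.2
  refine ⟨u, v, ?_, ?_⟩
  · rw [hu] at hm; push_cast at hm; linarith
  · rw [hc, hv] at hj; push_cast at hj; linarith

theorem rat_of_integral {x : ℚ} (h : IsIntegral ℤ x) : ∃ n : ℤ, x = n := by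
  obtain ⟨n, hn⟩ := IsIntegrallyClosed.isIntegral_iff.1 h
  exact ⟨n, by simpa using hn.symm⟩

theorem ringOfIntegers_form (K : Type) [Field K] [NumberField K]
    (ω : K) (hω : ω ^ 2 = -34) (hgen : Algebra.adjoin ℚ {ω} = ⊤) (x : K) (hx : IsIntegral ℤ x) :
    finrank ℚ K = 2 ∧ ∃ a b : ℤ, x = a + b * ω := by
  have hli : LinearIndependent ℚ ![(1 : K), ω] := by
    rw [LinearIndependent.pair_iff]
    intro s r h
    exact rat_indep K ω hω s r (by simpa [Algebra.smul_def] using h)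
  let B : Basis (Fin 2) ℚ K := Basis.mk hli (by
    intro y _
    obtain ⟨a, b, rfl⟩ := exists_rat K ω hω hgen y
    simp only [Matrix.range_cons, Matrix.range_empty, Set.union_empty, Set.singleton_union]
    rw [Submodule.mem_span_pair]
    exact ⟨a, b, by simp [Algebra.smul_def]⟩)
  have hB0 : B 0 = 1 := by simp [B]
  have hB1 : B 1 = ω := by simp [B]
  obtain ⟨T0, T1, T2⟩ := trace_aux B ω hω hB0 hB1
  have hint : IsIntegral ℤ ω := by
    refine IsIntegral.of_pow (n := 2) (by norm_num) ?_
    rw [hω]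
    exact_mod_cast isIntegral_algebraMap (R := ℤ) (A := K) (x := -34)
  refine ⟨by rw [finrank_eq_card_basis B]; simp, ?_⟩
  obtain ⟨a, b, rfl⟩ := exists_rat K ω hω hgen x
  have e1 : (a : K) + b * ω = a • (1 : K) + b • ω := by simp [Algebra.smul_def]
  have e2 : ((a : K) + b * ω) * ω = a • ω + b • (ω * ω) := by simp [Algebra.smul_def]; ring
  obtain ⟨m, hm⟩ := rat_of_integral (Algebra.isIntegral_trace (L := ℚ) hx)
  obtain ⟨j, hj⟩ := rat_of_integral (Algebra.isIntegral_trace (L := ℚ) (hx.mul hint))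
  rw [e1, map_add, map_smul, map_smul, T0, T1] at hm
  rw [e2, map_add, map_smul, map_smul, T1, T2] at hj
  simp only [smul_eq_mul] at hm hj
  have hm' : 2 * a = m := by linarith
  have hn : IsIntegral ℤ (a ^ 2 + 34 * b ^ 2 : ℚ) := by
    rw [← isIntegral_algebraMap_iff (algebraMap ℚ K).injective]
    have : algebraMap ℚ K (a ^ 2 + 34 * b ^ 2 : ℚ) = (a + b * ω) * (algebraMap ℤ K m - (a + b * ω)) := by
      have : (m : K) = 2 * a := by exact_mod_cast congrArg (Rat.cast (K := K)) hm'.symm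
      simp [this]
      linear_combination b ^ 2 * hω
    rw [this]
    exact hx.mul (isIntegral_algebraMap.sub hx)
  obtain ⟨n, hn⟩ := rat_of_integral hn
  obtain ⟨u, v, rfl, rfl⟩ := int_aux a b m (-j) n hm' (by push_cast; linarith) hn
  exact ⟨u, v, by simp⟩

/-- The ideal class group of `ℚ(√(-34))` (formalized as any number field `K`
generated over `ℚ` by a square root of `-34`) is cyclic of order `4`; in
particular it has an element `g` with `g² ≠ 1`, so it is not an elementary
abelian 2-group. -/
theorem classGroup_neg34 (K : Type) [Field K] [NumberField K]
    (ω : K) (hω : ω ^ 2 = -34) (hgen : Algebra.adjoin ℚ {ω} = ⊤) :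
    Nat.card (ClassGroup (NumberField.RingOfIntegers K)) = 4 ∧
    IsCyclic (ClassGroup (NumberField.RingOfIntegers K)) ∧
    ∃ g : ClassGroup (NumberField.RingOfIntegers K), g ^ 2 ≠ 1 := by
  have hint : IsIntegral ℤ ω := by
    refine IsIntegral.of_pow (n := 2) (by norm_num) ?_
    rw [hω]
    exact_mod_cast isIntegral_algebraMap (R := ℤ) (A := K) (x := -34)
  let t : 𝓞 K := ⟨ω, hint⟩
  have htω : algebraMap (𝓞 K) K t = ω := rfl
  have ht : t ^ 2 = -34 := by
    apply RingOfIntegers.coe_injective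
    rw [map_pow, htω, hω, map_neg, map_ofNat]
  have hfin := (ringOfIntegers_form K ω hω hgen ω hint).1
  have hR : ∀ x : 𝓞 K, ∃ a b : ℤ, x = a + b * t := by
    intro x
    obtain ⟨a, b, h⟩ := (ringOfIntegers_form K ω hω hgen x x.isIntegral_coe).2
    refine ⟨a, b, ?_⟩
    apply RingOfIntegers.coe_injective
    simpa [htω] using h
  have hli : LinearIndependent ℤ ![(1 : 𝓞 K), t] := by
    rw [LinearIndependent.pair_iff]
    intro s r h
    exact lin_indep t ht s r (by simpa using h)
  let B : Basis (Fin 2) ℤ (𝓞 K) := Basis.mk hli (by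
    intro y _
    obtain ⟨a, b, rfl⟩ := hR y
    simp only [Matrix.range_cons, Matrix.range_empty, Set.union_empty, Set.singleton_union]
    rw [Submodule.mem_span_pair]
    exact ⟨a, b, by simp⟩)
  have hB0 : B 0 = 1 := by simp [B]
  have hB1 : B 1 = t := by simp [B]
  obtain ⟨T0, T1, T2⟩ := trace_aux B t ht hB0 hB1
  have hd : discr K = -136 := by
    rw [← discr_eq_discr K B, Algebra.discr_def, Matrix.det_fin_two]
    simp only [Algebra.traceMatrix_apply, Algebra.traceForm_apply, hB0, hB1, one_mul, mul_one,
      T0, T1, T2]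
    norm_num
  refine abstract_main t ht hR fun C => ?_
  obtain ⟨I, hI, hle⟩ := exists_ideal_in_class_of_norm_le C
  refine ⟨I, hI, ?_⟩
  have hr : InfinitePlace.nrComplexPlaces K ≤ 1 := by
    have := InfinitePlace.card_add_two_mul_card_eq_rank K
    omega
  rw [hd, hfin] at hle
  have hpi := Real.pi_gt_d2
  have hpi4 := Real.pi_le_four
  have hs : √|((-136 : ℤ) : ℝ)| ≤ 11.67 := by
    rw [Real.sqrt_le_left (by norm_num)]; norm_num
  have h4 : (4 / Real.pi) ^ InfinitePlace.nrComplexPlaces K ≤ 4 / 3.14 := by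
    calc (4 / Real.pi) ^ InfinitePlace.nrComplexPlaces K ≤ (4 / Real.pi) ^ 1 :=
          pow_le_pow_right₀ (by rw [le_div_iff₀ Real.pi_pos]; linarith) hr
      _ ≤ 4 / 3.14 := by rw [pow_one]; gcongr
  have h8 : (Ideal.absNorm (I : Ideal (𝓞 K)) : ℝ) < 8 := by
    refine hle.trans_lt ?_
    calc _ ≤ (4 / 3.14 : ℝ) * (((Nat.factorial 2 : ℕ) : ℝ) / ((2 : ℕ) : ℝ) ^ 2 * 11.67) := by gcongr
      _ < 8 := by norm_num [Nat.factorial]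
  have : Ideal.absNorm (I : Ideal (𝓞 K)) < 8 := by exact_mod_cast h8
  omega
end

section
/- The ideal class group of the imaginary quadratic field ℚ(√(−210)) has order 8 and every element of it has order dividing 2; that is, it is isomorphic to (ℤ/2ℤ)³. -/
open NumberField

theorem aux_rat_s15 (K : Type) [Field K] [NumberField K] (ω : K) (hω : ω ^ 2 = -210) (a b : ℚ)
   (h : (a:K) + b * ω = 0) : a = 0 ∧ b = 0 := by
  have h2 : (a:K)^2 + 210 * b^2 = 0 := by linear_combination ((a:K) - b * ω) * h + b^2 * hω
  have h3 : a^2 + 210 * b^2 = 0 := by exact_mod_cast h2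
  constructor <;> nlinarith [sq_nonneg a, sq_nonneg b, pow_eq_zero_iff (two_ne_zero) (a := a)]

theorem aux_basis (K : Type) [Field K] [NumberField K] (ω : K) (hω : ω ^ 2 = -210) (hgen : Algebra.adjoin ℚ {ω} = ⊤) :
   (∀ x : K, ∃ a b : ℚ, x = a + b * ω) ∧ (∀ a b : ℚ, Algebra.norm ℚ ((a:K) + b * ω) = a^2 + 210 * b^2) ∧ 
     (∀ a b : ℚ, Algebra.trace ℚ K ((a:K) + b * ω) = 2 * a) := by
  have hrep : ∀ x : K, ∃ a b : ℚ, x = a + b * ω := by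
    intro x
    have hx : x ∈ Algebra.adjoin ℚ {ω} := by rw [hgen]; trivial
    induction hx using Algebra.adjoin_induction with
    | mem x hx => exact ⟨0, 1, by simp at hx; simp [hx]⟩
    | algebraMap r => exact ⟨r, 0, by simp⟩
    | add x y _ _ hx hy =>
      obtain ⟨a, b, rfl⟩ := hx
      obtain ⟨c, d, rfl⟩ := hy
      exact ⟨a + c, b + d, by push_cast; ring⟩
    | mul x y _ _ hx hy =>
      obtain ⟨a, b, rfl⟩ := hx
      obtain ⟨c, d, rfl⟩ := hy
      exact ⟨a * c - 210 * b * d, a * d + b * c, by push_cast; linear_combination (b * d : K) * hω⟩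
  have hli : LinearIndependent ℚ ![(1:K), ω] := by
    rw [LinearIndependent.pair_iff]
    intro s t h
    exact aux_rat_s15 K ω hω s t (by simpa [Algebra.smul_def] using h)
  let B : Module.Basis (Fin 2) ℚ K := Module.Basis.mk hli (by
    intro x _
    obtain ⟨a, b, rfl⟩ := hrep x
    simp only [Matrix.range_cons, Matrix.range_empty, Set.union_empty, Set.singleton_union]
    rw [Submodule.mem_span_pair]
    exact ⟨a, b, by simp [Algebra.smul_def]⟩)
  have hB0 : B 0 = 1 := by simp [B]
  have hB1 : B 1 = ω := by simp [B]
  have hr : ∀ a b : ℚ, B.repr ((a:K) + b * ω) = Finsupp.single 0 a + Finsupp.single 1 b := by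
    intro a b
    have : (a:K) + b * ω = a • B 0 + b • B 1 := by simp [hB0, hB1, Algebra.smul_def]
    rw [this]; simp
  have hM : ∀ a b : ℚ, Algebra.leftMulMatrix B ((a:K) + b * ω) = !![a, -210 * b; b, a] := by
    intro a b
    have h0 : ((a:K) + b * ω) * B 0 = a + b * ω := by rw [hB0]; ring
    have h1 : ((a:K) + b * ω) * B 1 = (-210 * b : ℚ) + a * ω := by
      rw [hB1]; push_cast; linear_combination (b:K) * hω
    ext i j
    rw [Algebra.leftMulMatrix_eq_repr_mul]
    fin_cases j
    · simp only [Fin.zero_eta]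
      rw [h0, hr]; fin_cases i <;> simp
    · simp only [Fin.mk_one]
      rw [h1, hr]; fin_cases i <;> simp
  refine ⟨hrep, fun a b => ?_, fun a b => ?_⟩
  · rw [Algebra.norm_eq_matrix_det B, hM, Matrix.det_fin_two]; simp; ring
  · rw [Algebra.trace_eq_matrix_trace B, hM, Matrix.trace_fin_two]; simp; ring

theorem aux_int_s15 (K : Type) [Field K] [NumberField K] (ω : K) (hω : ω ^ 2 = -210) (hgen : Algebra.adjoin ℚ {ω} = ⊤) :
   ∃ w : 𝓞 K, w ^ 2 = -210 ∧ (∀ x : 𝓞 K, ∃ a b : ℤ, x = a + b * w) ∧ 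
    (∀ a b : ℤ, Algebra.norm ℤ ((a:𝓞 K) + b * w) = a^2 + 210 * b^2) := by
  obtain ⟨h1, h2, h3⟩ := aux_basis K ω hω hgen
  have hi : IsIntegral ℤ ω := by
    refine IsIntegral.of_pow (n := 2) (by norm_num) ?_
    rw [hω]
    exact_mod_cast isIntegral_algebraMap (R := ℤ) (A := K) (x := -210)
  obtain ⟨w, hw⟩ : ∃ w : 𝓞 K, (w : K) = ω := ⟨⟨ω, hi⟩, rfl⟩
  refine ⟨w, ?_, ?_, ?_⟩
  · apply RingOfIntegers.ext
    rw [← hw] at hω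
    simpa [map_ofNat] using hω
  · intro x
    obtain ⟨a, b, hx⟩ := h1 x
    have hn := h2 a b
    have ht := h3 a b
    rw [← hx, ← Algebra.coe_norm_int] at hn
    rw [← hx, ← Algebra.coe_trace_int] at ht
    generalize Algebra.norm ℤ x = n at hn
    generalize Algebra.trace ℤ (𝓞 K) x = t at ht
    have hb : (210 * (2 * b))^2 = ((210 * (4 * n - t^2) : ℤ):ℚ) := by
      push_cast; rw [hn, ht]; ring
    have hb2 : ∃ s : ℤ, 2 * b = s := by
      have : IsIntegral ℤ (210 * (2 * b)) := by
        refine IsIntegral.of_pow (n := 2) (by norm_num) ?_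
        rw [hb]; exact isIntegral_algebraMap (R := ℤ) (A := ℚ) 
      obtain ⟨m, hm⟩ := IsIntegrallyClosed.isIntegral_iff.mp this
      simp at hm
      rw [← hm] at hb
      have hb' : m^2 = 210 * (4 * n - t^2) := by exact_mod_cast hb
      have : (210:ℤ) ∣ m := by
        have hd : (210:ℤ) ∣ m^2 := ⟨_, hb'⟩
        have k2 : (2:ℤ) ∣ m := Int.prime_two.dvd_of_dvd_pow (dvd_trans (by norm_num) hd)
        have k3 : (3:ℤ) ∣ m := Int.prime_three.dvd_of_dvd_pow (dvd_trans (by norm_num) hd)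
        have k5 : (5:ℤ) ∣ m := (Nat.prime_iff_prime_int.mp (by norm_num : Nat.Prime 5)).dvd_of_dvd_pow (dvd_trans (by norm_num) hd)
        have k7 : (7:ℤ) ∣ m := (Nat.prime_iff_prime_int.mp (by norm_num : Nat.Prime 7)).dvd_of_dvd_pow (dvd_trans (by norm_num) hd)
        omega
      obtain ⟨s, rfl⟩ := this
      exact ⟨s, by push_cast at hm; linarith⟩
    obtain ⟨s, hs⟩ := hb2
    have key : t^2 + 210 * s^2 = 4 * n := by
      have : (t:ℚ)^2 + 210 * s^2 = 4 * n := by rw [hn, ht, ← hs]; ring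
      exact_mod_cast this
    have hte : Even t := by
      have : Even (t^2) := ⟨2 * n - 105 * s^2, by linarith⟩
      exact (Int.even_pow.mp this).1
    obtain ⟨t', rfl⟩ := hte
    have hse : Even s := by
      have : Even (s^2) := ⟨n - 52 * s^2 - t'^2, by linarith⟩
      exact (Int.even_pow.mp this).1
    obtain ⟨s', rfl⟩ := hse
    refine ⟨t', s', ?_⟩
    apply RingOfIntegers.ext
    have e1 : a = t' := by push_cast at ht; linarith
    have e2 : b = s' := by push_cast at hs; linarith
    rw [hx, e1, e2, ← hw]; simp
  · intro a b
    have := h2 a b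
    have h : ((Algebra.norm ℤ ((a:𝓞 K) + b * w) : ℤ) : ℚ) = a^2 + 210 * b^2 := by
      rw [Algebra.coe_norm_int, ← this, ← hw]
      simp
    exact_mod_cast h

open scoped nonZeroDivisors

theorem aux_dvd {R : Type} [CommRing R] (P : Ideal R) (hP : P.IsPrime) (p : ℕ) (hp : p.Prime)
    (hpP : (p : R) ∈ P) (n : ℤ) (hn : (n : R) ∈ P) : (p : ℤ) ∣ n := by
  by_contra h
  have hc : IsCoprime (p : ℤ) n :=
    ((Nat.prime_iff_prime_int.mp hp).irreducible.coprime_iff_not_dvd).mpr h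
  obtain ⟨u, v, huv⟩ := hc
  apply hP.one_notMem
  have : (1 : R) = u * (p : R) + v * (n : R) := by
    exact_mod_cast (congrArg (Int.cast : ℤ → R) huv).symm
  rw [this]
  exact P.add_mem (P.mul_mem_left _ hpP) (P.mul_mem_left _ hn)

theorem aux_prime {R : Type} [CommRing R] (P : Ideal R) (hP : P.IsPrime) (n : ℕ) (hn : n ≠ 0)
    (hnP : (n : R) ∈ P) : ∃ p : ℕ, p.Prime ∧ (p : R) ∈ P := by
  induction n using induction_on_primes with
  | zero => exact absurd rfl hn
  | one => exact absurd (by simpa using hnP) hP.one_notMem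
  | prime_mul p a hp ih =>
    push_cast at hnP
    rcases hP.mem_or_mem hnP with h | h
    · exact ⟨p, hp, h⟩
    · exact ih (by rintro rfl; simp at hn) h

theorem aux_center (p : ℕ) (hp : 0 < p) (s : ℤ) : ∃ t q : ℤ, s = t + p * q ∧ 2 * t ≤ p ∧ - p ≤ 2 * t := by
  have h1 := Int.emod_add_mul_ediv s p
  have h2 := Int.emod_nonneg s (b := (p:ℤ)) (by omega)
  have h3 := Int.emod_lt_of_pos s (b := (p:ℤ)) (by omega)
  by_cases h : 2 * (s % p) ≤ p
  · exact ⟨s % p, s / p, h1.symm, h, by omega⟩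
  · exact ⟨s % p - p, s / p + 1, by linarith, by omega, by omega⟩

theorem aux_surj (K : Type) [Field K] [NumberField K] (w : 𝓞 K) (hw : w ^ 2 = -210)
    (hrep : ∀ x : 𝓞 K, ∃ a b : ℤ, x = a + b * w)
    (hN : ∀ a b : ℤ, Algebra.norm ℤ ((a:𝓞 K) + b * w) = a^2 + 210 * b^2)
    (H : Subgroup (ClassGroup (𝓞 K)))
    (hH : ∀ p : ℕ, p = 2 ∨ p = 3 ∨ p = 5 ∨ p = 7 →
      ∀ h : Ideal.span {(p : 𝓞 K), w} ∈ (Ideal (𝓞 K))⁰, ClassGroup.mk0 ⟨_, h⟩ ∈ H) :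
    ∀ g, g ∈ H := by
  have main : ∀ (n : ℕ) (I : Ideal (𝓞 K)) (h : I ∈ (Ideal (𝓞 K))⁰), Ideal.absNorm I = n →
      ClassGroup.mk0 ⟨I, h⟩ ∈ H := by
    intro n
    induction n using Nat.strong_induction_on with
    | _ n ih =>
    intro I h hn
    have hI0 : I ≠ ⊥ := by simpa using nonZeroDivisors.ne_zero h
    have hn0 : n ≠ 0 := by rw [← hn]; simpa [Ideal.absNorm_eq_zero_iff] using hI0
    by_cases hT : I = ⊤
    · rw [(ClassGroup.mk0_eq_one_iff h).mpr (by rw [hT]; exact top_isPrincipal)]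
      exact H.one_mem
    obtain ⟨P, hPm, hIP⟩ := Ideal.exists_le_maximal I hT
    by_cases hne : I = P
    swap
    · obtain ⟨J, hJ⟩ := Ideal.dvd_iff_le.mpr hIP
      have hP0 : P ≠ 0 := by rintro rfl; simp at hJ; exact hI0 hJ
      have hJ0 : J ≠ 0 := by rintro rfl; simp at hJ; exact hI0 hJ
      have hJ1 : J ≠ ⊤ := by rintro rfl; simp at hJ; exact hne hJ
      have e : Ideal.absNorm P * Ideal.absNorm J = n := by rw [← map_mul, ← hJ, hn]
      have a1 : Ideal.absNorm P ≠ 1 := by rw [Ne, Ideal.absNorm_eq_one_iff]; exact hPm.ne_top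
      have a2 : Ideal.absNorm J ≠ 1 := by rw [Ne, Ideal.absNorm_eq_one_iff]; exact hJ1
      have b1 : Ideal.absNorm P ≠ 0 := by rintro h0; rw [h0] at e; omega
      have b2 : Ideal.absNorm J ≠ 0 := by rintro h0; rw [h0] at e; omega
      have c1 : Ideal.absNorm P < n := by
        rw [← e]; exact lt_mul_of_one_lt_right (by omega) (by omega)
      have c2 : Ideal.absNorm J < n := by
        rw [← e]; exact lt_mul_of_one_lt_left (by omega) (by omega)
      have m1 : P ∈ (Ideal (𝓞 K))⁰ := mem_nonZeroDivisors_of_ne_zero hP0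
      have m2 : J ∈ (Ideal (𝓞 K))⁰ := mem_nonZeroDivisors_of_ne_zero hJ0
      have : (⟨I, h⟩ : (Ideal (𝓞 K))⁰) = ⟨P, m1⟩ * ⟨J, m2⟩ := Subtype.ext hJ
      rw [this, map_mul]
      exact H.mul_mem (ih _ c1 P m1 rfl) (ih _ c2 J m2 rfl)
    subst hne
    have hP := hPm.isPrime
    obtain ⟨p, hp, hpP⟩ := aux_prime I hP n hn0 (hn ▸ Ideal.absNorm_mem I)
    have hdvd := aux_dvd I hP p hp hpP
    have hpn : p ≤ n := by
      have := hdvd n (by have := Ideal.absNorm_mem I; rw [hn] at this; exact_mod_cast this)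
      exact Nat.le_of_dvd (by omega) (by exact_mod_cast this)
    by_cases hb : ∃ a b : ℤ, (a:𝓞 K) + b * w ∈ I ∧ ¬ (p:ℤ) ∣ b
    swap
    · push Not at hb
      have : I = Ideal.span {(p:𝓞 K)} := by
        apply le_antisymm
        · intro x hx
          obtain ⟨a, b, rfl⟩ := hrep x
          obtain ⟨b', rfl⟩ := hb a b hx
          have ha : (a : 𝓞 K) ∈ I := by
            have : (a : 𝓞 K) = (a + ((p * b' : ℤ) : 𝓞 K) * w) - (b' * w) * p := by push_cast; ring
            rw [this]
            exact I.sub_mem hx (I.mul_mem_left _ hpP)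
          obtain ⟨a', rfl⟩ := hdvd a ha
          rw [Ideal.mem_span_singleton]
          exact ⟨a' + b' * w, by push_cast; ring⟩
        · rw [Ideal.span_singleton_le_iff_mem]; exact hpP
      rw [(ClassGroup.mk0_eq_one_iff h).mpr (by rw [this]; exact ⟨_, rfl⟩)]
      exact H.one_mem
    obtain ⟨a, b, hab, hpb⟩ := hb
    obtain ⟨u, v, huv⟩ :=
      ((Nat.prime_iff_prime_int.mp hp).irreducible.coprime_iff_not_dvd).mpr hpb
    obtain ⟨t, q, htq, ht1, ht2⟩ := aux_center p hp.pos (-v * a)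
    have hwt : ((-t : ℤ) : 𝓞 K) + ((1 : ℤ) : 𝓞 K) * w ∈ I := by
      have e1 : ((u * p + v * b : ℤ) : 𝓞 K) = 1 := by rw [huv]; simp
      have e2 : ((-v * a : ℤ) : 𝓞 K) = ((t + p * q : ℤ) : 𝓞 K) := by rw [htq]
      push_cast at e1 e2
      have : ((-t : ℤ) : 𝓞 K) + ((1 : ℤ) : 𝓞 K) * w = v * (a + b * w) + (q + u * w) * p := by
        push_cast
        linear_combination (-w) * e1 + e2
      rw [this]
      exact I.add_mem (I.mul_mem_left _ hab) (I.mul_mem_left _ hpP)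
    have htp : (p : ℤ) ∣ t ^ 2 + 210 := by
      apply hdvd
      have : ((t ^ 2 + 210 : ℤ) : 𝓞 K) = (-(t + w)) * (((-t : ℤ) : 𝓞 K) + ((1 : ℤ) : 𝓞 K) * w) := by
        push_cast
        linear_combination hw
      rw [this]
      exact I.mul_mem_left _ hwt
    by_cases hp17 : 17 ≤ p
    · obtain ⟨J, hJ⟩ := Ideal.dvd_iff_le.mpr ((Ideal.span_singleton_le_iff_mem I).mpr hwt)
      have hnorm : n * Ideal.absNorm J = (t ^ 2 + 210).natAbs := by
        rw [← hn, ← map_mul, ← hJ, Ideal.absNorm_span_singleton, hN]; congr 1; ring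
      have hnorm' : (n : ℤ) * (Ideal.absNorm J : ℤ) = t ^ 2 + 210 := by
        have h0 : 0 ≤ t ^ 2 + 210 := by positivity
        have := congrArg (Nat.cast : ℕ → ℤ) hnorm
        rw [Int.natAbs_of_nonneg h0] at this
        exact_mod_cast this
      have hJ0 : J ≠ 0 := by
        rintro rfl
        simp at hnorm'
        nlinarith [sq_nonneg t]
      have hlt : Ideal.absNorm J < n := by
        by_contra hge
        have g1 : (p : ℤ) ≤ n := by exact_mod_cast hpn
        have g2 : (n : ℤ) ≤ Ideal.absNorm J := by exact_mod_cast not_lt.mp hge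
        have g3 : (17 : ℤ) ≤ p := by exact_mod_cast hp17
        nlinarith
      have m2 : J ∈ (Ideal (𝓞 K))⁰ := mem_nonZeroDivisors_of_ne_zero hJ0
      have hs : ClassGroup.mk0 (⟨I, h⟩ * ⟨J, m2⟩ : (Ideal (𝓞 K))⁰) = 1 := by
        have := (ClassGroup.mk0_eq_one_iff (I := I * J) (mul_mem h m2)).mpr (by rw [← hJ]; exact ⟨_, rfl⟩)
        exact this
      rw [map_mul] at hs
      rw [eq_inv_of_mul_eq_one_left hs]
      exact H.inv_mem (ih _ hlt J m2 rfl)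
    have hpc : p = 2 ∨ p = 3 ∨ p = 5 ∨ p = 7 := by
      have hlt : p < 17 := by omega
      clear hH ih
      interval_cases p <;> first | omega | (exfalso; revert hp; norm_num; done) | skip
      · exfalso
        have : t ≤ 5 := by omega
        have : -5 ≤ t := by omega
        interval_cases t <;> norm_num at htp
      · exfalso
        have : t ≤ 6 := by omega
        have : -6 ≤ t := by omega
        interval_cases t <;> norm_num at htp
    have h210 : (p : ℤ) ∣ 210 := by
      rcases hpc with rfl | rfl | rfl | rfl <;> norm_num
    have hpt : (p : ℤ) ∣ t :=
      (Nat.prime_iff_prime_int.mp hp).dvd_of_dvd_pow ((dvd_add_left h210).mp htp)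
    have hwI : w ∈ I := by
      obtain ⟨t', rfl⟩ := hpt
      have : w = (((-(p * t') : ℤ) : 𝓞 K) + ((1 : ℤ) : 𝓞 K) * w) + t' * p := by push_cast; ring
      rw [this]
      exact I.add_mem hwt (I.mul_mem_left _ hpP)
    have hIe : I = Ideal.span {(p : 𝓞 K), w} := by
      apply le_antisymm
      · intro x hx
        obtain ⟨a, b, rfl⟩ := hrep x
        have ha : (a : 𝓞 K) ∈ I := (I.add_mem_iff_left (I.mul_mem_left _ hwI)).mp hx
        obtain ⟨a', rfl⟩ := hdvd a ha
        rw [Ideal.mem_span_pair]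
        exact ⟨a', b, by push_cast; ring⟩
      · rw [Ideal.span_le]
        rintro x (rfl | rfl)
        · exact hpP
        · exact hwI
    subst hIe
    exact hH p hpc h
  intro g
  obtain ⟨⟨I, hI⟩, rfl⟩ := ClassGroup.mk0_surjective g
  exact main _ I hI rfl

theorem aux_coprime_mul {R : Type} [CommRing R] (w : R) (hw : w ^ 2 = -210) (d e f : ℤ)
    (hf : d * e * f = 210) (hc : IsCoprime d e) :
    Ideal.span {(d : R), w} * Ideal.span {(e : R), w} = Ideal.span {((d * e : ℤ) : R), w} := by
  have hf' : (d * e * f : R) = 210 := by exact_mod_cast congrArg (Int.cast : ℤ → R) hf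
  apply le_antisymm
  · rw [Ideal.span_mul_span', Ideal.span_le]
    rintro x ⟨y, hy, z, hz, rfl⟩
    simp only [SetLike.mem_coe, Ideal.mem_span_pair]
    rcases hy with rfl | rfl <;> rcases hz with rfl | rfl
    · exact ⟨1, 0, by push_cast; ring⟩
    · exact ⟨0, d, by push_cast; ring⟩
    · exact ⟨0, e, by push_cast; ring⟩
    · exact ⟨-f, 0, by push_cast; linear_combination - hf' - hw⟩
  · obtain ⟨u, v, huv⟩ := hc
    have huv' : (u * d + v * e : R) = 1 := by exact_mod_cast congrArg (Int.cast : ℤ → R) huv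
    rw [Ideal.span_le]
    have k1 : ∀ n : R, n ∈ Ideal.span {n, w} := fun n => Ideal.subset_span (by simp)
    have k2 : ∀ n : R, w ∈ Ideal.span {n, w} := fun n => Ideal.subset_span (by simp)
    rintro x (rfl | rfl)
    · push_cast
      exact Ideal.mul_mem_mul (k1 _) (k1 _)
    · have : x = u * (d * x) + v * (x * e) := by linear_combination (-x) * huv'
      have m := Ideal.add_mem _
        (Ideal.mul_mem_left _ (u : R) (Ideal.mul_mem_mul (k1 (d : R)) (k2 (e : R))))
        (Ideal.mul_mem_left _ (v : R) (Ideal.mul_mem_mul (k2 (d : R)) (k1 (e : R))))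
      rwa [← this] at m

theorem aux_sq {R : Type} [CommRing R] (w : R) (hw : w ^ 2 = -210) (d f : ℤ)
    (hf : d * f = 210) (hc : IsCoprime d f) :
    Ideal.span {(d : R), w} * Ideal.span {(d : R), w} = Ideal.span {(d : R)} := by
  have hf' : (d * f : R) = 210 := by exact_mod_cast congrArg (Int.cast : ℤ → R) hf
  apply le_antisymm
  · rw [Ideal.span_mul_span', Ideal.span_le]
    rintro x ⟨y, hy, z, hz, rfl⟩
    simp only [SetLike.mem_coe, Ideal.mem_span_singleton]
    rcases hy with rfl | rfl <;> rcases hz with rfl | rfl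
    · exact ⟨d, by ring⟩
    · exact ⟨z, by ring⟩
    · exact ⟨y, by ring⟩
    · exact ⟨-f, by linear_combination hw + hf'⟩
  · obtain ⟨u, v, huv⟩ := hc
    have huv' : (u * d + v * f : R) = 1 := by exact_mod_cast congrArg (Int.cast : ℤ → R) huv
    have k1 : ∀ n : R, n ∈ Ideal.span {n, w} := fun n => Ideal.subset_span (by simp)
    have k2 : ∀ n : R, w ∈ Ideal.span {n, w} := fun n => Ideal.subset_span (by simp)
    rw [Ideal.span_singleton_le_iff_mem]
    have : (d : R) = u * (d * d) + (-v) * (w * w) := by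
      linear_combination (-d : R) * huv' + v * hf' + v * hw
    have m := Ideal.add_mem _
      (Ideal.mul_mem_left _ (u : R) (Ideal.mul_mem_mul (k1 (d : R)) (k1 (d : R))))
      (Ideal.mul_mem_left _ (-v : R) (Ideal.mul_mem_mul (k2 (d : R)) (k2 (d : R))))
    rwa [← this] at m

theorem aux_nonprinc (K : Type) [Field K] [NumberField K] (w : 𝓞 K) (hw : w ^ 2 = -210)
    (hrep : ∀ x : 𝓞 K, ∃ a b : ℤ, x = a + b * w)
    (hN : ∀ a b : ℤ, Algebra.norm ℤ ((a:𝓞 K) + b * w) = a^2 + 210 * b^2)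
    (d f : ℤ) (hf : d * f = 210) (hc : IsCoprime d f) (hd : 1 < d) (hd' : d ≤ 30)
    (hp : (Ideal.span {(d : 𝓞 K), w}).IsPrincipal) : False := by
  obtain ⟨α, hα⟩ := hp
  have h2 := aux_sq w hw d f hf hc
  rw [hα, Ideal.submodule_span_eq, Ideal.span_singleton_mul_span_singleton] at h2
  have h3 := congrArg Ideal.absNorm h2
  obtain ⟨a, b, rfl⟩ := hrep α
  rw [Ideal.absNorm_span_singleton, Ideal.absNorm_span_singleton, map_mul, hN] at h3
  have h4 := hN d 0
  simp only [Int.cast_zero, zero_mul, add_zero] at h4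
  rw [h4] at h3
  have h5 : (a ^ 2 + 210 * b ^ 2) * (a ^ 2 + 210 * b ^ 2) = d ^ 2 := by
    rcases Int.natAbs_eq_natAbs_iff.mp h3 with h | h
    · rw [h]; ring
    · nlinarith [sq_nonneg (a ^ 2 + 210 * b ^ 2), sq_nonneg d]
  have h6 : a ^ 2 + 210 * b ^ 2 = d := by
    have : 0 ≤ a ^ 2 + 210 * b ^ 2 := by positivity
    nlinarith
  have hb : b = 0 := by
    have : b ^ 2 < 1 := by nlinarith [sq_nonneg a]
    have : b ^ 2 = 0 := by nlinarith [sq_nonneg b]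
    exact pow_eq_zero_iff (two_ne_zero) |>.mp this
  subst hb
  have ha1 : a ≤ 5 := by nlinarith
  have ha2 : -5 ≤ a := by nlinarith
  have hd2 : d = a ^ 2 := by linarith
  subst hd2
  rw [Int.isCoprime_iff_gcd_eq_one] at hc
  interval_cases a <;> omega

/-- the class of an ideal `(d, w)` -/
noncomputable def auxC {K : Type} [Field K] [NumberField K] (w : 𝓞 K) (hw0 : w ≠ 0) (d : ℤ) :
    ClassGroup (𝓞 K) :=
  ClassGroup.mk0 ⟨Ideal.span {(d : 𝓞 K), w}, mem_nonZeroDivisors_of_ne_zero (by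
    intro h
    apply hw0
    have : w ∈ Ideal.span {(d : 𝓞 K), w} := Ideal.subset_span (by simp)
    rw [h] at this
    simpa using this)⟩

theorem auxC_mul {K : Type} [Field K] [NumberField K] (w : 𝓞 K) (hw0 : w ≠ 0) (hw : w ^ 2 = -210)
    (d e f : ℤ) (hf : d * e * f = 210) (hc : IsCoprime d e) :
    auxC w hw0 d * auxC w hw0 e = auxC w hw0 (d * e) := by
  unfold auxC
  rw [← map_mul]
  congr 1
  exact Subtype.ext (aux_coprime_mul w hw d e f hf hc)

theorem auxC_sq {K : Type} [Field K] [NumberField K] (w : 𝓞 K) (hw0 : w ≠ 0) (hw : w ^ 2 = -210)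
    (d f : ℤ) (hf : d * f = 210) (hc : IsCoprime d f) :
    auxC w hw0 d * auxC w hw0 d = 1 := by
  unfold auxC
  rw [← map_mul]
  have k : ∀ X : (Ideal (𝓞 K))⁰, (X : Ideal (𝓞 K)).IsPrincipal → ClassGroup.mk0 X = 1 :=
    fun X h => (ClassGroup.mk0_eq_one_iff X.2).mpr h
  apply k
  change (Ideal.span {(d : 𝓞 K), w} * Ideal.span {(d : 𝓞 K), w}).IsPrincipal
  rw [aux_sq w hw d f hf hc]
  exact ⟨_, rfl⟩

/-- The ideal class group of `ℚ(√(-210))` (formalized as any number field `K`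
generated over `ℚ` by a square root of `-210`) has order `8` and every element
has order dividing `2`; it is isomorphic to `(ℤ/2ℤ)³`. -/
theorem classGroup_neg210 (K : Type) [Field K] [NumberField K]
    (ω : K) (hω : ω ^ 2 = -210) (hgen : Algebra.adjoin ℚ {ω} = ⊤) :
    Nat.card (ClassGroup (NumberField.RingOfIntegers K)) = 8 ∧
    (∀ g : ClassGroup (NumberField.RingOfIntegers K), g ^ 2 = 1) ∧
    Nonempty (ClassGroup (NumberField.RingOfIntegers K) ≃*
      Multiplicative (ZMod 2 × ZMod 2 × ZMod 2)) := by
  obtain ⟨w, hw, hrep, hN⟩ := aux_int_s15 K ω hω hgen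
  have hw0 : w ≠ 0 := by
    rintro rfl
    have : (210 : 𝓞 K) = 0 := by linear_combination hw
    exact absurd this (by norm_num)
  have co : ∀ d e : ℤ, Int.gcd d e = 1 → IsCoprime d e := fun d e h =>
    Int.isCoprime_iff_gcd_eq_one.mpr h
  have c23 := auxC_mul w hw0 hw 2 3 35 (by norm_num) (co _ _ (by norm_num))
  have c25 := auxC_mul w hw0 hw 2 5 21 (by norm_num) (co _ _ (by norm_num))
  have c35 := auxC_mul w hw0 hw 3 5 14 (by norm_num) (co _ _ (by norm_num))
  have c235 := auxC_mul w hw0 hw 2 15 7 (by norm_num) (co _ _ (by norm_num))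
  have c2357 := auxC_mul w hw0 hw 30 7 1 (by norm_num) (co _ _ (by norm_num))
  norm_num at c23 c25 c35 c235 c2357
  have s2 := auxC_sq w hw0 hw 2 105 (by norm_num) (co _ _ (by norm_num))
  have s3 := auxC_sq w hw0 hw 3 70 (by norm_num) (co _ _ (by norm_num))
  have s5 := auxC_sq w hw0 hw 5 42 (by norm_num) (co _ _ (by norm_num))
  have s210 : auxC w hw0 210 = 1 := by
    unfold auxC
    refine (ClassGroup.mk0_eq_one_iff _).mpr ⟨w, ?_⟩
    apply le_antisymm
    · rw [Ideal.span_le]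
      rintro x (rfl | rfl)
      · rw [SetLike.mem_coe, Ideal.submodule_span_eq, Ideal.mem_span_singleton]
        exact ⟨-w, by push_cast; linear_combination hw⟩
      · exact Submodule.mem_span_singleton_self x
    · rw [Ideal.submodule_span_eq, Ideal.span_singleton_le_iff_mem]
      exact Ideal.subset_span (by simp)
  have np : ∀ d f : ℤ, d * f = 210 → Int.gcd d f = 1 → 1 < d → d ≤ 30 → auxC w hw0 d ≠ 1 := by
    intro d f h1 h2 h3 h4 h5
    exact aux_nonprinc K w hw hrep hN d f h1 (co _ _ h2) h3 h4 ((ClassGroup.mk0_eq_one_iff _).mp h5)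
  let L : ∀ g : ClassGroup (𝓞 K), g * g = 1 → (ZMod 2 →+ Additive (ClassGroup (𝓞 K))) := fun g hg =>
    ZMod.lift 2 ⟨zmultiplesHom _ (Additive.ofMul g), by
      simp only [zmultiplesHom_apply]
      rw [show ((2 : ℕ) : ℤ) = 2 from rfl, two_zsmul]
      exact hg⟩
  have L0 : ∀ g hg, L g hg 0 = 0 := fun g hg => map_zero _
  have L1 : ∀ g hg, L g hg 1 = Additive.ofMul g := fun g hg => by
    have := ZMod.lift_coe 2 ⟨zmultiplesHom _ (Additive.ofMul g), by
      simp only [zmultiplesHom_apply]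
      rw [show ((2 : ℕ) : ℤ) = 2 from rfl, two_zsmul]
      exact hg⟩ 1
    simpa [L] using this
  let F : ZMod 2 × ZMod 2 × ZMod 2 →+ Additive (ClassGroup (𝓞 K)) :=
    (L _ s2).coprod ((L _ s3).coprod (L _ s5))
  have hF : ∀ a b c, F (a, b, c) = L _ s2 a + (L _ s3 b + L _ s5 c) := fun a b c => rfl
  have inj : Function.Injective F := by
    rw [injective_iff_map_eq_zero]
    rintro ⟨a, b, c⟩ h
    rw [hF] at h
    have z : ∀ x : ZMod 2, x = 0 ∨ x = 1 := by decide
    rcases z a with rfl | rfl <;> rcases z b with rfl | rfl <;> rcases z c with rfl | rfl <;>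
      simp only [L0, L1, zero_add, add_zero, ← ofMul_mul, c23, c25, c35, c235, ofMul_eq_zero] at h
    · rfl
    · exact absurd h (np 5 42 (by norm_num) (by norm_num) (by norm_num) (by norm_num))
    · exact absurd h (np 3 70 (by norm_num) (by norm_num) (by norm_num) (by norm_num))
    · exact absurd h (np 15 14 (by norm_num) (by norm_num) (by norm_num) (by norm_num))
    · exact absurd h (np 2 105 (by norm_num) (by norm_num) (by norm_num) (by norm_num))
    · exact absurd h (np 10 21 (by norm_num) (by norm_num) (by norm_num) (by norm_num))
    · exact absurd h (np 6 35 (by norm_num) (by norm_num) (by norm_num) (by norm_num))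
    · exact absurd h (np 30 7 (by norm_num) (by norm_num) (by norm_num) (by norm_num))
  have surj : Function.Surjective F := by
    let H : Subgroup (ClassGroup (𝓞 K)) := (AddMonoidHom.toMultiplicativeLeft F).range
    have hHm : ∀ a b c, (F (a, b, c)).toMul ∈ H := fun a b c => ⟨Multiplicative.ofAdd (a, b, c), rfl⟩
    have h2 : auxC w hw0 2 ∈ H := by simpa [hF, L0, L1] using hHm 1 0 0
    have h3 : auxC w hw0 3 ∈ H := by simpa [hF, L0, L1] using hHm 0 1 0
    have h5 : auxC w hw0 5 ∈ H := by simpa [hF, L0, L1] using hHm 0 0 1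
    have h7 : auxC w hw0 7 ∈ H := by
      rw [s210] at c2357
      rw [eq_inv_of_mul_eq_one_right c2357, ← c235, ← c35]
      exact H.inv_mem (H.mul_mem h2 (H.mul_mem h3 h5))
    have := aux_surj K w hw hrep hN H (by
      intro p hp h
      have key : auxC w hw0 p ∈ H := by
        rcases hp with rfl | rfl | rfl | rfl <;> assumption
      simpa [auxC] using key)
    intro g
    obtain ⟨x, hx⟩ := this g.toMul
    exact ⟨x.toAdd, hx⟩
  let E : (ZMod 2 × ZMod 2 × ZMod 2) ≃+ Additive (ClassGroup (𝓞 K)) :=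
    AddEquiv.ofBijective F ⟨inj, surj⟩
  let E' : ClassGroup (𝓞 K) ≃* Multiplicative (ZMod 2 × ZMod 2 × ZMod 2) :=
    (AddEquiv.toMultiplicativeLeft E).symm
  refine ⟨?_, ?_, ⟨E'⟩⟩
  · rw [Nat.card_congr E'.toEquiv, Nat.card_congr Multiplicative.toAdd]
    simp
  · intro g
    apply E'.injective
    rw [map_pow, map_one]
    have : ∀ x : ZMod 2 × ZMod 2 × ZMod 2, x + x = 0 := by decide
    rw [pow_two]
    exact this _
end

section
/- Let D > 1 be a squarefree positive integer with D ≡ 1 or 2 (mod 4), and suppose every element of the ideal class group of ℚ(√(−D)) has order dividing 2. Let G_D(ℚ) = {a + b√(−D) ∈ ℚ(√(−D)) : a, b ∈ ℚ, a² + D b² = 1}, a group under multiplication (the norm-one subgroup of the unit group of ℚ(√(−D))). Then G_D(ℚ) is isomorphic as a group to U × F, where U = {1, −1} is the group of order 2 and F is a free abelian group. -/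
theorem sub_free {ι : Type} (N : Submodule ℤ (ι →₀ ℤ)) : Module.Free ℤ N := by
  classical
  obtain ⟨_, _⟩ := exists_wellFoundedLT ι
  let L : ι → Submodule ℤ (ι →₀ ℤ) := fun i =>
    { carrier := {x | x ∈ N ∧ ∀ j, i < j → x j = 0}
      add_mem' := fun {a b} ha hb => ⟨N.add_mem ha.1 hb.1, fun j hj => by
        simp [ha.2 j hj, hb.2 j hj]⟩
      zero_mem' := ⟨N.zero_mem, fun j _ => rfl⟩
      smul_mem' := fun c x hx => ⟨N.smul_mem c hx.1, fun j hj => by simp [hx.2 j hj]⟩ }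
  let I : ι → Submodule ℤ ℤ := fun i => (L i).map (Finsupp.lapply i)
  have hgen : ∀ i, ∃ x ∈ L i, ∀ y ∈ L i, ∃ c : ℤ, y i = c * x i := by
    intro i
    obtain ⟨d, hd⟩ := (IsPrincipalIdealRing.principal (I i)).principal
    have hdm : d ∈ I i := by rw [hd]; exact Submodule.mem_span_singleton_self d
    obtain ⟨x, hx, hxd⟩ := hdm
    refine ⟨x, hx, fun y hy => ?_⟩
    have : y i ∈ I i := ⟨y, hy, rfl⟩
    rw [hd, Submodule.mem_span_singleton] at this
    obtain ⟨c, hc⟩ := this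
    refine ⟨c, ?_⟩
    have h2 : x i = d := hxd
    rw [h2, ← hc, smul_eq_mul]
  choose x hxL hx using hgen
  let J := {i : ι // x i i ≠ 0}
  let v : J → N := fun i => ⟨x i, (hxL i).1⟩
  have hli : LinearIndependent ℤ v := by
    rw [linearIndependent_iff]
    intro l hl
    by_contra hne
    have hs : l.support.Nonempty := Finsupp.support_nonempty_iff.mpr hne
    let m := l.support.max' hs
    have hm : l m ≠ 0 := Finsupp.mem_support_iff.mp (l.support.max'_mem hs)
    have h1 := congrArg (fun y : N => (y : ι →₀ ℤ) m) hl
    simp only [Finsupp.linearCombination_apply, Finsupp.sum] at h1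
    rw [Submodule.coe_sum, Finsupp.finsetSum_apply, Finset.sum_eq_single m] at h1
    · simp [v] at h1
      rcases h1 with h1 | h1
      · exact hm h1
      · exact m.2 h1
    · intro b hb hbm
      have : b < m := lt_of_le_of_ne (l.support.le_max' b hb) hbm
      have := (hxL b).2 m this
      simp [v, this]
    · intro h
      exact absurd (l.support.max'_mem hs) h
  have hsp : ∀ i, ∀ y : N, (y : ι →₀ ℤ) ∈ L i → y ∈ Submodule.span ℤ (Set.range v) := by
    intro i
    induction i using WellFoundedLT.induction with
    | ind i ih =>
      have key : ∀ y : N, (y : ι →₀ ℤ) ∈ L i → (y : ι →₀ ℤ) i = 0 →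
          y ∈ Submodule.span ℤ (Set.range v) := by
        intro y hy hyi
        by_cases h0 : (y : ι →₀ ℤ) = 0
        · have : y = 0 := Subtype.ext h0
          rw [this]; exact Submodule.zero_mem _
        · have hs := Finsupp.support_nonempty_iff.mpr h0
          have hmem := Finset.max'_mem _ hs
          set m := (y : ι →₀ ℤ).support.max' hs with hmdef
          rw [Finsupp.mem_support_iff] at hmem
          have hmi : m < i := by
            rcases lt_trichotomy m i with h | h | h
            · exact h
            · rw [h] at hmem; exact absurd hyi hmem
            · exact absurd (hy.2 m h) hmem
          refine ih m hmi y ⟨y.2, fun j hj => ?_⟩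
          by_contra hc
          exact absurd (Finset.le_max' _ j (Finsupp.mem_support_iff.mpr hc)) (not_le.mpr hj)
      intro y hy
      obtain ⟨c, hc⟩ := hx i y hy
      by_cases hz : x i i = 0
      · exact key y hy (by rw [hc, hz, mul_zero])
      · have h1 : y - c • v ⟨i, hz⟩ ∈ Submodule.span ℤ (Set.range v) := by
          apply key
          · exact (L i).sub_mem hy ((L i).smul_mem c (hxL i))
          · simp [v, hc]
        have h2 : c • v ⟨i, hz⟩ ∈ Submodule.span ℤ (Set.range v) :=
          Submodule.smul_mem _ _ (Submodule.subset_span ⟨_, rfl⟩)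
        simpa using Submodule.add_mem _ h1 h2
  refine Module.Free.of_basis (Module.Basis.mk hli ?_)
  intro y _
  by_cases h0 : (y : ι →₀ ℤ) = 0
  · have : y = 0 := Subtype.ext h0
    rw [this]; exact Submodule.zero_mem _
  · have hs := Finsupp.support_nonempty_iff.mpr h0
    refine hsp ((y : ι →₀ ℤ).support.max' hs) y ⟨y.2, fun j hj => ?_⟩
    by_contra hc
    exact absurd (Finset.le_max' _ j (Finsupp.mem_support_iff.mpr hc)) (not_le.mpr hj)

theorem split_free {ι G : Type} [CommGroup G] (f : Additive G →+ (ι →₀ ℤ)) (e : ℤˣ →* G)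
    (he : Function.Injective e) (hfe : ∀ u, f (Additive.ofMul (e u)) = 0)
    (hker : ∀ g, f (Additive.ofMul g) = 0 → ∃ u, e u = g) :
    ∃ κ : Type, Nonempty (G ≃* ℤˣ × Multiplicative (FreeAbelianGroup κ)) := by
  let F := f.toIntLinearMap
  have := sub_free (LinearMap.range F)
  obtain ⟨s, hs⟩ := Module.projective_lifting_property F.rangeRestrict LinearMap.id
    F.surjective_rangeRestrict
  let b := Module.Free.chooseBasis ℤ (LinearMap.range F)
  let E : FreeAbelianGroup (Module.Free.ChooseBasisIndex ℤ (LinearMap.range F)) ≃+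
      LinearMap.range F :=
    (FreeAbelianGroup.equivFinsupp _).trans b.repr.symm.toAddEquiv
  refine ⟨Module.Free.ChooseBasisIndex ℤ (LinearMap.range F), ⟨MulEquiv.symm ?_⟩⟩
  let t : Multiplicative (FreeAbelianGroup (Module.Free.ChooseBasisIndex ℤ (LinearMap.range F)))
      →* G := AddMonoidHom.toMultiplicativeLeft (s.toAddMonoidHom.comp E.toAddMonoidHom)
  have ht : ∀ m, f (Additive.ofMul (t m)) = (E m.toAdd : ι →₀ ℤ) := by
    intro m
    have := congrArg (fun g => ((g (E m.toAdd) : LinearMap.range F) : ι →₀ ℤ)) hs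
    exact this
  refine MulEquiv.ofBijective (e.coprod t) ⟨?_, ?_⟩
  · rw [injective_iff_map_eq_one]
    rintro ⟨u, m⟩ h
    rw [MonoidHom.coprod_apply] at h
    have h1 := congrArg (fun g => f (Additive.ofMul g)) h
    simp only [ofMul_mul, map_add, hfe, ht, ofMul_one, map_zero, zero_add] at h1
    have h2 : m.toAdd = 0 := by
      apply E.injective
      rw [map_zero]
      exact Subtype.ext h1
    have h3 : m = 1 := h2
    subst h3
    simp only [map_one, mul_one] at h
    rw [he (h.trans e.map_one.symm)]
    rfl
  · intro g
    let m := E.symm ⟨f (Additive.ofMul g), ⟨Additive.ofMul g, rfl⟩⟩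
    obtain ⟨u, hu⟩ := hker (g * (t (Multiplicative.ofAdd m))⁻¹) (by
      rw [ofMul_mul, ofMul_inv, map_add, map_neg, ht]
      simp [m])
    refine ⟨(u, Multiplicative.ofAdd m), ?_⟩
    rw [MonoidHom.coprod_apply, hu]
    simp

open FractionalIdeal IsDedekindDomain nonZeroDivisors in
/-- valuation vector -/
noncomputable def valVec (K : Type) [Field K] [NumberField K] :
    Additive Kˣ →+ (HeightOneSpectrum (NumberField.RingOfIntegers K) →₀ ℤ) where
  toFun u := Finsupp.ofSupportFinite
    (fun v => count K v (spanSingleton (NumberField.RingOfIntegers K)⁰ ((u.toMul : Kˣ) : K)))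
    (by
      have := finite_factors (spanSingleton (NumberField.RingOfIntegers K)⁰ ((u.toMul : Kˣ) : K))
      rw [Filter.eventually_cofinite] at this
      exact this)
  map_zero' := by
    ext v
    simp [Finsupp.ofSupportFinite, spanSingleton_one, count_one]
  map_add' a b := by
    ext v
    change count K v (spanSingleton _ (((a.toMul : Kˣ) : K) * ((b.toMul : Kˣ) : K))) =
      count K v (spanSingleton _ ((a.toMul : Kˣ) : K)) +
      count K v (spanSingleton _ ((b.toMul : Kˣ) : K))
    rw [← spanSingleton_mul_spanSingleton, count_mul]
    · exact spanSingleton_ne_zero_iff.mpr (Units.ne_zero _)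
    · exact spanSingleton_ne_zero_iff.mpr (Units.ne_zero _)

open FractionalIdeal IsDedekindDomain nonZeroDivisors in
theorem valVec_zero (K : Type) [Field K] [NumberField K] (u : Kˣ)
    (h : valVec K (Additive.ofMul u) = 0) : IsIntegral ℤ (u : K) := by
  have h1 : spanSingleton (NumberField.RingOfIntegers K)⁰ (u : K) = 1 := by
    rw [← finprod_heightOneSpectrum_factorization' K
      (I := spanSingleton (NumberField.RingOfIntegers K)⁰ (u : K)) (spanSingleton_ne_zero_iff.mpr (Units.ne_zero _))]
    apply finprod_eq_one_of_forall_eq_one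
    intro v
    have : count K v (spanSingleton (NumberField.RingOfIntegers K)⁰ (u : K)) = 0 :=
      DFunLike.congr_fun h v
    rw [this, zpow_zero]
  have h2 : (u : K) ∈ (1 : FractionalIdeal (NumberField.RingOfIntegers K)⁰ K) := by
    rw [← h1]; exact mem_spanSingleton_self _ _
  obtain ⟨z, hz⟩ := (mem_one_iff _).mp h2
  rw [← hz]
  exact z.2

theorem valVec_neg_one (K : Type) [Field K] [NumberField K] :
    valVec K (Additive.ofMul (-1)) = 0 := by
  have h : (2 : ℕ) • valVec K (Additive.ofMul (-1)) = 0 := by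
    rw [← map_nsmul, ← ofMul_pow]
    simp
  simpa using h

theorem rat_aux0 (D k : ℕ) (hD : Squarefree D) (hk : Squarefree k) (c : ℚ)
    (h : (D : ℚ) * c ^ 2 = k) : D = k := by
  have h1 : (D : ℤ) * c.num ^ 2 = c.den ^ 2 * k := by
    have h1 : c = c.num / c.den := (Rat.num_div_den _).symm
    have h2 : (c.den : ℚ) ≠ 0 := by simp
    rw [h1] at h
    field_simp at h
    exact_mod_cast h
  have h2 : D * c.num.natAbs ^ 2 = c.den ^ 2 * k := by
    have := congrArg Int.natAbs h1
    simpa [Int.natAbs_mul, Int.natAbs_pow] using this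
  have hcop : (c.num.natAbs ^ 2).Coprime (c.den ^ 2) := c.reduced.pow 2 2
  have h3 : c.num.natAbs ^ 2 ∣ k := hcop.dvd_of_dvd_mul_left (h2 ▸ Dvd.intro_left _ rfl)
  have h4 : c.den ^ 2 ∣ D := hcop.symm.dvd_of_dvd_mul_right (h2 ▸ Dvd.intro _ rfl)
  have h5 := Nat.isUnit_iff.mp (hk _ (by rwa [← sq]))
  have h6 := Nat.isUnit_iff.mp (hD _ (by rwa [← sq]))
  rw [h5, h6] at h2
  simpa using h2

theorem rat_aux (D : ℕ) (hD : 1 < D) (hsq : Squarefree D)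
    (hmod : D % 4 = 1 ∨ D % 4 = 2) (a b : ℚ) (h : a ^ 2 + (D : ℚ) * b ^ 2 = 1)
    (n : ℤ) (hn : 2 * a = n) : b = 0 := by
  have hD0 : (0 : ℚ) < D := by positivity
  have hb : 0 ≤ (D : ℚ) * b ^ 2 := by positivity
  have hn2 : n ^ 2 ≤ 4 := by
    have : (n : ℚ) ^ 2 ≤ 4 := by rw [← hn]; nlinarith
    exact_mod_cast this
  have hl : -2 ≤ n := by nlinarith
  have hu : n ≤ 2 := by nlinarith
  have hz : a ^ 2 = 1 → b = 0 := by
    intro h1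
    have : (D : ℚ) * b ^ 2 = 0 := by linarith
    simpa [hD0.ne'] using this
  have h3 : a ^ 2 = 1 / 4 → b = 0 := by
    intro h1
    have := rat_aux0 D 3 hsq Nat.prime_three.prime.squarefree (2 * b) (by
      push_cast; linear_combination 4 * h - 4 * h1)
    omega
  interval_cases n
  · exact hz (by have : a = -1 := by push_cast at hn; linarith
                 rw [this]; norm_num)
  · exact h3 (by have : a = -1 / 2 := by push_cast at hn; linarith
                 rw [this]; norm_num)
  · have ha : a = 0 := by push_cast at hn; linarith
    have := rat_aux0 D 1 hsq squarefree_one b (by push_cast; rw [ha] at h; linarith)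
    omega
  · exact h3 (by have : a = 1 / 2 := by push_cast at hn; linarith
                 rw [this]; norm_num)
  · exact hz (by have : a = 1 := by push_cast at hn; linarith
                 rw [this]; norm_num)


/-- Structure theorem for `G_D(ℚ)`: let `D > 1` be squarefree with `D ≡ 1` or
`2 (mod 4)`, and suppose every element of the ideal class group of `ℚ(√(-D))`
(formalized as any number field `K` generated over `ℚ` by a square root `ω` of
`-D`) has order dividing `2`. Then the norm-one group
`G_D(ℚ) = {a + bω : a, b ∈ ℚ, a² + D b² = 1}` is a subgroup of `Kˣ`
isomorphic to `U × F`, where `U = {1, -1}` (realized as `ℤˣ`) and `F` is a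
free abelian group. -/
theorem GDQ_structure (D : ℕ) (hD : 1 < D) (hsq : Squarefree D)
    (hmod : D % 4 = 1 ∨ D % 4 = 2)
    (K : Type) [Field K] [NumberField K] (ω : K) (hω : ω ^ 2 = -(D : K))
    (hgen : Algebra.adjoin ℚ {ω} = ⊤)
    (hcg : ∀ g : ClassGroup (NumberField.RingOfIntegers K), g ^ 2 = 1) :
    ∃ G : Subgroup Kˣ,
      ((G : Set Kˣ) = {u : Kˣ | ∃ a b : ℚ,
        (u : K) = (a : K) + (b : K) * ω ∧ a ^ 2 + (D : ℚ) * b ^ 2 = 1}) ∧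
      ∃ ι : Type, Nonempty (G ≃* ℤˣ × Multiplicative (FreeAbelianGroup ι)) := by
  let G : Subgroup Kˣ :=
    { carrier := {u : Kˣ | ∃ a b : ℚ,
        (u : K) = (a : K) + (b : K) * ω ∧ a ^ 2 + (D : ℚ) * b ^ 2 = 1}
      one_mem' := ⟨1, 0, by simp, by simp⟩
      mul_mem' := by
        rintro u w ⟨a, b, h1, h2⟩ ⟨c, d, h3, h4⟩
        refine ⟨a * c - D * b * d, a * d + b * c, ?_, ?_⟩
        · rw [Units.val_mul, h1, h3]
          push_cast
          linear_combination (b : K) * d * hω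
        · linear_combination (c ^ 2 + D * d ^ 2) * h2 + h4
      inv_mem' := by
        rintro u ⟨a, b, h1, h2⟩
        refine ⟨a, -b, ?_, by simpa using h2⟩
        rw [Units.val_inv_eq_inv_val]
        apply inv_eq_of_mul_eq_one_left
        have h2' : (a : K) ^ 2 + (D : K) * b ^ 2 = 1 := by exact_mod_cast h2
        rw [h1]
        push_cast
        linear_combination h2' - (b : K) ^ 2 * hω }
  refine ⟨G, rfl, ?_⟩
  have hneg : (-1 : Kˣ) ∈ G := ⟨-1, 0, by simp, by simp⟩
  let e0 : ℤˣ →* Kˣ := Units.map (Int.castRingHom K : ℤ →* K)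
  have e0neg : e0 (-1) = -1 := by ext; simp [e0]
  have he0 : ∀ u, e0 u ∈ G := by
    intro u
    rcases Int.units_eq_one_or u with rfl | rfl
    · rw [map_one]; exact G.one_mem
    · rw [e0neg]; exact hneg
  let e : ℤˣ →* G := e0.codRestrict G he0
  refine split_free ((valVec K).comp G.subtype.toAdditive) e ?_ ?_ ?_
  · intro u w huw
    have h : e0 u = e0 w := congrArg Subtype.val huw
    ext
    have := congrArg (fun z : Kˣ => (z : K)) h
    simpa [e0] using this
  · intro u
    change valVec K (Additive.ofMul (e0 u)) = 0
    rcases Int.units_eq_one_or u with rfl | rfl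
    · rw [map_one, ofMul_one, map_zero]
    · rw [e0neg, valVec_neg_one]
  · rintro ⟨u, hu⟩ h
    have h0 : valVec K (Additive.ofMul u) = 0 := h
    have h1 : valVec K (Additive.ofMul u⁻¹) = 0 := by rw [ofMul_inv, map_neg, h0, neg_zero]
    have i0 := valVec_zero K u h0
    have i1 := valVec_zero K u⁻¹ h1
    obtain ⟨a, b, hab, hn⟩ := id hu
    have hinv : ((u⁻¹ : Kˣ) : K) = a - b * ω := by
      rw [Units.val_inv_eq_inv_val]
      apply inv_eq_of_mul_eq_one_left
      have h2' : (a : K) ^ 2 + (D : K) * b ^ 2 = 1 := by exact_mod_cast hn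
      rw [hab]
      linear_combination h2' - (b : K) ^ 2 * hω
    have hint : IsIntegral ℤ (algebraMap ℚ K (2 * a)) := by
      have := i0.add i1
      rw [hab, hinv] at this
      have heq : algebraMap ℚ K (2 * a) = (a : K) + b * ω + (a - b * ω) := by
        rw [map_mul, eq_ratCast, eq_ratCast]
        push_cast
        ring
      rw [heq]
      exact this
    have hint2 : IsIntegral ℤ (2 * a) :=
      (isIntegral_algebraMap_iff (algebraMap ℚ K).injective).mp hint
    obtain ⟨n, hn2⟩ := IsIntegrallyClosed.isIntegral_iff.mp hint2
    have hb := rat_aux D hD hsq hmod a b hn n (by simpa using hn2.symm)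
    subst hb
    have ha : a = 1 ∨ a = -1 := by
      simpa using hn
    rcases ha with rfl | rfl
    · refine ⟨1, ?_⟩
      apply Subtype.ext
      rw [map_one]
      apply Units.ext
      rw [hab]
      simp
    · refine ⟨-1, ?_⟩
      apply Subtype.ext
      change e0 (-1) = u
      rw [e0neg]
      ext
      simp [hab]
end
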